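/- Let 13/14 < γ < 1 be fixed and ε > 0. Suppose α is irrational and a, q are integers with q ≥ 2, gcd(a,q) = 1, a ≠ 0 and |α − a/q| < 1/q². Set N = q^{29/(55−28γ)} and H = ⌊q^{1/2}⌋, and let h be an integer with 1 ≤ h ≤ H. Then for q sufficiently large, Σ = Σ_{p ≤ N} ( ψ(−(p+1)^γ) − ψ(−p^γ) ) e(αhp²) log p satisfies Σ ≪ N^{(15γ+13)/29 + ε}, where the sum is over primes p ≤ N and the implied constant depends only on γ and ε. -/

import Mathlib

/-- `e2pi x = e^{2πix}`. -/
noncomputable def e2pi (x : ℝ) : ℂ := Complex.exp (2 * Real.pi * Complex.I * x)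

/-- `psi t = {t} - 1/2`. -/
noncomputable def psi (t : ℝ) : ℝ := Int.fract t - 1 / 2

section

open Finset

lemma e2pi_add (x y : ℝ) : e2pi (x + y) = e2pi x * e2pi y := by
  simp only [e2pi, ← Complex.exp_add]
  congr 1; push_cast; ring

lemma norm_e2pi (x : ℝ) : ‖e2pi x‖ = 1 := by
  have : (2 * Real.pi * Complex.I * x : ℂ) = ((2 * Real.pi * x : ℝ) : ℂ) * Complex.I := by
    push_cast; ring
  rw [e2pi, this, Complex.norm_exp_ofReal_mul_I]

lemma e2pi_int (n : ℤ) : e2pi n = 1 := by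
  rw [e2pi, Complex.exp_eq_one_iff]
  exact ⟨n, by push_cast; ring⟩

lemma e2pi_neg (x : ℝ) : e2pi (-x) = starRingEnd ℂ (e2pi x) := by
  rw [e2pi, e2pi, ← Complex.exp_conj]
  congr 1
  simp [map_ofNat]

lemma e2pi_add_int (x : ℝ) (n : ℤ) : e2pi (x + n) = e2pi x := by
  rw [e2pi_add, e2pi_int, mul_one]

lemma e2pi_eq (x : ℝ) :
    e2pi x = (Real.cos (2 * Real.pi * x) : ℂ) + (Real.sin (2 * Real.pi * x) : ℂ) * Complex.I := by
  have : (2 * Real.pi * Complex.I * x : ℂ) = ((2 * Real.pi * x : ℝ) : ℂ) * Complex.I := by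
    push_cast; ring
  rw [e2pi, this, Complex.exp_mul_I, Complex.ofReal_cos, Complex.ofReal_sin]

lemma norm_sum_le_of_norm_le_one {ι : Type*} (s : Finset ι) (f : ι → ℂ) (hf : ∀ i ∈ s, ‖f i‖ ≤ 1) :
    ‖∑ i ∈ s, f i‖ ≤ #s := by
  calc _ ≤ ∑ i ∈ s, ‖f i‖ := norm_sum_le _ _
    _ ≤ ∑ i ∈ s, 1 := sum_le_sum hf
    _ = #s := by simp

lemma norm_sum_e2pi_le {ι : Type*} (s : Finset ι) (x : ι → ℝ) :
    ‖∑ k ∈ s, e2pi (x k)‖ ≤ #s :=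
  norm_sum_le_of_norm_le_one _ _ fun _ _ => (norm_e2pi _).le

/-- The first difference of a sequence. -/
def fdiff (x : ℕ → ℝ) (k : ℕ) : ℝ := x (k + 1) - x k

lemma two_mul_le_sin_pi {x ρ : ℝ} (h1 : ρ ≤ x) (h2 : x ≤ 1 - ρ) (hρ : 0 ≤ ρ) :
    2 * ρ ≤ Real.sin (Real.pi * x) := by
  have hpi := Real.pi_pos
  rcases le_total x (1 / 2) with h | h
  · have := Real.mul_le_sin (x := Real.pi * x) (by nlinarith) (by nlinarith)
    have e : 2 / Real.pi * (Real.pi * x) = 2 * x := by field_simp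
    linarith
  · have := Real.mul_le_sin (x := Real.pi * (1 - x)) (by nlinarith) (by nlinarith)
    have e : 2 / Real.pi * (Real.pi * (1 - x)) = 2 * (1 - x) := by field_simp
    have e2 : Real.sin (Real.pi * (1 - x)) = Real.sin (Real.pi * x) := by
      rw [mul_sub, mul_one, Real.sin_pi_sub]
    linarith

/-- `1 / (e(d) - 1)`, see `kl_mul`. -/
noncomputable def klFactor (d : ℝ) : ℂ :=
  -1 / 2 - (Real.cos (Real.pi * d) / (2 * Real.sin (Real.pi * d)) : ℝ) * Complex.I

lemma kl_mul {d : ℝ} (hd : Real.sin (Real.pi * d) ≠ 0) : (e2pi d - 1) * klFactor d = 1 := by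
  have hs := Real.sin_sq_add_cos_sq (Real.pi * d)
  have e1 : 2 * Real.pi * d = 2 * (Real.pi * d) := by ring
  rw [e2pi_eq, klFactor, e1, Real.cos_two_mul, Real.sin_two_mul]
  set s := Real.sin (Real.pi * d)
  set c := Real.cos (Real.pi * d)
  have hs' : (s : ℂ) ^ 2 + (c : ℂ) ^ 2 = 1 := by exact_mod_cast hs
  have hd' : (s : ℂ) ≠ 0 := by exact_mod_cast hd
  push_cast
  field_simp
  ring_nf
  simp only [Complex.I_sq]
  linear_combination (-(2 * c * Complex.I)) * hs'

lemma norm_klFactor {d : ℝ} (hd : 0 < Real.sin (Real.pi * d)) :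
    ‖klFactor d‖ = 1 / (2 * Real.sin (Real.pi * d)) := by
  have hs := Real.sin_sq_add_cos_sq (Real.pi * d)
  have h : ‖klFactor d‖ ^ 2 = (1 / (2 * Real.sin (Real.pi * d))) ^ 2 := by
    rw [← Complex.normSq_eq_norm_sq, Complex.normSq_apply]
    simp only [klFactor, Complex.sub_re, Complex.sub_im, Complex.mul_re, Complex.mul_im,
      Complex.I_re, Complex.I_im, Complex.ofReal_re, Complex.ofReal_im]
    set s := Real.sin (Real.pi * d)
    set c := Real.cos (Real.pi * d)
    norm_num
    field_simp
    linarith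
  exact (pow_left_inj₀ (norm_nonneg _) (by positivity) (by norm_num)).1 h

lemma norm_klFactor_sub {d d' : ℝ} (hd : 0 < Real.sin (Real.pi * d))
    (hd' : 0 < Real.sin (Real.pi * d')) (h1 : d ≤ d') (h2 : d' ≤ d + 1) :
    ‖klFactor d' - klFactor d‖ = (klFactor d').im - (klFactor d).im := by
  have hre : (klFactor d' - klFactor d).re = 0 := by
    simp only [klFactor, Complex.sub_re, Complex.mul_re,
      Complex.I_re, Complex.I_im, Complex.ofReal_re, Complex.ofReal_im]
    ring
  have hmono : (klFactor d).im ≤ (klFactor d').im := by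
    simp only [klFactor, Complex.sub_im, Complex.mul_im,
      Complex.I_re, Complex.I_im, Complex.ofReal_re, Complex.ofReal_im]
    have : 0 ≤ Real.sin (Real.pi * d' - Real.pi * d) := by
      have hpi := Real.pi_pos
      apply Real.sin_nonneg_of_nonneg_of_le_pi <;> nlinarith
    rw [Real.sin_sub] at this
    have e : Real.cos (Real.pi * d') / (2 * Real.sin (Real.pi * d')) ≤
        Real.cos (Real.pi * d) / (2 * Real.sin (Real.pi * d)) := by
      rw [div_le_div_iff₀ (by positivity) (by positivity)]
      linarith
    norm_num
    linarith
  have : klFactor d' - klFactor d = (((klFactor d').im - (klFactor d).im : ℝ) : ℂ) * Complex.I := by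
    apply Complex.ext
    · rw [hre]; simp
    · simp
  rw [this, norm_mul, Complex.norm_I, mul_one, Complex.norm_real, Real.norm_eq_abs, abs_of_nonneg]
  linarith

lemma kusmin_landau_of_mem_unit (x : ℕ → ℝ) (n : ℕ) (ρ : ℝ) (hρ : 0 < ρ)
    (hmono : ∀ k, k + 1 < n → fdiff x k ≤ fdiff x (k + 1))
    (h1 : ∀ k < n, ρ ≤ fdiff x k) (h2 : ∀ k < n, fdiff x k ≤ 1 - ρ) :
    ‖∑ k ∈ range n, e2pi (x k)‖ ≤ 1 / ρ := by
  have hsin : ∀ k < n, 2 * ρ ≤ Real.sin (Real.pi * fdiff x k) := fun k hk =>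
    two_mul_le_sin_pi (h1 k hk) (h2 k hk) hρ.le
  have hg : ∀ k < n, ‖klFactor (fdiff x k)‖ ≤ 1 / (4 * ρ) := by
    intro k hk
    have := hsin k hk
    rw [norm_klFactor (by linarith)]
    apply one_div_le_one_div_of_le <;> linarith
  have hstep : ∀ k < n, e2pi (x k) = (e2pi (x (k + 1)) - e2pi (x k)) * klFactor (fdiff x k) := by
    intro k hk
    have := kl_mul (d := fdiff x k) (by linarith [hsin k hk])
    have e : x (k + 1) = x k + fdiff x k := by simp [fdiff]
    rw [e, e2pi_add]
    linear_combination (-e2pi (x k)) * this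
  have key : ∀ m, m < n →
      ‖∑ k ∈ range (m + 1), e2pi (x k) - e2pi (x (m + 1)) * klFactor (fdiff x m)‖
      ≤ ‖klFactor (fdiff x 0)‖ + ((klFactor (fdiff x m)).im - (klFactor (fdiff x 0)).im) := by
    intro m
    induction m with
    | zero =>
      intro h0
      simp only [zero_add, range_one, sum_singleton, sub_self, add_zero]
      have := hstep 0 h0
      have e : e2pi (x 0) - e2pi (x 1) * klFactor (fdiff x 0) =
          -(e2pi (x 0) * klFactor (fdiff x 0)) := by
        linear_combination this
      rw [e, norm_neg, norm_mul, norm_e2pi, one_mul]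
    | succ m ih =>
      intro hm
      have ih' := ih (by omega)
      rw [sum_range_succ]
      have := hstep (m + 1) hm
      have e : ∑ k ∈ range (m + 1), e2pi (x k) + e2pi (x (m + 1)) -
          e2pi (x (m + 1 + 1)) * klFactor (fdiff x (m + 1)) =
          (∑ k ∈ range (m + 1), e2pi (x k) - e2pi (x (m + 1)) * klFactor (fdiff x m)) -
          e2pi (x (m + 1)) * (klFactor (fdiff x (m + 1)) - klFactor (fdiff x m)) := by
        linear_combination this
      rw [e]
      refine (norm_sub_le _ _).trans ?_
      rw [norm_mul, norm_e2pi, one_mul, norm_klFactor_sub (by linarith [hsin m (by omega)])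
        (by linarith [hsin (m + 1) hm]) (hmono m hm)
        (by linarith [h1 m (by omega), h2 (m + 1) hm])]
      linarith
  rcases Nat.eq_zero_or_pos n with rfl | hn
  · simp; positivity
  obtain ⟨m, rfl⟩ : ∃ m, n = m + 1 := ⟨n - 1, by omega⟩
  have k1 := key m (by omega)
  have k2 := hg m (by omega)
  have k3 := hg 0 (by omega)
  have k4 := (Complex.abs_im_le_norm (klFactor (fdiff x m)))
  have k5 := (Complex.abs_im_le_norm (klFactor (fdiff x 0)))
  have k6 : ‖∑ k ∈ range (m + 1), e2pi (x k)‖ ≤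
      ‖∑ k ∈ range (m + 1), e2pi (x k) - e2pi (x (m + 1)) * klFactor (fdiff x m)‖ +
        ‖klFactor (fdiff x m)‖ := by
    have := norm_add_le (∑ k ∈ range (m + 1), e2pi (x k) - e2pi (x (m + 1)) * klFactor (fdiff x m))
      (e2pi (x (m + 1)) * klFactor (fdiff x m))
    rwa [sub_add_cancel, norm_mul (e2pi _), norm_e2pi, one_mul] at this
  have k7 := le_abs_self (klFactor (fdiff x m)).im
  have k8 := neg_abs_le (klFactor (fdiff x 0)).im
  have : 1 / ρ = 4 * (1 / (4 * ρ)) := by field_simp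
  linarith

/-- Discrete Kusmin–Landau inequality. -/
lemma kusmin_landau (x : ℕ → ℝ) (n : ℕ) (ν : ℤ) (ρ : ℝ) (hρ : 0 < ρ)
    (hmono : ∀ k, k + 1 < n → fdiff x k ≤ fdiff x (k + 1))
    (h1 : ∀ k < n, ν + ρ ≤ fdiff x k) (h2 : ∀ k < n, fdiff x k ≤ ν + 1 - ρ) :
    ‖∑ k ∈ range n, e2pi (x k)‖ ≤ 1 / ρ := by
  have hd : ∀ k, fdiff (fun k => x k - ν * k) k = fdiff x k - ν := by
    intro k; simp only [fdiff]; push_cast; ring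
  have := kusmin_landau_of_mem_unit (fun k => x k - ν * k) n ρ hρ
    (fun k hk => by rw [hd, hd]; linarith [hmono k hk])
    (fun k hk => by rw [hd]; linarith [h1 k hk]) (fun k hk => by rw [hd]; linarith [h2 k hk])
  convert this using 3 with k
  have e := e2pi_add_int (x k) (-(ν * k))
  rw [← e]; congr 1; push_cast; ring

lemma exists_cut (d : ℕ → ℝ) (n : ℕ) (hmono : ∀ k, k + 1 < n → d k ≤ d (k + 1)) (T : ℝ) :
    ∃ m ≤ n, (∀ k < m, d k < T) ∧ ∀ k, m ≤ k → k < n → T ≤ d k := by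
  induction n with
  | zero => exact ⟨0, le_rfl, by simp, by simp⟩
  | succ n ih =>
    obtain ⟨m, hm, h1, h2⟩ := ih fun k hk => hmono k (by omega)
    by_cases hn : d n < T
    · have hmn : m = n := by
        by_contra hne
        have a := h2 (n - 1) (by omega) (by omega)
        have b := hmono (n - 1) (by omega)
        rw [show n - 1 + 1 = n by omega] at b
        linarith
      subst hmn
      refine ⟨m + 1, le_rfl, fun k hk => ?_, fun k hk hk' => by omega⟩
      rcases Nat.lt_succ_iff_lt_or_eq.1 hk with h | rfl
      · exact h1 k h
      · exact hn
    · refine ⟨m, by omega, h1, fun k hk hk' => ?_⟩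
      rcases Nat.lt_succ_iff_lt_or_eq.1 hk' with h | rfl
      · exact h2 k hk h
      · exact not_lt.1 hn

lemma step_mul_le (d : ℕ → ℝ) (n : ℕ) (μ : ℝ) (hstep : ∀ k, k + 1 < n → μ ≤ d (k + 1) - d k) :
    ∀ m < n, m * μ ≤ d m - d 0 := by
  intro m
  induction m with
  | zero => simp
  | succ m ih =>
    intro hm
    have := ih (by omega)
    have := hstep m hm
    push_cast
    linarith

lemma card_le_of_step (d : ℕ → ℝ) (n : ℕ) (μ A W : ℝ) (hμ : 0 < μ) (hW : 0 ≤ W)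
    (hstep : ∀ k, k + 1 < n → μ ≤ d (k + 1) - d k)
    (h1 : ∀ k < n, A ≤ d k) (h2 : ∀ k < n, d k ≤ A + W) : (n : ℝ) ≤ W / μ + 1 := by
  rcases Nat.eq_zero_or_pos n with rfl | hn
  · simp; positivity
  have := step_mul_le d n μ hstep (n - 1) (by omega)
  have a := h1 0 hn
  have b := h2 (n - 1) (by omega)
  rw [Nat.cast_sub hn, Nat.cast_one] at this
  have : (n : ℝ) - 1 ≤ W / μ := by rw [le_div_iff₀ hμ]; linarith
  linarith

lemma norm_sum_range_split (f : ℕ → ℂ) {m n : ℕ} (h : m ≤ n) :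
    ‖∑ k ∈ range n, f k‖ ≤ ‖∑ k ∈ range m, f k‖ + ‖∑ k ∈ range (n - m), f (m + k)‖ := by
  conv_lhs => rw [← Nat.add_sub_cancel' h, sum_range_add]
  exact norm_add_le _ _

lemma second_diff_unit (x : ℕ → ℝ) (n : ℕ) (ν : ℤ) (μ : ℝ) (hμ : 0 < μ)
    (hstep : ∀ k, k + 1 < n → μ ≤ fdiff x (k + 1) - fdiff x k)
    (h1 : ∀ k < n, ν ≤ fdiff x k) (h2 : ∀ k < n, fdiff x k ≤ ν + 1) :
    ‖∑ k ∈ range n, e2pi (x k)‖ ≤ 3 / √μ + 2 := by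
  set ρ := √μ with hρ
  have hρ0 : 0 < ρ := Real.sqrt_pos.2 hμ
  have hρμ : ρ / μ = 1 / ρ := by
    rw [div_eq_div_iff hμ.ne' hρ0.ne', ← sq, Real.sq_sqrt hμ.le, one_mul]
  have hmono : ∀ k, k + 1 < n → fdiff x k ≤ fdiff x (k + 1) := fun k hk => by
    linarith [hstep k hk]
  obtain ⟨m, hm, hm1, hm2⟩ := exists_cut (fdiff x) n hmono (ν + ρ)
  have hfd : ∀ c k, fdiff (fun k => x (c + k)) k = fdiff x (c + k) := fun c k => by
    simp [fdiff, add_assoc]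
  obtain ⟨m', hm', hm1', hm2'⟩ := exists_cut (fun k => fdiff x (m + k)) (n - m)
    (fun k hk => by simpa only [add_assoc] using hmono (m + k) (by omega)) (ν + 1 - ρ)
  have b1 : ‖∑ k ∈ range m, e2pi (x k)‖ ≤ 1 / ρ + 1 := by
    refine (norm_sum_e2pi_le _ _).trans ?_
    rw [card_range, ← hρμ]
    exact card_le_of_step (fdiff x) m μ ν ρ hμ hρ0.le (fun k hk => hstep k (by omega))
      (fun k hk => h1 k (by omega)) (fun k hk => (hm1 k hk).le)
  have b2 : ‖∑ k ∈ range m', e2pi (x (m + k))‖ ≤ 1 / ρ := by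
    refine kusmin_landau (fun k => x (m + k)) m' ν ρ hρ0 ?_ ?_ ?_
    · intro k hk
      rw [hfd, hfd]
      exact hmono (m + k) (by omega)
    · intro k hk
      rw [hfd]
      exact hm2 (m + k) (by omega) (by omega)
    · intro k hk
      rw [hfd]
      exact (hm1' k hk).le
  have b3 : ‖∑ k ∈ range (n - m - m'), e2pi (x (m + (m' + k)))‖ ≤ 1 / ρ + 1 := by
    refine (norm_sum_e2pi_le _ _).trans ?_
    rw [card_range, ← hρμ]
    refine card_le_of_step (fun k => fdiff x (m + (m' + k))) _ μ (ν + 1 - ρ) ρ hμ hρ0.le ?_ ?_ ?_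
    · intro k hk
      exact hstep (m + (m' + k)) (by omega)
    · intro k hk
      exact hm2' (m' + k) (by omega) (by omega)
    · intro k hk
      linarith [h2 (m + (m' + k)) (by omega)]
  have s1 := norm_sum_range_split (fun k => e2pi (x k)) hm
  have s2 := norm_sum_range_split (fun k => e2pi (x (m + k))) hm'
  have e : 3 / ρ = 3 * (1 / ρ) := by ring
  rw [e]
  linarith

lemma second_diff_of_integer_range (x : ℕ → ℝ) (μ : ℝ) (hμ : 0 < μ) (ν : ℤ) (W n : ℕ)
    (hstep : ∀ k, k + 1 < n → μ ≤ fdiff x (k + 1) - fdiff x k)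
    (h1 : ∀ k < n, ν ≤ fdiff x k) (h2 : ∀ k < n, fdiff x k < ν + W) :
    ‖∑ k ∈ range n, e2pi (x k)‖ ≤ W * (3 / √μ + 2) := by
  induction W generalizing n with
  | zero =>
    rcases Nat.eq_zero_or_pos n with rfl | hn
    · simp
    · have := h1 0 hn
      have := h2 0 hn
      simp at *; linarith
  | succ W ih =>
    obtain ⟨m, hm, hm1, hm2⟩ := exists_cut (fdiff x) n
      (fun k hk => by linarith [hstep k hk]) (ν + W)
    have s1 := norm_sum_range_split (fun k => e2pi (x k)) hm
    have i1 := ih m (fun k hk => hstep k (by omega)) (fun k hk => h1 k (by omega)) hm1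
    have hfd : ∀ c k, fdiff (fun k => x (c + k)) k = fdiff x (c + k) := fun c k => by
      simp [fdiff, add_assoc]
    have i2 := second_diff_unit (fun k => x (m + k)) (n - m) (ν + W) μ hμ
      (fun k hk => by rw [hfd, hfd]; exact hstep (m + k) (by omega))
      (fun k hk => by rw [hfd]; push_cast; exact hm2 (m + k) (by omega) (by omega))
      (fun k hk => by
        rw [hfd]; have := h2 (m + k) (by omega); push_cast at *; linarith)
    push_cast
    linarith

/-- Discrete second-difference (van der Corput) test. -/
lemma second_diff_test (x : ℕ → ℝ) (n : ℕ) (μ A W : ℝ) (hμ : 0 < μ) (hW : 0 ≤ W)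
    (hstep : ∀ k, k + 1 < n → μ ≤ fdiff x (k + 1) - fdiff x k)
    (h1 : ∀ k < n, A ≤ fdiff x k) (h2 : ∀ k < n, fdiff x k ≤ A + W) :
    ‖∑ k ∈ range n, e2pi (x k)‖ ≤ (W + 2) * (3 / √μ + 2) := by
  have key := second_diff_of_integer_range x μ hμ ⌊A⌋ (⌊W⌋₊ + 2) n hstep
    (fun k hk => (Int.floor_le A).trans (h1 k hk))
    (fun k hk => by
      have := h2 k hk
      have := Int.lt_floor_add_one A
      have := Nat.lt_floor_add_one W
      push_cast
      linarith)
  refine key.trans ?_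
  push_cast
  gcongr
  exact Nat.floor_le hW

lemma sum_triangle_diag {A : Type*} [AddCommMonoid A] (G : ℕ → ℕ → A) (L M : ℕ) (h : L ≤ M) :
    ∑ l ∈ range L, ∑ k ∈ range l, G k l = ∑ d ∈ Ico 1 M, ∑ k ∈ range (L - d), G k (k + d) := by
  induction L with
  | zero => simp
  | succ L ih =>
    rw [sum_range_succ, ih (by omega)]
    have h1 : ∑ k ∈ range L, G k L = ∑ d ∈ Ico 1 M, if d ≤ L then G (L - d) L else 0 := by
      rw [← sum_filter]
      symm
      refine sum_bij' (fun d _ => L - d) (fun k _ => L - k) ?_ ?_ ?_ ?_ ?_ <;>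
        simp only [mem_filter, mem_Ico, mem_range] <;> intros <;> first | omega | trivial
    rw [h1, ← sum_add_distrib]
    refine sum_congr rfl fun d hd => ?_
    rw [mem_Ico] at hd
    split_ifs with hdL
    · rw [show L + 1 - d = L - d + 1 by omega, sum_range_succ, show L - d + d = L by omega]
    · rw [show L + 1 - d = 0 by omega, show L - d = 0 by omega]; simp

lemma sum_square_diag {A : Type*} [AddCommMonoid A] (G : ℕ → ℕ → A) (L M : ℕ) (h : L ≤ M) :
    ∑ k ∈ range L, ∑ l ∈ range L, G k l = ∑ k ∈ range L, G k k +
      ∑ d ∈ Ico 1 M, ∑ k ∈ range (L - d), (G k (k + d) + G (k + d) k) := by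
  rw [← sum_triangle_diag (fun k l => G k l + G l k) L M h]
  clear h
  induction L with
  | zero => simp
  | succ L ih =>
    simp only [sum_range_succ, sum_add_distrib] at ih ⊢
    rw [ih]
    abel

lemma card_window (L D k d : ℕ) (h : k + d < L) :
    #{m ∈ range (L + D) | (k ≤ m ∧ m < k + D) ∧ (k + d ≤ m ∧ m < k + d + D)} = D - d := by
  have : {m ∈ range (L + D) | (k ≤ m ∧ m < k + D) ∧ (k + d ≤ m ∧ m < k + d + D)} =
      Ico (k + d) (k + D) := by
    ext m; simp only [mem_filter, mem_range, mem_Ico]; omega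
  rw [this, Nat.card_Ico]; omega

open scoped ComplexInnerProductSpace in
/-- The van der Corput inequality in an inner product space. -/
lemma vdc_inequality {E : Type*} [NormedAddCommGroup E] [InnerProductSpace ℂ E] (z : ℕ → E)
    (L D : ℕ) (hD : 1 ≤ D) :
    D * ‖∑ k ∈ range L, z k‖ ^ 2 ≤ (L + D) * (∑ k ∈ range L, ‖z k‖ ^ 2 +
      2 * ∑ d ∈ Ico 1 D, ‖∑ k ∈ range (L - d), inner ℂ (z k) (z (k + d))‖) := by
  classical
  set w : ℕ → E := fun m => ∑ k ∈ range L, if k ≤ m ∧ m < k + D then z k else 0 with hw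
  set c : ℕ → ℝ := fun d => ‖∑ k ∈ range (L - d), inner ℂ (z k) (z (k + d))‖ with hc
  have hsum : ∑ m ∈ range (L + D), w m = (D : ℂ) • ∑ k ∈ range L, z k := by
    simp only [hw]
    rw [sum_comm, smul_sum]
    refine sum_congr rfl fun k hk => ?_
    rw [mem_range] at hk
    rw [← sum_filter, sum_const]
    have := card_window L D k 0 hk
    simp only [add_zero, and_self, Nat.sub_zero] at this
    rw [this, Nat.cast_smul_eq_nsmul]
  have hcs : ‖∑ m ∈ range (L + D), w m‖ ^ 2 ≤ (L + D) * ∑ m ∈ range (L + D), ‖w m‖ ^ 2 := by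
    have h1 : ‖∑ m ∈ range (L + D), w m‖ ^ 2 ≤ (∑ m ∈ range (L + D), ‖w m‖) ^ 2 := by
      gcongr; exact norm_sum_le _ _
    refine h1.trans ?_
    have := sq_sum_le_card_mul_sum_sq (s := range (L + D)) (f := fun m => ‖w m‖)
    simpa using this
  have hF : ((∑ m ∈ range (L + D), ‖w m‖ ^ 2 : ℝ) : ℂ) =
      ∑ k ∈ range L, ∑ l ∈ range L,
        (#{m ∈ range (L + D) | (k ≤ m ∧ m < k + D) ∧ (l ≤ m ∧ m < l + D)} : ℂ) *
          inner ℂ (z k) (z l) := by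
    push_cast
    have : ∀ m, (‖w m‖ : ℂ) ^ 2 = ∑ k ∈ range L, ∑ l ∈ range L,
        if (k ≤ m ∧ m < k + D) ∧ (l ≤ m ∧ m < l + D) then inner ℂ (z k) (z l) else 0 := by
      intro m
      rw [← Complex.coe_algebraMap]
      have h0 := inner_self_eq_norm_sq_to_K (𝕜 := ℂ) (w m)
      rw [Complex.coe_algebraMap]
      refine Eq.trans h0.symm ?_
      simp only [hw, sum_inner, inner_sum]
      rw [sum_comm]
      refine sum_congr rfl fun k _ => sum_congr rfl fun l _ => ?_
      by_cases h1 : k ≤ m ∧ m < k + D <;> by_cases h2 : l ≤ m ∧ m < l + D <;> simp [h1, h2]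
    simp only [this]
    rw [sum_comm]
    refine sum_congr rfl fun k _ => ?_
    rw [sum_comm]
    refine sum_congr rfl fun l _ => ?_
    rw [← sum_filter, sum_const, nsmul_eq_mul]
  have hW : ∑ m ∈ range (L + D), ‖w m‖ ^ 2 ≤ D * ∑ k ∈ range L, ‖z k‖ ^ 2 +
      2 * (D * ∑ d ∈ Ico 1 D, c d) := by
    have h0 : ∑ m ∈ range (L + D), ‖w m‖ ^ 2 =
        ‖((∑ m ∈ range (L + D), ‖w m‖ ^ 2 : ℝ) : ℂ)‖ := by
      rw [Complex.norm_real, Real.norm_of_nonneg]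
      positivity
    rw [h0, hF, sum_square_diag _ L (L + D) (by omega)]
    refine (norm_add_le _ _).trans (add_le_add ?_ ?_)
    · refine (norm_sum_le _ _).trans ?_
      rw [mul_sum]
      refine sum_le_sum fun k hk => ?_
      rw [mem_range] at hk
      have := card_window L D k 0 hk
      simp only [add_zero, Nat.sub_zero] at this
      rw [this, norm_mul, Complex.norm_natCast]
      gcongr
      exact (norm_inner_le_norm _ _).trans (by rw [sq])
    · refine (norm_sum_le _ _).trans ?_
      have hterm : ∀ d ∈ Ico 1 (L + D), ‖∑ k ∈ range (L - d),
          ((#{m ∈ range (L + D) | (k ≤ m ∧ m < k + D) ∧ (k + d ≤ m ∧ m < k + d + D)} : ℂ) *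
            inner ℂ (z k) (z (k + d)) +
          (#{m ∈ range (L + D) | (k + d ≤ m ∧ m < k + d + D) ∧ (k ≤ m ∧ m < k + D)} : ℂ) *
            inner ℂ (z (k + d)) (z k))‖ ≤ 2 * ((D - d : ℕ) * c d) := by
        intro d _
        have e1 : ∀ k ∈ range (L - d),
          ((#{m ∈ range (L + D) | (k ≤ m ∧ m < k + D) ∧ (k + d ≤ m ∧ m < k + d + D)} : ℂ) *
            inner ℂ (z k) (z (k + d)) +
          (#{m ∈ range (L + D) | (k + d ≤ m ∧ m < k + d + D) ∧ (k ≤ m ∧ m < k + D)} : ℂ) *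
            inner ℂ (z (k + d)) (z k)) = ((D - d : ℕ) : ℂ) * inner ℂ (z k) (z (k + d)) +
              ((D - d : ℕ) : ℂ) * starRingEnd ℂ (inner ℂ (z k) (z (k + d))) := by
          intro k hk
          rw [mem_range] at hk
          have h1 := card_window L D k d (by omega)
          have h2 : #{m ∈ range (L + D) | (k + d ≤ m ∧ m < k + d + D) ∧ (k ≤ m ∧ m < k + D)} =
              D - d := by
            rw [← h1]; congr 1; ext m; simp only [mem_filter]; tauto
          rw [h1, h2, inner_conj_symm]
        rw [sum_congr rfl e1, sum_add_distrib, ← mul_sum, ← mul_sum, ← map_sum]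
        refine (norm_add_le _ _).trans (le_of_eq ?_)
        rw [norm_mul, norm_mul, Complex.norm_natCast, RCLike.norm_conj, ← two_mul]
      refine (sum_le_sum hterm).trans ?_
      rw [← mul_sum]
      gcongr
      rw [mul_sum]
      have hsub : Ico 1 D ⊆ Ico 1 (L + D) := Ico_subset_Ico_right (by omega)
      rw [← sum_subset hsub]
      · refine sum_le_sum fun d _ => ?_
        gcongr
        omega
      · intro d hd hd'
        rw [mem_Ico] at hd hd'
        rw [show D - d = 0 by omega]; simp
  rw [hsum, norm_smul, Complex.norm_natCast, mul_pow] at hcs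
  have hD' : (0 : ℝ) < D := by exact_mod_cast hD
  have h1 := hcs.trans (mul_le_mul_of_nonneg_left hW (by positivity))
  refine le_of_mul_le_mul_left ?_ hD'
  calc (D : ℝ) * (D * ‖∑ k ∈ range L, z k‖ ^ 2) = D ^ 2 * ‖∑ k ∈ range L, z k‖ ^ 2 := by ring
    _ ≤ _ := h1
    _ = _ := by ring

lemma e2pi_nat_mul (n : ℕ) (x : ℝ) : e2pi (n * x) = e2pi x ^ n := by
  rw [e2pi, e2pi, ← Complex.exp_nat_mul]
  congr 1; push_cast; ring

lemma e2pi_eq_one_iff (x : ℝ) : e2pi x = 1 ↔ ∃ n : ℤ, x = n := by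
  refine ⟨fun h => ?_, fun ⟨n, hn⟩ => hn ▸ e2pi_int n⟩
  rw [e2pi, Complex.exp_eq_one_iff] at h
  obtain ⟨n, hn⟩ := h
  refine ⟨n, ?_⟩
  have h2 : (2 * Real.pi * Complex.I : ℂ) ≠ 0 := Complex.two_pi_I_ne_zero
  have h3 : (x : ℂ) = n := mul_left_cancel₀ h2 (by rw [hn]; ring)
  exact_mod_cast h3

lemma sum_e2pi_div (r : ℕ) (hr : 1 ≤ r) (m : ℤ) :
    ∑ j ∈ range r, e2pi (m * j / r) = if (r : ℤ) ∣ m then (r : ℂ) else 0 := by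
  have hr0 : (r : ℝ) ≠ 0 := by positivity
  have h1 : ∀ j ∈ range r, e2pi (m * j / r) = e2pi (m / r) ^ j := fun j _ => by
    rw [← e2pi_nat_mul]; congr 1; ring
  rw [sum_congr rfl h1]
  split_ifs with h
  · obtain ⟨c, rfl⟩ := h
    have : e2pi (((r * c : ℤ) : ℝ) / r) = 1 := by
      rw [e2pi_eq_one_iff]; exact ⟨c, by push_cast; field_simp⟩
    rw [this]; simp
  · have hne : e2pi (m / r) ≠ 1 := by
      intro h1
      obtain ⟨c, hc⟩ := (e2pi_eq_one_iff _).1 h1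
      refine h ⟨c, ?_⟩
      rw [div_eq_iff hr0] at hc
      have : (m : ℝ) = ((r * c : ℤ) : ℝ) := by push_cast; linarith
      exact_mod_cast this
    rw [geom_sum_eq hne, ← e2pi_nat_mul, mul_div_cancel₀ _ hr0, e2pi_int, sub_self, zero_div]

lemma sum_norm_sq_residue (r : ℕ) (hr : 1 ≤ r) (n : ℕ) (w : ℕ → ℂ) :
    ∑ j ∈ range r, ‖∑ k ∈ range n, w k * e2pi (k * (j / r))‖ ^ 2 =
      r * ∑ c ∈ range r, ‖∑ k ∈ range n with k % r = c, w k‖ ^ 2 := by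
  have hsq : ∀ u : ℂ, ((‖u‖ ^ 2 : ℝ) : ℂ) = u * starRingEnd ℂ u := fun u => by
    rw [Complex.mul_conj, Complex.normSq_eq_norm_sq]
  have hL : ((∑ j ∈ range r, ‖∑ k ∈ range n, w k * e2pi (k * (j / r))‖ ^ 2 : ℝ) : ℂ) =
      ∑ k ∈ range n, ∑ l ∈ range n, (w k * starRingEnd ℂ (w l)) *
        (if (r : ℤ) ∣ ((k : ℤ) - l) then (r : ℂ) else 0) := by
    rw [Complex.ofReal_sum]
    simp only [hsq, map_sum, sum_mul_sum]
    rw [sum_comm]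
    refine sum_congr rfl fun k _ => ?_
    rw [sum_comm]
    refine sum_congr rfl fun l _ => ?_
    rw [← sum_e2pi_div r hr, mul_sum]
    refine sum_congr rfl fun j _ => ?_
    rw [map_mul, ← e2pi_neg]
    have : (((k : ℤ) - l : ℤ) : ℝ) * j / r = k * (j / r) + -(l * (j / r)) := by push_cast; ring
    rw [this, e2pi_add]; ring
  have hR : ((r * ∑ c ∈ range r, ‖∑ k ∈ range n with k % r = c, w k‖ ^ 2 : ℝ) : ℂ) =
      ∑ k ∈ range n, ∑ l ∈ range n, (w k * starRingEnd ℂ (w l)) *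
        (if (r : ℤ) ∣ ((k : ℤ) - l) then (r : ℂ) else 0) := by
    rw [Complex.ofReal_mul, Complex.ofReal_sum]
    simp only [hsq, map_sum, sum_mul_sum, sum_filter]
    rw [sum_comm, mul_sum]
    refine sum_congr rfl fun k _ => ?_
    rw [sum_comm, mul_sum]
    refine sum_congr rfl fun l _ => ?_
    have hiff : (r : ℤ) ∣ ((k : ℤ) - l) ↔ k % r = l % r := by
      rw [Int.dvd_iff_emod_eq_zero, ← Int.emod_eq_emod_iff_emod_sub_eq_zero]
      norm_cast
    rw [sum_eq_single (k % r)]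
    · by_cases h : k % r = l % r
      · simp [hiff, h]; ring
      · have h' : ¬ l % r = k % r := fun h2 => h h2.symm
        simp [hiff, h, h']
    · intro c _ hc
      simp [hc.symm]
    · intro h
      exact absurd (mem_range.2 (Nat.mod_lt _ hr)) h
  exact_mod_cast hL.trans hR.symm

lemma periodic_mod (p : ℕ → ℂ) (r : ℕ) (hp : ∀ k, p (k + r) = p k) (k : ℕ) : p (k % r) = p k :=
  Function.Periodic.map_mod_nat (f := p) hp k

/-- Removing a periodic twist by completion. -/
lemma periodic_twist (r : ℕ) (hr : 1 ≤ r) (n : ℕ) (p w : ℕ → ℂ) (hp : ∀ k, p (k + r) = p k)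
    (hp1 : ∀ k, ‖p k‖ ≤ 1) (B : ℝ)
    (hB : ∀ β : ℝ, ‖∑ k ∈ range n, w k * e2pi (k * β)‖ ≤ B) :
    ‖∑ k ∈ range n, p k * w k‖ ≤ √r * B := by
  have hB0 : 0 ≤ B := (norm_nonneg _).trans (hB 0)
  have h1 : ∑ k ∈ range n, p k * w k =
      ∑ c ∈ range r, p c * ∑ k ∈ range n with k % r = c, w k := by
    rw [← sum_fiberwise_of_maps_to (t := range r) (g := fun k => k % r)
      (fun k _ => mem_range.2 (Nat.mod_lt _ hr))]
    refine sum_congr rfl fun c _ => ?_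
    rw [mul_sum]
    refine sum_congr rfl fun k hk => ?_
    rw [mem_filter] at hk
    rw [← hk.2, periodic_mod p r hp]
  have h2 : ‖∑ k ∈ range n, p k * w k‖ ^ 2 ≤
      r * ∑ c ∈ range r, ‖∑ k ∈ range n with k % r = c, w k‖ ^ 2 := by
    rw [h1]
    have : ‖∑ c ∈ range r, p c * ∑ k ∈ range n with k % r = c, w k‖ ≤
        ∑ c ∈ range r, ‖∑ k ∈ range n with k % r = c, w k‖ := by
      refine (norm_sum_le _ _).trans (sum_le_sum fun c _ => ?_)
      rw [norm_mul]
      exact mul_le_of_le_one_left (norm_nonneg _) (hp1 c)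
    refine (pow_le_pow_left₀ (norm_nonneg _) this 2).trans ?_
    simpa using sq_sum_le_card_mul_sum_sq (s := range r)
      (f := fun c => ‖∑ k ∈ range n with k % r = c, w k‖)
  rw [← sum_norm_sq_residue r hr] at h2
  have h3 : ∑ j ∈ range r, ‖∑ k ∈ range n, w k * e2pi (k * (j / r))‖ ^ 2 ≤ r * B ^ 2 := by
    calc _ ≤ ∑ j ∈ range r, B ^ 2 := sum_le_sum fun j _ => by
          gcongr; exact hB _
      _ = _ := by simp
  refine abs_le_of_sq_le_sq' ?_ (by positivity) |>.2
  rw [mul_pow, Real.sq_sqrt (by positivity)]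
  exact h2.trans h3

lemma twisted_block (z : ℕ → ℝ) (n : ℕ) (L μ β : ℝ) (hn : n ≤ L) (hμ : 0 < μ) (hμ4 : μ ≤ 4)
    (h1 : ∀ k < n, μ / 2 ≤ fdiff (fdiff z) k) (h2 : ∀ k < n, fdiff (fdiff z) k ≤ μ) :
    ‖∑ k ∈ range n, e2pi (z k) * e2pi (k * β)‖ ≤ 17 * (L * √μ + 1 / √μ) := by
  have hL : 0 ≤ L := (Nat.cast_nonneg n).trans hn
  have hf : ∀ k, fdiff (fun k => z k + k * β) k = fdiff z k + β := fun k => by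
    simp only [fdiff]; push_cast; ring
  have hup : ∀ k < n, fdiff z k ≤ fdiff z 0 + k * μ := by
    intro k
    induction k with
    | zero => simp
    | succ k ih =>
      intro hk
      have a := ih (by omega)
      have b := h2 k (by omega)
      rw [fdiff] at b
      push_cast; linarith
  have hlo : ∀ k < n, fdiff z 0 ≤ fdiff z k := by
    intro k
    induction k with
    | zero => simp
    | succ k ih =>
      intro hk
      have a := ih (by omega)
      have b := h1 k (by omega)
      rw [fdiff] at b
      linarith
  have key := second_diff_test (fun k => z k + k * β) n (μ / 2) (fdiff z 0 + β) (L * μ)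
    (by positivity) (by positivity)
    (fun k hk => by rw [hf, hf]; have := h1 k (by omega); rw [fdiff] at this; linarith)
    (fun k hk => by rw [hf]; linarith [hlo k hk])
    (fun k hk => by
      rw [hf]
      have : (k : ℝ) ≤ L := le_trans (by exact_mod_cast hk.le) hn
      nlinarith [hup k hk])
  simp only [e2pi_add] at key
  refine key.trans ?_
  set s := √μ with hs
  have hs0 : 0 < s := Real.sqrt_pos.2 hμ
  have hsq : μ = s ^ 2 := (Real.sq_sqrt hμ.le).symm
  have hs2 : s ≤ 2 := by nlinarith
  have h3 : 3 / √(μ / 2) ≤ 4.25 / s := by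
    rw [div_le_div_iff₀ (Real.sqrt_pos.2 (by positivity)) hs0]
    have : s * (12 / 17) ≤ √(μ / 2) := Real.le_sqrt_of_sq_le (by rw [hsq]; nlinarith)
    linarith
  calc (L * μ + 2) * (3 / √(μ / 2) + 2) ≤ (L * μ + 2) * (4.25 / s + 2) := by gcongr
    _ = 4.25 * (L * s) + 2 * s * (L * s) + (8.5 / s + 4) := by rw [hsq]; field_simp; ring
    _ ≤ 4.25 * (L * s) + 4 * (L * s) + (8.5 / s + 8 / s) := by
        have : 4 ≤ 8 / s := by rw [le_div_iff₀ hs0]; linarith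
        gcongr
        linarith
    _ ≤ 17 * (L * s + 1 / s) := by
        have e : 8.5 / s + 8 / s = 16.5 * (1 / s) := by ring
        rw [e]
        nlinarith [mul_nonneg hL hs0.le, one_div_pos.2 hs0]

lemma twisted_block_neg (z : ℕ → ℝ) (n : ℕ) (L μ β : ℝ) (hn : n ≤ L) (hμ : 0 < μ) (hμ4 : μ ≤ 4)
    (h1 : ∀ k < n, -μ ≤ fdiff (fdiff z) k) (h2 : ∀ k < n, fdiff (fdiff z) k ≤ -(μ / 2)) :
    ‖∑ k ∈ range n, e2pi (z k) * e2pi (k * β)‖ ≤ 17 * (L * √μ + 1 / √μ) := by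
  have hf : ∀ k, fdiff (fdiff fun k => - z k) k = - fdiff (fdiff z) k := fun k => by
    simp only [fdiff]; ring
  have := twisted_block (fun k => - z k) n L μ (-β) hn hμ hμ4
    (fun k hk => by rw [hf]; linarith [h2 k hk]) (fun k hk => by rw [hf]; linarith [h1 k hk])
  simp only [mul_neg, e2pi_neg, ← map_mul, ← map_sum, RCLike.norm_conj] at this
  exact this

lemma fdiff_fdiff_shift (x : ℕ → ℝ) (c k : ℕ) :
    fdiff (fdiff fun k => x (c + k)) k = fdiff (fdiff x) (c + k) := by
  simp [fdiff, add_assoc]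

lemma norm_sum_twist_le (s : Finset ℕ) (p : ℕ → ℂ) (z : ℕ → ℝ) (hp1 : ∀ k, ‖p k‖ ≤ 1) :
    ‖∑ k ∈ s, p k * e2pi (z k)‖ ≤ #s :=
  norm_sum_le_of_norm_le_one _ _ fun k _ => by rw [norm_mul, norm_e2pi, mul_one]; exact hp1 k

lemma dyadic_twisted_pow (r : ℕ) (hr : 1 ≤ r) (L τ lam : ℝ) (hτ : 0 < τ) (hlam : 0 < lam) (K : ℕ)
    (hK : 2 ^ K * τ ≤ 4) (n : ℕ) (hn : n ≤ L) (z : ℕ → ℝ) (p : ℕ → ℂ)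
    (hp : ∀ k, p (k + r) = p k) (hp1 : ∀ k, ‖p k‖ ≤ 1)
    (h1 : ∀ k < n, -(2 ^ K * τ) ≤ fdiff (fdiff z) k) (h2 : ∀ k < n, fdiff (fdiff z) k ≤ 2 ^ K * τ)
    (h3 : ∀ k, k + 1 < n → lam ≤ fdiff (fdiff z) (k + 1) - fdiff (fdiff z) k) :
    ‖∑ k ∈ range n, p k * e2pi (z k)‖ ≤
      K * (34 * (√r * (L * √(2 ^ K * τ) + 1 / √τ))) + (2 * τ / lam + 1) := by
  have hL : 0 ≤ L := (Nat.cast_nonneg n).trans hn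
  induction K generalizing n z p with
  | zero =>
    refine (norm_sum_twist_le _ p z hp1).trans ?_
    rw [card_range]
    simp only [pow_zero, one_mul] at *
    have := card_le_of_step (fdiff (fdiff z)) n lam (-τ) (2 * τ) hlam (by positivity) h3 h1
      (fun k hk => by linarith [h2 k hk])
    simpa using this
  | succ K ih =>
    have hsplit : (2 : ℝ) ^ (K + 1) * τ = 2 * (2 ^ K * τ) := by ring
    set M := (2 : ℝ) ^ K * τ with hM
    have hM0 : 0 < M := by positivity
    have hMτ : τ ≤ 2 * M := by
      have : (1 : ℝ) ≤ 2 ^ K := one_le_pow₀ (by norm_num)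
      nlinarith
    rw [hsplit] at hK h1 h2 ⊢
    have hmono : ∀ k, k + 1 < n → fdiff (fdiff z) k ≤ fdiff (fdiff z) (k + 1) := fun k hk => by
      linarith [h3 k hk]
    obtain ⟨m, hm, hm1, hm2⟩ := exists_cut (fdiff (fdiff z)) n hmono (-M)
    obtain ⟨m', hm', hm1', hm2'⟩ := exists_cut (fun k => fdiff (fdiff z) (m + k)) (n - m)
      (fun k hk => by simpa only [add_assoc] using hmono (m + k) (by omega)) M
    have hcast : ∀ {a : ℕ}, a ≤ n → (a : ℝ) ≤ L := fun h => le_trans (by exact_mod_cast h) hn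
    have b1 : ‖∑ k ∈ range m, p k * e2pi (z k)‖ ≤
        √r * (17 * (L * √(2 * M) + 1 / √(2 * M))) := by
      refine periodic_twist r hr m p _ hp hp1 _ fun β => ?_
      refine twisted_block_neg z m L (2 * M) β (hcast hm) (by positivity) hK
        (fun k hk => h1 k (by omega)) (fun k hk => ?_)
      linarith [hm1 k hk]
    have b2 := ih (by linarith) m' (hcast (by omega)) (fun k => z (m + k)) (fun k => p (m + k))
      (fun k => by rw [← add_assoc, hp]) (fun k => hp1 _)
      (fun k hk => by rw [fdiff_fdiff_shift]; exact hm2 (m + k) (by omega) (by omega))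
      (fun k hk => by rw [fdiff_fdiff_shift]; exact (hm1' k hk).le)
      (fun k hk => by rw [fdiff_fdiff_shift, fdiff_fdiff_shift]; exact h3 (m + k) (by omega))
    have b3 : ‖∑ k ∈ range (n - m - m'), p (m + (m' + k)) * e2pi (z (m + (m' + k)))‖ ≤
        √r * (17 * (L * √(2 * M) + 1 / √(2 * M))) := by
      refine periodic_twist r hr _ (fun k => p (m + (m' + k))) _
        (fun k => by rw [← add_assoc, ← add_assoc, hp, add_assoc]) (fun k => hp1 _) _ fun β => ?_
      have e : ∀ k, fdiff (fdiff fun k => z (m + (m' + k))) k = fdiff (fdiff z) (m + (m' + k)) :=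
        fun k => by simp [fdiff, add_assoc]
      refine twisted_block (fun k => z (m + (m' + k))) _ L (2 * M) β (hcast (by omega))
        (by positivity) hK (fun k hk => ?_) (fun k hk => ?_)
      · rw [e]
        linarith [hm2' (m' + k) (by omega) (by omega)]
      · rw [e]
        exact h2 _ (by omega)
    have s1 := norm_sum_range_split (fun k => p k * e2pi (z k)) hm
    have s2 := norm_sum_range_split (fun k => p (m + k) * e2pi (z (m + k))) hm'
    have c1 : √M ≤ √(2 * M) := Real.sqrt_le_sqrt (by linarith)
    have c2 : 1 / √(2 * M) ≤ 1 / √τ :=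
      one_div_le_one_div_of_le (Real.sqrt_pos.2 hτ) (Real.sqrt_le_sqrt hMτ)
    have c3 : √r * (17 * (L * √(2 * M) + 1 / √(2 * M))) ≤
        17 * (√r * (L * √(2 * M) + 1 / √τ)) := by
      rw [mul_left_comm]
      gcongr
    have c4 : K * (34 * (√r * (L * √M + 1 / √τ))) ≤
        K * (34 * (√r * (L * √(2 * M) + 1 / √τ))) := by gcongr
    push_cast
    linarith

lemma dyadic_twisted (r : ℕ) (hr : 1 ≤ r) (L τ μ Y lam : ℝ) (hτ : 0 < τ) (hμ : 0 < μ)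
    (hμ2 : μ ≤ 2) (hlam : 0 < lam) (hY : 1 ≤ Y) (hμY : μ / τ ≤ Y) (n : ℕ) (hn : n ≤ L)
    (z : ℕ → ℝ) (p : ℕ → ℂ) (hp : ∀ k, p (k + r) = p k) (hp1 : ∀ k, ‖p k‖ ≤ 1)
    (h1 : ∀ k < n, |fdiff (fdiff z) k| ≤ μ)
    (h3 : ∀ k, k + 1 < n → lam ≤ fdiff (fdiff z) (k + 1) - fdiff (fdiff z) k) :
    ‖∑ k ∈ range n, p k * e2pi (z k)‖ ≤
      (1 + 2 * Real.log Y) * (34 * (√r * (L * √(2 * μ) + 1 / √τ))) + (2 * τ / lam + 1) := by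
  have hL : 0 ≤ L := (Nat.cast_nonneg n).trans hn
  have hlogY : 0 ≤ Real.log Y := Real.log_nonneg hY
  rcases le_or_gt μ τ with h | h
  · refine (norm_sum_twist_le _ p z hp1).trans ?_
    rw [card_range]
    have := card_le_of_step (fdiff (fdiff z)) n lam (-τ) (2 * τ) hlam (by positivity) h3
      (fun k hk => by linarith [(abs_le.1 (h1 k hk)).1])
      (fun k hk => by linarith [(abs_le.1 (h1 k hk)).2])
    have : 0 ≤ (1 + 2 * Real.log Y) * (34 * (√r * (L * √(2 * μ) + 1 / √τ))) := by positivity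
    linarith
  · obtain ⟨j, hj1, hj2⟩ := exists_nat_pow_near (x := μ / τ) (y := 2)
      ((one_le_div hτ).2 h.le) (by norm_num)
    rw [le_div_iff₀ hτ] at hj1
    rw [div_lt_iff₀ hτ] at hj2
    have hpow : (2 : ℝ) ^ (j + 1) * τ = 2 * (2 ^ j * τ) := by ring
    have key := dyadic_twisted_pow r hr L τ lam hτ hlam (j + 1) (by rw [hpow]; linarith) n hn z p
      hp hp1 (fun k hk => by linarith [(abs_le.1 (h1 k hk)).1])
      (fun k hk => by linarith [(abs_le.1 (h1 k hk)).2]) h3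
    refine key.trans ?_
    have hjl : (j : ℝ) ≤ 2 * Real.log Y := by
      have a1 : (2 : ℝ) ^ j ≤ Y := ((le_div_iff₀ hτ).2 hj1).trans hμY
      have a2 := Real.log_le_log (by positivity) a1
      rw [Real.log_pow] at a2
      nlinarith [Real.log_two_gt_d9]
    have hle : (2 : ℝ) ^ (j + 1) * τ ≤ 2 * μ := by linarith
    generalize (2 : ℝ) ^ (j + 1) * τ = v at hle
    gcongr
    push_cast; linarith

lemma sum_inv_sqrt_le (I : ℕ) : ∑ i ∈ Ico 1 (I + 1), 1 / √(i : ℝ) ≤ 2 * √(I : ℝ) := by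
  induction I with
  | zero => simp
  | succ I ih =>
    rw [sum_Ico_succ_top (by omega)]
    have h0 : (0 : ℝ) ≤ I := Nat.cast_nonneg I
    have h1 := Real.sq_sqrt h0
    have h2 := Real.sq_sqrt (show (0 : ℝ) ≤ (I : ℝ) + 1 by positivity)
    have h3 : 0 < √((I : ℝ) + 1) := Real.sqrt_pos.2 (by positivity)
    have h4 := Real.sqrt_nonneg (I : ℝ)
    have h5 : 1 / √((I : ℝ) + 1) ≤ 2 * √((I : ℝ) + 1) - 2 * √(I : ℝ) := by
      rw [div_le_iff₀ h3]
      nlinarith [sq_nonneg (√((I : ℝ) + 1) - √(I : ℝ))]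
    push_cast
    linarith

lemma sum_inv_le_log (n : ℕ) : ∑ i ∈ Ico 1 (n + 1), 1 / (i : ℝ) ≤ 1 + Real.log n := by
  have := harmonic_le_one_add_log n
  rw [harmonic] at this
  push_cast at this
  rw [sum_Ico_eq_sum_range]
  refine le_trans (le_of_eq ?_) this
  refine sum_congr (by simp) fun i _ => ?_
  push_cast
  rw [one_div, add_comm]

lemma sum_periodic_le (g : ℕ → ℝ) (r D : ℕ) (hr : 1 ≤ r) (hg : ∀ d, 0 ≤ g d)
    (hp : ∀ d, g (d + r) = g d) :
    ∑ d ∈ range D, g d ≤ ((D : ℝ) / r + 1) * ∑ d ∈ range r, g d := by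
  have hblock : ∀ M, ∑ d ∈ range (M * r), g d = M * ∑ d ∈ range r, g d := by
    intro M
    induction M with
    | zero => simp
    | succ M ih =>
      rw [Nat.succ_mul, sum_range_add, ih]
      have : ∀ k ∈ range r, g (M * r + k) = g k := fun k _ => by
        rw [add_comm]
        exact Function.Periodic.nat_mul (f := g) hp M k
      rw [sum_congr rfl this]
      push_cast; ring
  have hsub : range D ⊆ range ((D / r + 1) * r) := by
    apply range_subset_range.2
    have := Nat.lt_div_mul_add (a := D) hr
    rw [add_mul, one_mul]
    omega
  refine (sum_le_sum_of_subset_of_nonneg hsub fun d _ _ => hg d).trans ?_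
  rw [hblock]
  have := Nat.cast_div_le (α := ℝ) (m := D) (n := r)
  have h0 : 0 ≤ ∑ d ∈ range r, g d := sum_nonneg fun d _ => hg d
  push_cast
  gcongr

/-- `r / a + r / (r - a)` at the residue `a ≠ 0`, and `0` at `a = 0`. -/
noncomputable def residueWeight (r : ℕ) (a : ℕ) : ℝ :=
  if a = 0 then 0 else (r : ℝ) / a + r / ((r : ℝ) - a)

lemma sum_residueWeight_le (r : ℕ) (hr : 1 ≤ r) :
    ∑ a ∈ range r, residueWeight r a ≤ 2 * r * (1 + Real.log r) := by
  have h1 : ∑ a ∈ range r, residueWeight r a =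
      ∑ a ∈ Ico 1 r, ((r : ℝ) / a + r / ((r : ℝ) - a)) := by
    rw [range_eq_Ico, sum_eq_sum_Ico_succ_bot (by omega)]
    simp only [residueWeight, if_true, zero_add]
    refine sum_congr rfl fun a ha => ?_
    rw [mem_Ico] at ha
    rw [if_neg (by omega)]
  have h2 : ∑ a ∈ Ico 1 r, (r : ℝ) / ((r : ℝ) - a) = ∑ a ∈ Ico 1 r, (r : ℝ) / a := by
    refine sum_bij' (fun a _ => r - a) (fun a _ => r - a) ?_ ?_ ?_ ?_ ?_
    all_goals intro a ha; rw [mem_Ico] at ha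
    · rw [mem_Ico]; omega
    · rw [mem_Ico]; omega
    · omega
    · omega
    · rw [Nat.cast_sub ha.2.le]
  have h3 : ∑ a ∈ Ico 1 r, (r : ℝ) / a ≤ r * (1 + Real.log r) := by
    have : ∑ a ∈ Ico 1 r, (1 : ℝ) / a ≤ 1 + Real.log r :=
      (sum_le_sum_of_subset_of_nonneg (Ico_subset_Ico_right (Nat.le_succ r))
        fun _ _ _ => by positivity).trans (sum_inv_le_log r)
    calc _ = r * ∑ a ∈ Ico 1 r, (1 : ℝ) / a := by
          rw [mul_sum]; exact sum_congr rfl fun a _ => by ring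
      _ ≤ _ := by gcongr
  rw [h1, sum_add_distrib, h2]
  linarith

lemma residueWeight_nonneg (r a : ℕ) (h : a < r) : 0 ≤ residueWeight r a := by
  rw [residueWeight]
  split_ifs
  · rfl
  · have : (0 : ℝ) < r - a := by rw [sub_pos]; exact_mod_cast h
    positivity

/-- The least nonnegative residue of `d b` modulo `r`. -/
def mulResidue (b : ℤ) (r d : ℕ) : ℕ := ((d * b) % (r : ℤ)).toNat

lemma mulResidue_lt (b : ℤ) (r d : ℕ) (hr : 1 ≤ r) : mulResidue b r d < r := by
  have h1 := Int.emod_nonneg (d * b) (show (r : ℤ) ≠ 0 by omega)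
  have h2 := Int.emod_lt_of_pos (d * b) (show (0 : ℤ) < r by omega)
  rw [mulResidue]; omega

lemma mulResidue_cast (b : ℤ) (r d : ℕ) (hr : 1 ≤ r) :
    (mulResidue b r d : ℤ) = (d * b) % (r : ℤ) := by
  have h1 := Int.emod_nonneg (d * b) (show (r : ℤ) ≠ 0 by omega)
  rw [mulResidue]; omega

lemma mulResidue_eq_zero (b : ℤ) (r d : ℕ) (hr : 1 ≤ r) (hb : IsCoprime b (r : ℤ)) :
    mulResidue b r d = 0 ↔ r ∣ d := by
  have h := mulResidue_cast b r d hr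
  have : mulResidue b r d = 0 ↔ (r : ℤ) ∣ d * b := by
    rw [Int.dvd_iff_emod_eq_zero, ← h]; norm_cast
  rw [this, ← Int.natCast_dvd_natCast]
  exact ⟨fun h => hb.symm.dvd_of_dvd_mul_right h, fun h => dvd_mul_of_dvd_left h _⟩

lemma sum_residueWeight_mul_le (b : ℤ) (r D : ℕ) (hr : 1 ≤ r) (hb : IsCoprime b (r : ℤ)) :
    ∑ d ∈ range D, residueWeight r (mulResidue b r d) ≤
      2 * (D + r) * (1 + Real.log r) := by
  refine (sum_periodic_le (fun d => residueWeight r (mulResidue b r d)) r D hr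
    (fun d => residueWeight_nonneg r _ (mulResidue_lt b r d hr)) (fun d => ?_)).trans ?_
  · simp only [mulResidue, Nat.cast_add, add_mul, Int.add_mul_emod_self_left]
  · have hinj : Set.InjOn (mulResidue b r) (range r) := by
      intro d hd d' hd' h
      simp only [coe_range, Set.mem_Iio] at hd hd'
      have h1 : ((d * b) % (r : ℤ)) = (d' * b) % (r : ℤ) := by
        rw [← mulResidue_cast b r d hr, ← mulResidue_cast b r d' hr, h]
      rw [Int.emod_eq_emod_iff_emod_sub_eq_zero, ← Int.dvd_iff_emod_eq_zero, ← sub_mul] at h1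
      have h2 := Int.eq_zero_of_abs_lt_dvd (hb.symm.dvd_of_dvd_mul_right h1) (by rw [abs_lt]; omega)
      omega
    have h1 : ∑ d ∈ range r, residueWeight r (mulResidue b r d) ≤
        ∑ a ∈ range r, residueWeight r a := by
      rw [← sum_image (f := residueWeight r) hinj]
      refine sum_le_sum_of_subset_of_nonneg ?_ fun a ha _ =>
        residueWeight_nonneg r a (mem_range.1 ha)
      intro a ha
      obtain ⟨d, _, rfl⟩ := mem_image.1 ha
      exact mem_range.2 (mulResidue_lt b r d hr)
    have h2 := h1.trans (sum_residueWeight_le r hr)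
    have hr0 : (0 : ℝ) < r := by exact_mod_cast hr
    calc ((D : ℝ) / r + 1) * ∑ d ∈ range r, residueWeight r (mulResidue b r d)
        ≤ ((D : ℝ) / r + 1) * (2 * r * (1 + Real.log r)) := by gcongr
      _ = _ := by field_simp

lemma sum_inv_sqrt_multiples_le (r D : ℕ) (hr : 1 ≤ r) :
    ∑ d ∈ Ico 1 D with r ∣ d, 1 / √(d : ℝ) ≤ 2 * √(D : ℝ) / r := by
  have hr0 : (0 : ℝ) < r := by exact_mod_cast hr
  have hsub : {d ∈ Ico 1 D | r ∣ d} ⊆ (Ico 1 (D / r + 1)).image (fun i => r * i) := by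
    intro d hd
    rw [mem_filter, mem_Ico] at hd
    obtain ⟨⟨h1, h2⟩, i, rfl⟩ := hd
    refine mem_image.2 ⟨i, mem_Ico.2 ⟨Nat.pos_of_mul_pos_left h1 |> fun h => ?_, ?_⟩, rfl⟩
    · rcases Nat.eq_zero_or_pos i with rfl | h
      · omega
      · exact h
    · rw [Nat.lt_succ_iff, Nat.le_div_iff_mul_le hr, mul_comm]; exact h2.le
  refine (sum_le_sum_of_subset_of_nonneg hsub fun _ _ _ => by positivity).trans ?_
  rw [sum_image (fun i _ j _ h => Nat.eq_of_mul_eq_mul_left hr h)]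
  have h1 : ∀ i : ℕ, 1 / √((r * i : ℕ) : ℝ) = 1 / √(r : ℝ) * (1 / √(i : ℝ)) := fun i => by
    push_cast
    rw [Real.sqrt_mul hr0.le]; field_simp
  simp only [h1]
  rw [← mul_sum]
  have h2 := sum_inv_sqrt_le (D / r)
  have h3 : √((D / r : ℕ) : ℝ) ≤ √(D : ℝ) / √(r : ℝ) := by
    rw [← Real.sqrt_div' _ hr0.le]
    exact Real.sqrt_le_sqrt Nat.cast_div_le
  have hs : 0 < √(r : ℝ) := Real.sqrt_pos.2 hr0
  calc 1 / √(r : ℝ) * ∑ i ∈ Ico 1 (D / r + 1), 1 / √(i : ℝ)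
      ≤ 1 / √(r : ℝ) * (2 * (√(D : ℝ) / √(r : ℝ))) := by gcongr; linarith
    _ = 2 * √(D : ℝ) / (√(r : ℝ) * √(r : ℝ)) := by field_simp
    _ = _ := by rw [Real.mul_self_sqrt hr0.le]

lemma fdiff_tele_ge (f : ℕ → ℝ) (k d : ℕ) (A : ℝ) (h : ∀ i < d, A ≤ fdiff f (k + i)) :
    d * A ≤ f (k + d) - f k := by
  induction d with
  | zero => simp
  | succ d ih =>
    have h1 := ih fun i hi => h i (by omega)
    have h2 := h d (by omega)
    rw [fdiff] at h2
    push_cast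
    rw [← add_assoc]
    linarith

lemma fdiff_tele_le (f : ℕ → ℝ) (k d : ℕ) (B : ℝ) (h : ∀ i < d, fdiff f (k + i) ≤ B) :
    f (k + d) - f k ≤ d * B := by
  induction d with
  | zero => simp
  | succ d ih =>
    have h1 := ih fun i hi => h i (by omega)
    have h2 := h d (by omega)
    rw [fdiff] at h2
    push_cast
    rw [← add_assoc]
    linarith

/-- The correlation sums of the Weyl step, for a fixed shift. -/
lemma shifted_sum_bounds (x : ℕ → ℝ) (n d : ℕ) (ω V lam : ℝ) (hd : 1 ≤ d)
    (hlam : 0 < lam) (hV : 0 ≤ V) (h1 : ∀ k < n, ω ≤ fdiff (fdiff x) k)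
    (h2 : ∀ k < n, fdiff (fdiff x) k ≤ ω + V) (h3 : ∀ k < n, lam ≤ fdiff (fdiff (fdiff x)) k) :
    ‖∑ k ∈ range (n - d), e2pi (x (k + d) - x k)‖ ≤ (d * V + 2) * (3 / √(d * lam) + 2) ∧
    ∀ (ν : ℤ) (ρ : ℝ), 0 < ρ → ν + ρ ≤ d * ω → d * ω + d * V ≤ ν + 1 - ρ →
      ‖∑ k ∈ range (n - d), e2pi (x (k + d) - x k)‖ ≤ 1 / ρ := by
  set y : ℕ → ℝ := fun k => x (k + d) - x k with hy
  have hd0 : (0 : ℝ) < d := by exact_mod_cast hd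
  have hf : ∀ k, fdiff y k = fdiff x (k + d) - fdiff x k := fun k => by
    simp only [hy, fdiff, show k + 1 + d = k + d + 1 by ring]; ring
  have hlo : ∀ k < n - d, d * ω ≤ fdiff y k := fun k hk => by
    rw [hf]; exact fdiff_tele_ge _ _ _ _ fun i hi => h1 _ (by omega)
  have hup : ∀ k < n - d, fdiff y k ≤ d * ω + d * V := fun k hk => by
    rw [hf, ← mul_add]; exact fdiff_tele_le _ _ _ _ fun i hi => h2 _ (by omega)
  have hst : ∀ k, k + 1 < n - d → d * lam ≤ fdiff y (k + 1) - fdiff y k := fun k hk => by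
    have := fdiff_tele_ge (fdiff (fdiff x)) k d lam fun i hi => h3 _ (by omega)
    refine this.trans (le_of_eq ?_)
    rw [hf, hf]
    simp only [fdiff, show k + 1 + d = k + d + 1 by ring]; ring
  refine ⟨second_diff_test y (n - d) (d * lam) (d * ω) (d * V) (by positivity) (by positivity)
    hst hlo hup, fun ν ρ hρ hν1 hν2 => ?_⟩
  refine kusmin_landau y (n - d) ν ρ hρ (fun k hk => ?_) (fun k hk => hν1.trans (hlo k hk))
    fun k hk => (hup k hk).trans hν2
  have := hst k hk
  have : 0 ≤ d * lam := by positivity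
  linarith

lemma shifted_sum_le (x : ℕ → ℝ) (n d D r : ℕ) (b : ℤ) (ω V lam : ℝ) (hd : 1 ≤ d) (hdD : d < D)
    (hr : 1 ≤ r) (hb : IsCoprime b (r : ℤ))
    (hω : |ω - b / r| ≤ 1 / ((2 * D + 1) * r))
    (hlam : 0 < lam) (hDlam : D * lam ≤ 1) (hV : 0 ≤ V) (h1 : ∀ k < n, ω ≤ fdiff (fdiff x) k)
    (h2 : ∀ k < n, fdiff (fdiff x) k ≤ ω + V) (h3 : ∀ k < n, lam ≤ fdiff (fdiff (fdiff x)) k) :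
    ‖∑ k ∈ range (n - d), e2pi (x (k + d) - x k)‖ ≤
      residueWeight r (mulResidue b r d) * (4 + 45 * (V * √(D / lam))) + 5 * (V * √(D / lam)) +
        (if r ∣ d then 10 / √lam * (1 / √d) else 0) := by
  obtain ⟨hA, hB⟩ := shifted_sum_bounds x n d ω V lam hd hlam hV h1 h2 h3
  have hd0 : (0 : ℝ) < d := by exact_mod_cast hd
  have hdD' : (d : ℝ) < D := by exact_mod_cast hdD
  have hD0 : (0 : ℝ) < D := hd0.trans hdD'
  have hr0 : (0 : ℝ) < r := by exact_mod_cast hr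
  have hG0 : 0 ≤ V * √(D / lam) := by positivity
  have hdl : 0 < √(d * lam) := Real.sqrt_pos.2 (by positivity)
  have hdl1 : √(d * lam) ≤ 1 := by
    apply Real.sqrt_le_one.2
    nlinarith
  have hdl2 : d / √(d * lam) ≤ √(D / lam) := by
    have : d / √(d * lam) = √(d / lam) := by
      rw [Real.sqrt_div hd0.le, Real.sqrt_mul hd0.le, ← div_div, Real.div_sqrt]
    rw [this]
    exact Real.sqrt_le_sqrt (by gcongr)
  have hA' : ‖∑ k ∈ range (n - d), e2pi (x (k + d) - x k)‖ ≤
      5 * (V * √(D / lam)) + 10 / √(d * lam) := by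
    refine hA.trans ?_
    have e1 : (2 : ℝ) ≤ 2 / √(d * lam) := by rw [le_div_iff₀ hdl]; linarith
    calc (d * V + 2) * (3 / √(d * lam) + 2) ≤ (d * V + 2) * (3 / √(d * lam) + 2 / √(d * lam)) := by
          gcongr
      _ = 5 * (V * (d / √(d * lam))) + 10 / √(d * lam) := by ring
      _ ≤ _ := by gcongr
  by_cases hrd : r ∣ d
  · rw [if_pos hrd, (mulResidue_eq_zero b r d hr hb).2 hrd]
    simp only [residueWeight, if_true, zero_mul, zero_add]
    refine hA'.trans (le_of_eq ?_)
    rw [Real.sqrt_mul hd0.le]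
    field_simp
  · rw [if_neg hrd, add_zero]
    have ha0 : mulResidue b r d ≠ 0 := fun h => hrd ((mulResidue_eq_zero b r d hr hb).1 h)
    have har := mulResidue_lt b r d hr
    have hac := mulResidue_cast b r d hr
    set a := mulResidue b r d with ha
    have ha1 : (1 : ℝ) ≤ a := by exact_mod_cast Nat.one_le_iff_ne_zero.2 ha0
    have har1 : (a : ℝ) + 1 ≤ r := by exact_mod_cast har
    obtain ⟨m, hm1, hm2, hm3, hmw⟩ : ∃ m : ℝ, 1 ≤ m ∧ m ≤ a ∧ m ≤ r - a ∧
        r / m ≤ residueWeight r a := by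
      rw [residueWeight, if_neg ha0]
      have p1 : 0 ≤ (r : ℝ) / a := by positivity
      have p2 : 0 ≤ (r : ℝ) / (r - a) := div_nonneg hr0.le (by linarith)
      rcases le_total (a : ℝ) (r - a) with h | h
      · exact ⟨a, ha1, le_rfl, h, by linarith⟩
      · exact ⟨r - a, by linarith, h, le_rfl, by linarith⟩
    have hm0 : 0 < m := by linarith
    have hmr : 1 ≤ r / m := by rw [one_le_div hm0]; linarith
    set ν : ℤ := (d * b) / (r : ℤ) with hν
    have hdb : (d : ℝ) * (b / r) = ν + a / r := by
      have := Int.mul_ediv_add_emod (d * b) r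
      rw [← hac] at this
      have h' : (r : ℝ) * ν + a = d * b := by exact_mod_cast this
      field_simp
      linarith
    have hclose : |d * ω - (ν + a / r)| ≤ 1 / 2 / r := by
      rw [← hdb, ← mul_sub, abs_mul, abs_of_pos hd0]
      calc d * |ω - b / r| ≤ d * (1 / ((2 * D + 1) * r)) := by gcongr
        _ = (d / (2 * D + 1)) / r := by field_simp
        _ ≤ _ := by
          have : (d : ℝ) / (2 * D + 1) ≤ 1 / 2 := by
            rw [div_le_iff₀ (by positivity)]; linarith
          gcongr
    rw [abs_le] at hclose
    have e1 : m / (2 * r) ≤ a / r - 1 / 2 / r := by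
      rw [← sub_div, div_le_div_iff₀ (by positivity) hr0]; nlinarith
    have e2 : a / r + 1 / 2 / r ≤ 1 - m / (2 * r) := by
      rw [← add_div, le_sub_iff_add_le, div_add_div _ _ hr0.ne' (by positivity),
        div_le_one (by positivity)]
      nlinarith
    have e3 : m / (2 * r) = m / (4 * r) + m / (4 * r) := by field_simp; norm_num
    have e4 : 0 < m / (4 * r) := by positivity
    rcases le_or_gt (d * V) (m / (4 * r)) with h | h
    · have := hB ν (m / (4 * r)) e4 (by linarith [hclose.1]) (by linarith [hclose.2])
      refine this.trans ?_
      have e5 : 1 / (m / (4 * r)) = r / m * 4 := by field_simp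
      rw [e5]
      have : 0 ≤ r / m * (45 * (V * √(D / lam))) := by positivity
      calc r / m * 4 ≤ r / m * (4 + 45 * (V * √(D / lam))) + 5 * (V * √(D / lam)) := by linarith
        _ ≤ _ := by gcongr
    · refine hA'.trans ?_
      have e6 : 1 ≤ r / m * (4 * (d * V)) := by
        rw [div_lt_iff₀ (by positivity)] at h
        rw [div_mul_eq_mul_div, le_div_iff₀ hm0]; linarith
      have e7 : 10 / √(d * lam) ≤ r / m * (40 * (V * √(D / lam))) := by
        calc 10 / √(d * lam) = 1 * (10 / √(d * lam)) := by ring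
          _ ≤ r / m * (4 * (d * V)) * (10 / √(d * lam)) := by gcongr
          _ = r / m * (40 * (V * (d / √(d * lam)))) := by ring
          _ ≤ _ := by gcongr
      calc _ ≤ 5 * (V * √(D / lam)) + r / m * (40 * (V * √(D / lam))) := by linarith
        _ ≤ r / m * (4 + 45 * (V * √(D / lam))) + 5 * (V * √(D / lam)) := by
          have : 0 ≤ r / m * (4 + 5 * (V * √(D / lam))) := by positivity
          linarith
        _ ≤ _ := by gcongr

lemma fdiff_fdiff_bounds (x : ℕ → ℝ) (n : ℕ) (L lam C₀ : ℝ) (hn : n ≤ L) (hlam : 0 < lam)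
    (hC₀ : 0 ≤ C₀) (h1 : ∀ k < n, lam ≤ fdiff (fdiff (fdiff x)) k)
    (h2 : ∀ k < n, fdiff (fdiff (fdiff x)) k ≤ C₀ * lam) (k : ℕ) (hk : k < n) :
    fdiff (fdiff x) 0 ≤ fdiff (fdiff x) k ∧
      fdiff (fdiff x) k ≤ fdiff (fdiff x) 0 + C₀ * lam * L := by
  have a := fdiff_tele_ge (fdiff (fdiff x)) 0 k lam fun i hi => by
    simpa using h1 i (by omega)
  have b := fdiff_tele_le (fdiff (fdiff x)) 0 k (C₀ * lam) fun i hi => by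
    simpa using h2 i (by omega)
  rw [zero_add] at a b
  have : 0 ≤ k * lam := by positivity
  have hkL : (k : ℝ) ≤ L := le_trans (by exact_mod_cast hk.le) hn
  have : k * (C₀ * lam) ≤ C₀ * lam * L := by
    rw [mul_comm]; gcongr
  constructor <;> linarith

lemma correlation_sum_le (x : ℕ → ℝ) (n : ℕ) (L u C₀ : ℝ) (Q r : ℕ) (b : ℤ) (hC₀ : 1 ≤ C₀)
    (hQ : 1 ≤ Q) (hQL : (Q : ℝ) ^ 2 ≤ L) (hn : n ≤ L) (hu : 0 < u) (hu1 : u ^ 4 * (Q : ℝ) ^ 6 ≤ 1)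
    (h1 : ∀ k < n, u ^ 4 ≤ fdiff (fdiff (fdiff x)) k)
    (h2 : ∀ k < n, fdiff (fdiff (fdiff x)) k ≤ C₀ * u ^ 4)
    (hr : 1 ≤ r) (hrQ : r ≤ 2 * Q ^ 2) (hb : IsCoprime b (r : ℤ))
    (hω : |fdiff (fdiff x) 0 - b / r| ≤ 1 / ((2 * (Q : ℝ) ^ 2 + 1) * r))
    (hr1 : Q / (u ^ 2 * L) < r) :
    ∑ d ∈ Ico 1 (Q ^ 2), ‖∑ k ∈ range (n - d), e2pi (x (k + d) - x k)‖ ≤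
      (620 * C₀) * (1 + Real.log (1 / u ^ 4)) * L := by
  have hQ1 : (1 : ℝ) ≤ Q := by exact_mod_cast hQ
  have hQ0 : (0 : ℝ) < Q := by linarith
  have hL1 : 1 ≤ L := by nlinarith
  have hr0 : (0 : ℝ) < r := by exact_mod_cast hr
  have hQ6 : (Q : ℝ) ^ 6 ≤ 1 / u ^ 4 := by rw [le_div_iff₀ (by positivity)]; linarith
  have hlogQ : 0 ≤ Real.log Q := Real.log_nonneg hQ1
  have hlog6 : 6 * Real.log Q ≤ Real.log (1 / u ^ 4) := by
    have := Real.log_le_log (by positivity) hQ6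
    rw [Real.log_pow] at this
    exact_mod_cast this
  set ell := 1 + Real.log (1 / u ^ 4) with hell
  have hell1 : 1 ≤ ell := by linarith
  have hlogr : 1 + Real.log r ≤ 2 * ell := by
    have h : (r : ℝ) ≤ 2 * (Q : ℝ) ^ 2 := by exact_mod_cast hrQ
    have := Real.log_le_log hr0 h
    rw [Real.log_mul (by norm_num) (by positivity), Real.log_pow] at this
    push_cast at this
    linarith [Real.log_two_lt_d9]
  have huQ : u ^ 2 * (Q : ℝ) ^ 3 ≤ 1 := by
    have : (u ^ 2 * (Q : ℝ) ^ 3) ^ 2 ≤ 1 := by calc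
      _ = u ^ 4 * (Q : ℝ) ^ 6 := by ring
      _ ≤ 1 := hu1
    exact (sq_le_one_iff₀ (by positivity)).1 this
  have hD : ((Q ^ 2 : ℕ) : ℝ) = (Q : ℝ) ^ 2 := by push_cast; ring
  have hG : C₀ * u ^ 4 * L * √((Q ^ 2 : ℕ) / u ^ 4) ≤ C₀ * (L / (Q : ℝ) ^ 2) := by
    have : √((Q ^ 2 : ℕ) / u ^ 4) = Q / u ^ 2 := by
      rw [hD, show (Q : ℝ) ^ 2 / u ^ 4 = (Q / u ^ 2) ^ 2 by field_simp]
      exact Real.sqrt_sq (by positivity)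
    rw [this]
    calc C₀ * u ^ 4 * L * (Q / u ^ 2) = C₀ * (L * ((u ^ 2 * (Q : ℝ) ^ 3) / (Q : ℝ) ^ 2)) := by
          field_simp
      _ ≤ C₀ * (L * (1 / (Q : ℝ) ^ 2)) := by gcongr
      _ = _ := by ring
  set G := C₀ * u ^ 4 * L * √((Q ^ 2 : ℕ) / u ^ 4) with hGdef
  have hG0 : 0 ≤ G := by positivity
  have hbd : ∀ d ∈ Ico 1 (Q ^ 2), ‖∑ k ∈ range (n - d), e2pi (x (k + d) - x k)‖ ≤
      residueWeight r (mulResidue b r d) * (4 + 45 * G) + 5 * G +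
        (if r ∣ d then 10 / u ^ 2 * (1 / √d) else 0) := by
    intro d hd
    rw [mem_Ico] at hd
    have hdd := fun k hk => fdiff_fdiff_bounds x n L (u ^ 4) C₀ hn (by positivity) (by linarith)
      h1 h2 k hk
    have hs : √(u ^ 4) = u ^ 2 := by
      rw [show u ^ 4 = (u ^ 2) ^ 2 by ring]; exact Real.sqrt_sq (by positivity)
    rw [← hs]
    refine shifted_sum_le x n d (Q ^ 2) r b _ _ _ hd.1 hd.2 hr hb ?_ (by positivity) ?_
      (by positivity) (fun k hk => (hdd k hk).1) (fun k hk => (hdd k hk).2) h1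
    · rw [hD]; exact hω
    · rw [hD]
      refine le_trans ?_ hu1
      rw [mul_comm]
      gcongr
      norm_num
  refine (sum_le_sum hbd).trans ?_
  rw [sum_add_distrib, sum_add_distrib, ← sum_mul, ← sum_filter, sum_const,
    Nat.card_Ico, nsmul_eq_mul]
  have t1 : ∑ d ∈ Ico 1 (Q ^ 2), residueWeight r (mulResidue b r d) ≤
      12 * (Q : ℝ) ^ 2 * ell := by
    have : ∑ d ∈ Ico 1 (Q ^ 2), residueWeight r (mulResidue b r d) ≤
        ∑ d ∈ range (Q ^ 2), residueWeight r (mulResidue b r d) := by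
      refine sum_le_sum_of_subset_of_nonneg ?_ fun d _ _ =>
        residueWeight_nonneg r _ (mulResidue_lt b r d hr)
      rw [range_eq_Ico]
      exact Ico_subset_Ico_left (Nat.zero_le _)
    refine this.trans ((sum_residueWeight_mul_le b r _ hr hb).trans ?_)
    have h : (r : ℝ) ≤ 2 * (Q : ℝ) ^ 2 := by exact_mod_cast hrQ
    rw [hD]
    calc 2 * ((Q : ℝ) ^ 2 + r) * (1 + Real.log r) ≤
          2 * ((Q : ℝ) ^ 2 + 2 * (Q : ℝ) ^ 2) * (2 * ell) := by
          have : 0 ≤ 1 + Real.log r :=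
            add_nonneg zero_le_one (Real.log_nonneg (by exact_mod_cast hr))
          gcongr
      _ = _ := by ring
  have t2 : ((Q ^ 2 - 1 : ℕ) : ℝ) * (5 * G) ≤ 5 * C₀ * L := by
    have : ((Q ^ 2 - 1 : ℕ) : ℝ) ≤ (Q : ℝ) ^ 2 := by
      rw [← hD]; exact_mod_cast Nat.sub_le _ _
    calc _ ≤ (Q : ℝ) ^ 2 * (5 * (C₀ * (L / (Q : ℝ) ^ 2))) := by gcongr
      _ = _ := by field_simp
  have t3 : ∑ d ∈ Ico 1 (Q ^ 2) with r ∣ d, 10 / u ^ 2 * (1 / √(d : ℝ)) ≤ 20 * L := by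
    rw [← mul_sum]
    have h := sum_inv_sqrt_multiples_le r (Q ^ 2) hr
    rw [hD, Real.sqrt_sq hQ0.le] at h
    rw [div_lt_iff₀ (by positivity)] at hr1
    calc _ ≤ 10 / u ^ 2 * (2 * Q / r) := by gcongr
      _ = 20 * (Q / (r * u ^ 2)) := by field_simp; norm_num
      _ ≤ 20 * L := by
        gcongr
        rw [div_le_iff₀ (by positivity)]
        linarith
  have t4 : (∑ d ∈ Ico 1 (Q ^ 2), residueWeight r (mulResidue b r d)) * (4 + 45 * G) ≤
      588 * C₀ * ell * L := by
    calc _ ≤ 12 * (Q : ℝ) ^ 2 * ell * (4 + 45 * (C₀ * (L / (Q : ℝ) ^ 2))) := by gcongr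
      _ = 48 * ell * (Q : ℝ) ^ 2 + 540 * C₀ * ell * L := by field_simp; ring
      _ ≤ 48 * ell * (C₀ * L) + 540 * C₀ * ell * L := by
        gcongr
        nlinarith
      _ = _ := by ring
  have t5 : L ≤ C₀ * ell * L := by
    have : 1 ≤ C₀ * ell := one_le_mul_of_one_le_of_one_le hC₀ hell1
    nlinarith
  have t6 : C₀ * L ≤ C₀ * ell * L := by
    have : C₀ * 1 ≤ C₀ * ell := by gcongr
    nlinarith
  linarith

lemma weyl_large_denominator (x : ℕ → ℝ) (n : ℕ) (L u C₀ : ℝ) (Q r : ℕ) (b : ℤ) (hC₀ : 1 ≤ C₀)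
    (hQ : 1 ≤ Q) (hQL : (Q : ℝ) ^ 2 ≤ L) (hn : n ≤ L) (hu : 0 < u) (hu1 : u ^ 4 * (Q : ℝ) ^ 6 ≤ 1)
    (h1 : ∀ k < n, u ^ 4 ≤ fdiff (fdiff (fdiff x)) k)
    (h2 : ∀ k < n, fdiff (fdiff (fdiff x)) k ≤ C₀ * u ^ 4)
    (hr : 1 ≤ r) (hrQ : r ≤ 2 * Q ^ 2) (hb : IsCoprime b (r : ℤ))
    (hω : |fdiff (fdiff x) 0 - b / r| ≤ 1 / ((2 * (Q : ℝ) ^ 2 + 1) * r))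
    (hr1 : Q / (u ^ 2 * L) < r) :
    ‖∑ k ∈ range n, e2pi (x k)‖ ≤
      (4000 * C₀) * (1 + Real.log (1 / u ^ 4)) * (L / Q) := by
  have hS := correlation_sum_le x n L u C₀ Q r b hC₀ hQ hQL hn hu hu1 h1 h2 hr hrQ hb hω hr1
  have hQ1 : (1 : ℝ) ≤ Q := by exact_mod_cast hQ
  have hQ0 : (0 : ℝ) < Q := by linarith
  have hL1 : 1 ≤ L := by nlinarith
  have hu41 : u ^ 4 ≤ 1 := by
    have : u ^ 4 * 1 ≤ u ^ 4 * (Q : ℝ) ^ 6 := by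
      gcongr; exact one_le_pow₀ hQ1
    linarith
  have hlog0 : 0 ≤ Real.log (1 / u ^ 4) :=
    Real.log_nonneg (by rw [le_div_iff₀ (by positivity)]; linarith)
  set ell := 1 + Real.log (1 / u ^ 4) with hell
  have hell1 : 1 ≤ ell := by linarith
  have hD : ((Q ^ 2 : ℕ) : ℝ) = (Q : ℝ) ^ 2 := by push_cast; ring
  have hv := vdc_inequality (fun k => e2pi (x k)) n (Q ^ 2) (Nat.one_le_pow _ _ hQ)
  have hin : ∀ k d, inner ℂ (e2pi (x k)) (e2pi (x (k + d))) = e2pi (x (k + d) - x k) := by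
    intro k d
    rw [RCLike.inner_apply, ← e2pi_neg, ← e2pi_add, sub_eq_add_neg]
  simp_rw [hin, norm_e2pi, one_pow, sum_const, card_range, nsmul_eq_mul, mul_one] at hv
  rw [hD] at hv
  set S := ∑ d ∈ Ico 1 (Q ^ 2), ‖∑ k ∈ range (n - d), e2pi (x (k + d) - x k)‖
  set T := ‖∑ k ∈ range n, e2pi (x k)‖
  have hT0 : 0 ≤ T := norm_nonneg _
  have hCl : 1 ≤ C₀ * ell := one_le_mul_of_one_le_of_one_le hC₀ hell1
  have hfin : (T * Q) ^ 2 ≤ (4000 * C₀ * ell * L) ^ 2 := by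
    have hsq : C₀ * ell ≤ (C₀ * ell) ^ 2 := by nlinarith
    have hS0 : 0 ≤ (n : ℝ) + 2 * S := by positivity
    have e1 : (n : ℝ) + 2 * S ≤ L + 2 * (620 * C₀ * ell * L) := by linarith
    have e2 : L + 2 * (620 * C₀ * ell * L) ≤ 1241 * (C₀ * ell) * L := by nlinarith
    calc (T * Q) ^ 2 = (Q : ℝ) ^ 2 * T ^ 2 := by ring
      _ ≤ (n + (Q : ℝ) ^ 2) * (n + 2 * S) := hv
      _ ≤ (L + L) * (1241 * (C₀ * ell) * L) := by
        apply mul_le_mul (by linarith) (e1.trans e2) hS0 (by linarith)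
      _ = 2482 * L ^ 2 * (C₀ * ell) := by ring
      _ ≤ 2482 * L ^ 2 * (C₀ * ell) ^ 2 := by gcongr
      _ ≤ 16000000 * L ^ 2 * (C₀ * ell) ^ 2 := by gcongr; norm_num
      _ = _ := by ring
  have := abs_le_of_sq_le_sq' hfin (by positivity) |>.2
  rw [mul_div_assoc', le_div_iff₀ hQ0]
  linarith

lemma weyl_small_denominator (x : ℕ → ℝ) (n : ℕ) (L u C₀ : ℝ) (Q r : ℕ) (b : ℤ) (hC₀ : 1 ≤ C₀)
    (hQ : 1 ≤ Q) (hQC : C₀ ≤ (Q : ℝ) ^ 2) (hQL : (Q : ℝ) ^ 2 ≤ L) (hn : n ≤ L) (hu : 0 < u)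
    (hu1 : u ^ 4 * (Q : ℝ) ^ 6 ≤ 1)
    (h1 : ∀ k < n, u ^ 4 ≤ fdiff (fdiff (fdiff x)) k)
    (h2 : ∀ k < n, fdiff (fdiff (fdiff x)) k ≤ C₀ * u ^ 4)
    (hr : 1 ≤ r) (hω : |fdiff (fdiff x) 0 - b / r| ≤ 1 / ((2 * (Q : ℝ) ^ 2 + 1) * r))
    (hr1 : r ≤ Q / (u ^ 2 * L)) :
    ‖∑ k ∈ range n, e2pi (x k)‖ ≤
      (500 * C₀) * (1 + Real.log (1 / u ^ 4)) * (L / Q + Q / (u ^ 3 * L)) := by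
  have hQ1 : (1 : ℝ) ≤ Q := by exact_mod_cast hQ
  have hQ0 : (0 : ℝ) < Q := by linarith
  have hL1 : 1 ≤ L := by nlinarith
  have hr0 : (0 : ℝ) < r := by exact_mod_cast hr
  have hr1' : (1 : ℝ) ≤ r := by exact_mod_cast hr
  have huQ : u ^ 2 * (Q : ℝ) ^ 3 ≤ 1 := by
    have : (u ^ 2 * (Q : ℝ) ^ 3) ^ 2 ≤ 1 := by calc
      _ = u ^ 4 * (Q : ℝ) ^ 6 := by ring
      _ ≤ 1 := hu1
    exact (sq_le_one_iff₀ (by positivity)).1 this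
  have hu41 : u ^ 4 ≤ 1 := by
    have : u ^ 4 * 1 ≤ u ^ 4 * (Q : ℝ) ^ 6 := by
      gcongr; exact one_le_pow₀ hQ1
    linarith
  have hlog0 : 0 ≤ Real.log (1 / u ^ 4) :=
    Real.log_nonneg (by rw [le_div_iff₀ (by positivity)]; linarith)
  set p : ℕ → ℂ := fun k => e2pi (b * (k * ((k : ℝ) - 1)) / (2 * r)) with hp
  set z : ℕ → ℝ := fun k => x k - b * (k * ((k : ℝ) - 1)) / (2 * r) with hz
  set V := C₀ * u ^ 4 * L with hV
  set μ := V + 1 / ((2 * (Q : ℝ) ^ 2 + 1) * r) with hμ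
  have hrV : r * V ≤ C₀ / (Q : ℝ) ^ 2 := by
    calc r * V ≤ Q / (u ^ 2 * L) * V := by gcongr
      _ = C₀ * (u ^ 2 * (Q : ℝ) ^ 3) / (Q : ℝ) ^ 2 := by rw [hV]; field_simp
      _ ≤ C₀ * 1 / (Q : ℝ) ^ 2 := by gcongr
      _ = _ := by ring
  have hV0 : 0 < V := by positivity
  have hrμ : r * μ ≤ 2 * C₀ / (Q : ℝ) ^ 2 := by
    have : r * μ = r * V + 1 / (2 * (Q : ℝ) ^ 2 + 1) := by rw [hμ]; field_simp
    have h' : 1 / (2 * (Q : ℝ) ^ 2 + 1) ≤ C₀ / (Q : ℝ) ^ 2 := by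
      rw [div_le_div_iff₀ (by positivity) (by positivity)]; nlinarith
    rw [this, mul_div_assoc]; linarith
  have hμ0 : 0 < μ := by positivity
  have hμ2 : μ ≤ 2 := by
    have : 2 * C₀ / (Q : ℝ) ^ 2 ≤ 2 := by rw [div_le_iff₀ (by positivity)]; linarith
    nlinarith
  have hfz : ∀ k, fdiff (fdiff z) k = fdiff (fdiff x) k - b / r := fun k => by
    simp only [fdiff, hz]; push_cast; field_simp; ring
  have hdd := fun k hk => fdiff_fdiff_bounds x n L (u ^ 4) C₀ hn (by positivity) (by linarith)
      h1 h2 k hk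
  have hτ0 : 0 < u ^ 4 * L / Q := by positivity
  have key := dyadic_twisted (2 * r) (by omega) L (u ^ 4 * L / Q) μ (2 / u ^ 4) (u ^ 4) hτ0 hμ0 hμ2
    (by positivity) (by rw [le_div_iff₀ (by positivity)]; linarith)
    (by
      calc μ / (u ^ 4 * L / Q) ≤ 2 / (u ^ 4 * L / Q) := by gcongr
        _ = 2 / u ^ 4 * (Q / L) := by field_simp
        _ ≤ 2 / u ^ 4 * 1 := by
          gcongr
          rw [div_le_one (by positivity)]; nlinarith
        _ = _ := by ring)
    n hn z p
    (fun k => by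
      simp only [hp]
      have := e2pi_add_int (b * (k * ((k : ℝ) - 1)) / (2 * r)) (b * (2 * k + 2 * r - 1))
      rw [← this]
      congr 1
      push_cast
      field_simp
      ring)
    (fun k => (norm_e2pi _).le)
    (fun k hk => by
      rw [hfz]
      have h := hdd k hk
      rw [abs_le] at hω ⊢
      constructor <;> linarith [hω.1, hω.2])
    (fun k hk => by
      rw [hfz, hfz]
      have := h1 k (by omega)
      rw [fdiff] at this
      linarith)
  have hpz : ∀ k, p k * e2pi (z k) = e2pi (x k) := fun k => by
    simp only [hp, hz]
    rw [← e2pi_add]; congr 1; ring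
  simp only [hpz] at key
  refine key.trans ?_
  set ell := 1 + Real.log (1 / u ^ 4) with hell
  have hell1 : 1 ≤ ell := by linarith
  have k1 : 1 + 2 * Real.log (2 / u ^ 4) ≤ 3 * ell := by
    rw [show 2 / u ^ 4 = 2 * (1 / u ^ 4) by ring, Real.log_mul (by norm_num) (by positivity)]
    linarith [Real.log_two_lt_d9]
  have k2 : √((2 * r : ℕ) : ℝ) * √(2 * μ) ≤ 3 * C₀ / Q := by
    rw [← Real.sqrt_mul (by positivity)]
    apply Real.sqrt_le_iff.2
    refine ⟨by positivity, ?_⟩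
    push_cast
    calc 2 * r * (2 * μ) = 4 * (r * μ) := by ring
      _ ≤ 4 * (2 * C₀ / (Q : ℝ) ^ 2) := by gcongr
      _ = 8 * (C₀ * 1) / (Q : ℝ) ^ 2 := by ring
      _ ≤ 9 * (C₀ * C₀) / (Q : ℝ) ^ 2 := by gcongr; norm_num
      _ = _ := by ring
  have k3 : √((2 * r : ℕ) : ℝ) * (1 / √(u ^ 4 * L / Q)) ≤ 2 * (Q / (u ^ 3 * L)) := by
    rw [← Real.sqrt_one, ← Real.sqrt_div zero_le_one, ← Real.sqrt_mul (by positivity)]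
    apply Real.sqrt_le_iff.2
    refine ⟨by positivity, ?_⟩
    push_cast
    calc 2 * r * (1 / (u ^ 4 * L / Q)) ≤ 2 * (Q / (u ^ 2 * L)) * (1 / (u ^ 4 * L / Q)) := by
          gcongr
      _ = 2 * (Q / (u ^ 3 * L)) ^ 2 := by field_simp
      _ ≤ _ := by nlinarith [sq_nonneg (Q / (u ^ 3 * L))]
  have k4 : 2 * (u ^ 4 * L / Q) / u ^ 4 + 1 ≤ 3 * (L / Q) := by
    have : 2 * (u ^ 4 * L / Q) / u ^ 4 = 2 * (L / Q) := by field_simp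
    have h' : 1 ≤ L / Q := by rw [one_le_div hQ0]; nlinarith
    linarith
  have k5 : √((2 * r : ℕ) : ℝ) * (L * √(2 * μ) + 1 / √(u ^ 4 * L / Q)) ≤
      3 * C₀ * (L / Q) + 2 * (Q / (u ^ 3 * L)) := by
    calc _ = L * (√((2 * r : ℕ) : ℝ) * √(2 * μ)) +
          √((2 * r : ℕ) : ℝ) * (1 / √(u ^ 4 * L / Q)) := by ring
      _ ≤ L * (3 * C₀ / Q) + 2 * (Q / (u ^ 3 * L)) := by gcongr
      _ = _ := by ring
  have hA : 0 ≤ L / Q := by positivity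
  have hB : 0 ≤ Q / (u ^ 3 * L) := by positivity
  calc _ ≤ 3 * ell * (34 * (3 * C₀ * (L / Q) + 2 * (Q / (u ^ 3 * L)))) + 3 * (L / Q) := by
        gcongr
    _ = 306 * C₀ * ell * (L / Q) + 204 * 1 * ell * (Q / (u ^ 3 * L)) + 3 * (1 * 1 * (L / Q)) := by
        ring
    _ ≤ 306 * C₀ * ell * (L / Q) + 204 * C₀ * ell * (Q / (u ^ 3 * L)) +
          3 * (C₀ * ell * (L / Q)) := by gcongr
    _ ≤ _ := by
      have e1 : 0 ≤ C₀ * ell * (L / Q) := by positivity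
      have e2 : 0 ≤ C₀ * ell * (Q / (u ^ 3 * L)) := by positivity
      linarith

/-- An exponential-sum estimate under a third-difference condition, with an arbitrary quadratic
part of the phase. -/
lemma weyl_third_diff (x : ℕ → ℝ) (n : ℕ) (L u C₀ : ℝ) (Q : ℕ) (hC₀ : 1 ≤ C₀)
    (hQ : 1 ≤ Q) (hQL : (Q : ℝ) ^ 2 ≤ L) (hn : n ≤ L) (hu : 0 < u) (hu1 : u ^ 4 * (Q : ℝ) ^ 6 ≤ 1)
    (h1 : ∀ k < n, u ^ 4 ≤ fdiff (fdiff (fdiff x)) k)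
    (h2 : ∀ k < n, fdiff (fdiff (fdiff x)) k ≤ C₀ * u ^ 4) :
    ‖∑ k ∈ range n, e2pi (x k)‖ ≤
      (4000 * C₀) * (1 + Real.log (1 / u ^ 4)) * (L / Q + Q / (u ^ 3 * L)) := by
  have hQ1 : (1 : ℝ) ≤ Q := by exact_mod_cast hQ
  have hQ0 : (0 : ℝ) < Q := by linarith
  have hL1 : 1 ≤ L := by nlinarith
  have hu41 : u ^ 4 ≤ 1 := by
    have : u ^ 4 * 1 ≤ u ^ 4 * (Q : ℝ) ^ 6 := by
      gcongr; exact one_le_pow₀ hQ1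
    linarith
  have hlog0 : 0 ≤ Real.log (1 / u ^ 4) :=
    Real.log_nonneg (by rw [le_div_iff₀ (by positivity)]; linarith)
  have hA : 0 ≤ L / Q := by positivity
  have hB : 0 ≤ Q / (u ^ 3 * L) := by positivity
  rcases le_or_gt C₀ ((Q : ℝ) ^ 2) with hQC | hQC
  · obtain ⟨q, hq1, hq2⟩ := Real.exists_rat_abs_sub_le_and_den_le (fdiff (fdiff x) 0)
      (n := 2 * Q ^ 2) (by positivity)
    have hcop : IsCoprime q.num (q.den : ℤ) := by
      rw [Int.isCoprime_iff_gcd_eq_one]; exact q.reduced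
    have hω : |fdiff (fdiff x) 0 - q.num / q.den| ≤ 1 / ((2 * (Q : ℝ) ^ 2 + 1) * q.den) := by
      have h := hq1
      rw [Rat.cast_def] at h
      push_cast at h
      exact h
    rcases le_or_gt (q.den : ℝ) (Q / (u ^ 2 * L)) with hr | hr
    · refine (weyl_small_denominator x n L u C₀ Q q.den q.num hC₀ hQ hQC hQL hn hu hu1 h1 h2 q.pos
        hω hr).trans
        ?_
      gcongr
      norm_num
    · refine (weyl_large_denominator x n L u C₀ Q q.den q.num hC₀ hQ hQL hn hu hu1 h1 h2 q.pos
        (by exact_mod_cast hq2) hcop hω hr).trans ?_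
      gcongr
      linarith
  · refine (norm_sum_e2pi_le _ _).trans ?_
    rw [card_range]
    refine hn.trans ?_
    have hQC' : (Q : ℝ) ≤ 4000 * C₀ := by nlinarith
    calc L = Q * 1 * (L / Q) := by field_simp
      _ ≤ (4000 * C₀) * (1 + Real.log (1 / u ^ 4)) * (L / Q + Q / (u ^ 3 * L)) := by
        gcongr <;> linarith

lemma bilinear_vdc (a b : ℕ → ℂ) (G : ℕ → ℕ → ℂ) (M L D : ℕ) (hD : 1 ≤ D) (T : ℕ → ℝ)
    (hG : ∀ m < M, ∀ l < L, ‖G m l‖ ≤ 1)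
    (hT : ∀ d, 1 ≤ d → d < D → ∀ m, m + d < M →
      ‖∑ l ∈ range L, (starRingEnd ℂ) (G m l) * G (m + d) l‖ ≤ T d) :
    D * ‖∑ m ∈ range M, ∑ l ∈ range L, a m * b l * G m l‖ ^ 2 ≤
      (M + D) * (∑ m ∈ range M, ‖a m‖ ^ 2) * (∑ l ∈ range L, ‖b l‖ ^ 2) *
        (L + 2 * ∑ d ∈ Ico 1 D, |T d|) := by
  set A := ∑ m ∈ range M, ‖a m‖ ^ 2 with hA
  set B := ∑ l ∈ range L, ‖b l‖ ^ 2 with hB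
  have hA0 : 0 ≤ A := by positivity
  have hB0 : 0 ≤ B := by positivity
  let z : ℕ → EuclideanSpace ℂ (Fin L) := fun m => WithLp.toLp 2 fun l => a m * G m l
  have hz : ∀ m l, z m l = a m * G m l := fun _ _ => rfl
  have hv := vdc_inequality z M D hD
  have h1 : ∑ m ∈ range M, ‖z m‖ ^ 2 ≤ A * L := by
    rw [hA, sum_mul]
    refine sum_le_sum fun m hm => ?_
    rw [EuclideanSpace.norm_sq_eq]
    calc ∑ l, ‖z m l‖ ^ 2 ≤ ∑ l : Fin L, ‖a m‖ ^ 2 := by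
          refine sum_le_sum fun l _ => ?_
          rw [hz, norm_mul, mul_pow]
          have := hG m (mem_range.1 hm) l l.2
          have h' : ‖G m l‖ ^ 2 ≤ 1 := pow_le_one₀ (norm_nonneg _) this
          exact mul_le_of_le_one_right (by positivity) h'
      _ = ‖a m‖ ^ 2 * L := by rw [sum_const]; simp [mul_comm]
  have h2 : ∀ d ∈ Ico 1 D, ‖∑ m ∈ range (M - d), inner ℂ (z m) (z (m + d))‖ ≤ A * |T d| := by
    intro d hd
    rw [mem_Ico] at hd
    have hin : ∀ m ∈ range (M - d), ‖inner ℂ (z m) (z (m + d))‖ ≤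
        (‖a m‖ ^ 2 / 2 + ‖a (m + d)‖ ^ 2 / 2) * |T d| := by
      intro m hm
      have hmd : m + d < M := by rw [mem_range] at hm; omega
      have e : inner ℂ (z m) (z (m + d)) = (starRingEnd ℂ) (a m) * a (m + d) *
          ∑ l ∈ range L, (starRingEnd ℂ) (G m l) * G (m + d) l := by
        rw [PiLp.inner_apply, ← Fin.sum_univ_eq_sum_range
          (fun l => (starRingEnd ℂ) (G m l) * G (m + d) l), mul_sum]
        refine sum_congr rfl fun l _ => ?_
        rw [RCLike.inner_apply, hz, hz, map_mul]
        ring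
      rw [e, norm_mul, norm_mul, RCLike.norm_conj]
      have := (hT d hd.1 hd.2 m hmd).trans (le_abs_self _)
      gcongr
      nlinarith [sq_nonneg (‖a m‖ - ‖a (m + d)‖)]
    refine (norm_sum_le_of_le _ hin).trans ?_
    rw [← sum_mul, sum_add_distrib, ← sum_div, ← sum_div]
    have e1 : ∑ m ∈ range (M - d), ‖a m‖ ^ 2 ≤ A :=
      sum_le_sum_of_subset_of_nonneg (range_mono (Nat.sub_le _ _)) fun _ _ _ => by positivity
    have e2 : ∑ m ∈ range (M - d), ‖a (m + d)‖ ^ 2 ≤ A := by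
      have := sum_Ico_eq_sum_range (fun m => ‖a m‖ ^ 2) d M
      simp_rw [add_comm d] at this
      rw [← this]
      refine sum_le_sum_of_subset_of_nonneg ?_ fun _ _ _ => by positivity
      intro m hm
      rw [mem_Ico] at hm
      rw [mem_range]
      omega
    gcongr
    linarith
  have h3 : ‖∑ m ∈ range M, ∑ l ∈ range L, a m * b l * G m l‖ ^ 2 ≤
      B * ‖∑ m ∈ range M, z m‖ ^ 2 := by
    have e : ∑ m ∈ range M, ∑ l ∈ range L, a m * b l * G m l =
        ∑ l : Fin L, b l * (∑ m ∈ range M, z m) l := by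
      rw [sum_comm, ← Fin.sum_univ_eq_sum_range
        (fun l => ∑ m ∈ range M, a m * b l * G m l)]
      refine sum_congr rfl fun l _ => ?_
      rw [WithLp.ofLp_sum, Finset.sum_apply, mul_sum]
      refine sum_congr rfl fun m _ => ?_
      rw [hz]; ring
    rw [e, EuclideanSpace.norm_sq_eq, hB, ← Fin.sum_univ_eq_sum_range (fun l => ‖b l‖ ^ 2)]
    refine le_trans ?_ (sum_mul_sq_le_sq_mul_sq _ _ _)
    gcongr
    refine (norm_sum_le _ _).trans (sum_le_sum fun l _ => ?_)
    rw [norm_mul]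
  calc D * ‖∑ m ∈ range M, ∑ l ∈ range L, a m * b l * G m l‖ ^ 2
      ≤ D * (B * ‖∑ m ∈ range M, z m‖ ^ 2) := by gcongr
    _ = B * (D * ‖∑ m ∈ range M, z m‖ ^ 2) := by ring
    _ ≤ B * ((M + D) * (A * L + 2 * ∑ d ∈ Ico 1 D, A * |T d|)) := by
        refine mul_le_mul_of_nonneg_left (hv.trans ?_) hB0
        gcongr with d hd
        exact h2 d hd
    _ = _ := by rw [← mul_sum]; ring

lemma diff_bounds_of_deriv (g g' : ℝ → ℝ) (y A B : ℝ)
    (hg : ∀ v, y ≤ v → v ≤ y + 1 → HasDerivAt g (g' v) v)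
    (hA : ∀ v, y ≤ v → v ≤ y + 1 → A ≤ g' v) (hB : ∀ v, y ≤ v → v ≤ y + 1 → g' v ≤ B) :
    A ≤ g (y + 1) - g y ∧ g (y + 1) - g y ≤ B := by
  obtain ⟨v, hv, hs⟩ := exists_hasDerivAt_eq_slope g g' (by linarith : y < y + 1)
    (fun v hv => (hg v hv.1 hv.2).continuousAt.continuousWithinAt)
    (fun v hv => hg v hv.1.le hv.2.le)
  rw [add_sub_cancel_left, div_one] at hs
  exact ⟨hs ▸ hA v hv.1.le hv.2.le, hs ▸ hB v hv.1.le hv.2.le⟩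

lemma fdiff_three_bounds (f f₁ f₂ f₃ : ℝ → ℝ) (s A B : ℝ) (k : ℕ)
    (h1 : ∀ v, s + k ≤ v → v ≤ s + k + 3 → HasDerivAt f (f₁ v) v)
    (h2 : ∀ v, s + k ≤ v → v ≤ s + k + 3 → HasDerivAt f₁ (f₂ v) v)
    (h3 : ∀ v, s + k ≤ v → v ≤ s + k + 3 → HasDerivAt f₂ (f₃ v) v)
    (hA : ∀ v, s + k ≤ v → v ≤ s + k + 3 → A ≤ f₃ v)
    (hB : ∀ v, s + k ≤ v → v ≤ s + k + 3 → f₃ v ≤ B) :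
    A ≤ fdiff (fdiff (fdiff fun i : ℕ => f (s + i))) k ∧
      fdiff (fdiff (fdiff fun i : ℕ => f (s + i))) k ≤ B := by
  have shift : ∀ (g g' : ℝ → ℝ) (v : ℝ), HasDerivAt g (g' (v + 1)) (v + 1) → HasDerivAt g (g' v) v →
      HasDerivAt (fun w => g (w + 1) - g w) (g' (v + 1) - g' v) v := fun g g' v a b =>
    (a.comp_add_const v 1).sub b
  have k2 : ∀ v, s + k ≤ v → v ≤ s + k + 2 → A ≤ f₂ (v + 1) - f₂ v ∧ f₂ (v + 1) - f₂ v ≤ B :=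
    fun v ha hb => diff_bounds_of_deriv f₂ f₃ v A B
      (fun w _ _ => h3 w (by linarith) (by linarith))
      (fun w _ _ => hA w (by linarith) (by linarith))
      (fun w _ _ => hB w (by linarith) (by linarith))
  have k1 : ∀ v, s + k ≤ v → v ≤ s + k + 1 →
      A ≤ (f₁ (v + 1 + 1) - f₁ (v + 1)) - (f₁ (v + 1) - f₁ v) ∧
        (f₁ (v + 1 + 1) - f₁ (v + 1)) - (f₁ (v + 1) - f₁ v) ≤ B :=
    fun v ha hb => diff_bounds_of_deriv (fun w => f₁ (w + 1) - f₁ w)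
      (fun w => f₂ (w + 1) - f₂ w) v A B
      (fun w _ _ => shift f₁ f₂ w (h2 _ (by linarith) (by linarith)) (h2 _ (by linarith)
        (by linarith)))
      (fun w _ _ => (k2 w (by linarith) (by linarith)).1)
      (fun w _ _ => (k2 w (by linarith) (by linarith)).2)
  have k0 := diff_bounds_of_deriv
      (fun w => (f (w + 1 + 1) - f (w + 1)) - (f (w + 1) - f w))
      (fun w => (f₁ (w + 1 + 1) - f₁ (w + 1)) - (f₁ (w + 1) - f₁ w)) (s + k) A B
      (fun w _ _ => shift (fun w => f (w + 1) - f w) (fun w => f₁ (w + 1) - f₁ w) w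
        (shift f f₁ (w + 1) (h1 _ (by linarith) (by linarith)) (h1 _ (by linarith) (by linarith)))
        (shift f f₁ w (h1 _ (by linarith) (by linarith)) (h1 _ (by linarith) (by linarith))))
      (fun w ha hb => (k1 w ha hb).1) (fun w ha hb => (k1 w ha hb).2)
  have e : fdiff (fdiff (fdiff fun i : ℕ => f (s + i))) k =
      (f (s + k + 1 + 1 + 1) - f (s + k + 1 + 1)) - (f (s + k + 1 + 1) - f (s + k + 1)) -
      ((f (s + k + 1 + 1) - f (s + k + 1)) - (f (s + k + 1) - f (s + k))) := by
    simp only [fdiff]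
    push_cast
    simp only [add_assoc]
  rw [e]
  exact k0

/-- The phase `θ (m y)² + j (m y + c)^γ`. -/
noncomputable def phase (γ θ j c m y : ℝ) : ℝ := θ * (m * y) ^ 2 + j * (m * y + c) ^ γ

/-- The third derivative of `phase` in `y`, as computed in `hasDerivAt_phase`. -/
noncomputable def phaseThird (γ j c m y : ℝ) : ℝ :=
  j * (γ * (1 - γ) * (2 - γ)) * (m ^ 3 * (m * y + c) ^ (γ - 3))

lemma hasDerivAt_rpow_affine (e c m y : ℝ) (h : 0 < m * y + c) :
    HasDerivAt (fun y => (m * y + c) ^ e) (e * m * (m * y + c) ^ (e - 1)) y := by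
  have := (((hasDerivAt_id y).const_mul m).add_const c).rpow_const (p := e) (Or.inl h.ne')
  refine this.congr_deriv ?_
  simp only [id]
  ring

lemma hasDerivAt_phase (γ θ j c m y : ℝ) (h : 0 < m * y + c) :
    HasDerivAt (phase γ θ j c m)
      (2 * θ * m ^ 2 * y + j * γ * m * (m * y + c) ^ (γ - 1)) y := by
  unfold phase
  have h1 := ((((hasDerivAt_id y).const_mul m).pow 2).const_mul θ).add
    ((hasDerivAt_rpow_affine γ c m y h).const_mul j)
  refine HasDerivAt.congr_deriv h1 ?_
  simp only [id]
  ring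

lemma hasDerivAt_phase_one (γ θ j c m y : ℝ) (h : 0 < m * y + c) :
    HasDerivAt (fun y => 2 * θ * m ^ 2 * y + j * γ * m * (m * y + c) ^ (γ - 1))
      (2 * θ * m ^ 2 + j * γ * (γ - 1) * m ^ 2 * (m * y + c) ^ (γ - 2)) y := by
  have h1 := ((hasDerivAt_id y).const_mul (2 * θ * m ^ 2)).add
    ((hasDerivAt_rpow_affine (γ - 1) c m y h).const_mul (j * γ * m))
  refine HasDerivAt.congr_deriv h1 ?_
  rw [show γ - 1 - 1 = γ - 2 by ring]
  ring

lemma hasDerivAt_phase_two (γ θ j c m y : ℝ) (h : 0 < m * y + c) :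
    HasDerivAt (fun y => 2 * θ * m ^ 2 + j * γ * (γ - 1) * m ^ 2 * (m * y + c) ^ (γ - 2))
      (phaseThird γ j c m y) y := by
  have h1 := ((hasDerivAt_rpow_affine (γ - 2) c m y h).const_mul
    (j * γ * (γ - 1) * m ^ 2)).const_add (2 * θ * m ^ 2)
  refine HasDerivAt.congr_deriv h1 ?_
  rw [show γ - 2 - 1 = γ - 3 by ring, phaseThird]
  ring

lemma phase_fdiff_three (γ θ j c m s A B : ℝ) (k : ℕ) (hm : 0 < m) (hs : 0 < s) (hc : 0 ≤ c)
    (hA : ∀ v, s + k ≤ v → v ≤ s + k + 3 → A ≤ phaseThird γ j c m v)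
    (hB : ∀ v, s + k ≤ v → v ≤ s + k + 3 → phaseThird γ j c m v ≤ B) :
    A ≤ fdiff (fdiff (fdiff fun i : ℕ => phase γ θ j c m (s + i))) k ∧
      fdiff (fdiff (fdiff fun i : ℕ => phase γ θ j c m (s + i))) k ≤ B := by
  have hpos : ∀ v, s + k ≤ v → 0 < m * v + c := fun v hv => by
    have : 0 < v := by have : (0 : ℝ) ≤ k := k.cast_nonneg; linarith
    positivity
  exact fdiff_three_bounds _ _ _ _ s A B k
    (fun v h _ => hasDerivAt_phase γ θ j c m v (hpos v h))
    (fun v h _ => hasDerivAt_phase_one γ θ j c m v (hpos v h))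
    (fun v h _ => hasDerivAt_phase_two γ θ j c m v (hpos v h)) hA hB

lemma phase_sub_fdiff_three (γ θ j c m m' s A B : ℝ) (k : ℕ) (hm : 0 < m) (hm' : 0 < m')
    (hs : 0 < s) (hc : 0 ≤ c)
    (hA : ∀ v, s + k ≤ v → v ≤ s + k + 3 → A ≤ phaseThird γ j c m' v - phaseThird γ j c m v)
    (hB : ∀ v, s + k ≤ v → v ≤ s + k + 3 → phaseThird γ j c m' v - phaseThird γ j c m v ≤ B) :
    A ≤ fdiff (fdiff (fdiff fun i : ℕ => phase γ θ j c m' (s + i) - phase γ θ j c m (s + i))) k ∧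
      fdiff (fdiff (fdiff fun i : ℕ => phase γ θ j c m' (s + i) - phase γ θ j c m (s + i))) k
        ≤ B := by
  have hpos : ∀ m : ℝ, 0 < m → ∀ v, s + k ≤ v → 0 < m * v + c := fun m hm v hv => by
    have : 0 < v := by have : (0 : ℝ) ≤ k := k.cast_nonneg; linarith
    positivity
  exact fdiff_three_bounds (fun y => phase γ θ j c m' y - phase γ θ j c m y) _ _ _ s A B k
    (fun v h _ => (hasDerivAt_phase γ θ j c m' v (hpos m' hm' v h)).sub
      (hasDerivAt_phase γ θ j c m v (hpos m hm v h)))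
    (fun v h _ => (hasDerivAt_phase_one γ θ j c m' v (hpos m' hm' v h)).sub
      (hasDerivAt_phase_one γ θ j c m v (hpos m hm v h)))
    (fun v h _ => (hasDerivAt_phase_two γ θ j c m' v (hpos m' hm' v h)).sub
      (hasDerivAt_phase_two γ θ j c m v (hpos m hm v h))) hA hB

lemma rpow_window (γ X z : ℝ) (hγ0 : 0 < γ) (hγ1 : γ < 1) (hX : 0 < X) (h1 : X ≤ z)
    (h2 : z ≤ 20 * X) : X ^ (γ - 3) / 8000 ≤ z ^ (γ - 3) ∧ z ^ (γ - 3) ≤ X ^ (γ - 3) := by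
  constructor
  · calc X ^ (γ - 3) / 8000 = (20 : ℝ) ^ (-3 : ℝ) * X ^ (γ - 3) := by
          rw [Real.rpow_neg (by norm_num)]; norm_num; ring
      _ ≤ (20 : ℝ) ^ (γ - 3) * X ^ (γ - 3) := by
          gcongr
          · norm_num
          · linarith
      _ = (20 * X) ^ (γ - 3) := by rw [Real.mul_rpow (by norm_num) hX.le]
      _ ≤ z ^ (γ - 3) :=
          Real.rpow_le_rpow_of_nonpos (by linarith) h2 (by linarith)
  · exact Real.rpow_le_rpow_of_nonpos hX h1 (by linarith)

lemma cube_rpow_diff_bounds (γ c y X M m m' : ℝ) (hγ0 : 0 < γ) (hγ1 : γ < 1) (hc : 0 ≤ c)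
    (hX : 0 < X) (hM : 0 < M) (hy : 0 < y) (hm : M ≤ m) (hmm : m ≤ m') (hm' : m' ≤ 2 * M)
    (hX1 : X ≤ M * y) (hX2 : 2 * M * y + c ≤ 20 * X) :
    γ / 8000 * (M ^ 2 * X ^ (γ - 3)) * (m' - m) ≤
      m' ^ 3 * (m' * y + c) ^ (γ - 3) - m ^ 3 * (m * y + c) ^ (γ - 3) ∧
    m' ^ 3 * (m' * y + c) ^ (γ - 3) - m ^ 3 * (m * y + c) ^ (γ - 3) ≤
      12 * (M ^ 2 * X ^ (γ - 3)) * (m' - m) := by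
  rcases eq_or_lt_of_le hmm with rfl | hlt
  · simp
  obtain ⟨v, hv, hs⟩ := exists_hasDerivAt_eq_slope (fun v => v ^ 3 * (v * y + c) ^ (γ - 3))
    (fun v => v ^ 2 * ((v * y + c) ^ (γ - 3 - 1) * (γ * (v * y) + 3 * c))) hlt
    (by
      refine ContinuousOn.mul (by fun_prop) (ContinuousOn.rpow_const (by fun_prop) ?_)
      intro v hv
      left
      have : 0 < v := by linarith [hv.1]
      positivity)
    (by
      intro v hv
      have hv0 : 0 < v := by linarith [hv.1]
      have hz : 0 < v * y + c := by positivity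
      have h := (((hasDerivAt_id v).pow 3)).mul
        ((((hasDerivAt_id v).mul_const y).add_const c).rpow_const (p := γ - 3) (Or.inl hz.ne'))
      refine HasDerivAt.congr_deriv h ?_
      simp only [id, Pi.pow_apply]
      have : (v * y + c) ^ (γ - 3) = (v * y + c) ^ (γ - 3 - 1) * (v * y + c) := by
        rw [← Real.rpow_add_one hz.ne']; ring_nf
      rw [this]
      push_cast
      ring)
  have hv0 : 0 < v := by linarith [hv.1]
  have hz : 0 < v * y + c := by positivity
  have hpow : (v * y + c) ^ (γ - 3 - 1) * (v * y + c) = (v * y + c) ^ (γ - 3) := by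
    rw [← Real.rpow_add_one hz.ne']; ring_nf
  have hw := rpow_window γ X (v * y + c) hγ0 hγ1 hX
    (by nlinarith [hv.1]) (by nlinarith [hv.2])
  have hz4 : 0 < (v * y + c) ^ (γ - 3 - 1) := Real.rpow_pos_of_pos hz _
  have hX3 : 0 < X ^ (γ - 3) := Real.rpow_pos_of_pos hX _
  have b1 : γ * (v * y + c) ^ (γ - 3) ≤ (v * y + c) ^ (γ - 3 - 1) * (γ * (v * y) + 3 * c) := by
    calc γ * (v * y + c) ^ (γ - 3) = (v * y + c) ^ (γ - 3 - 1) * (γ * (v * y) + γ * c) := by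
          rw [← hpow]; ring
      _ ≤ _ := by gcongr; linarith
  have b2 : (v * y + c) ^ (γ - 3 - 1) * (γ * (v * y) + 3 * c) ≤ 3 * (v * y + c) ^ (γ - 3) := by
    calc _ ≤ (v * y + c) ^ (γ - 3 - 1) * (3 * (v * y) + 3 * c) := by
          have : γ ≤ 3 := by linarith
          gcongr
      _ = _ := by rw [← hpow]; ring
  have hd : 0 < m' - m := by linarith
  rw [eq_div_iff hd.ne'] at hs
  rw [← hs]
  constructor
  · refine mul_le_mul_of_nonneg_right ?_ hd.le
    calc γ / 8000 * (M ^ 2 * X ^ (γ - 3)) = M ^ 2 * (γ * (X ^ (γ - 3) / 8000)) := by ring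
      _ ≤ v ^ 2 * (γ * (v * y + c) ^ (γ - 3)) := by
        have : M ≤ v := by linarith [hv.1]
        have := hw.1
        gcongr
      _ ≤ _ := by gcongr
  · refine mul_le_mul_of_nonneg_right ?_ hd.le
    calc _ ≤ v ^ 2 * (3 * (v * y + c) ^ (γ - 3)) := by gcongr
      _ ≤ (2 * M) ^ 2 * (3 * X ^ (γ - 3)) := by
        have : v ≤ 2 * M := by linarith [hv.2]
        have := hw.2
        gcongr
      _ = _ := by ring

lemma weyl_third_diff_rpow (x : ℕ → ℝ) (n : ℕ) (L lam C₀ : ℝ) (Q : ℕ) (hC₀ : 1 ≤ C₀)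
    (hQ : 1 ≤ Q) (hQL : (Q : ℝ) ^ 2 ≤ L) (hn : n ≤ L) (hlam : 0 < lam)
    (hlam1 : lam * (Q : ℝ) ^ 6 ≤ 1)
    (h : ∀ k < n, lam ≤ fdiff (fdiff (fdiff x)) k ∧ fdiff (fdiff (fdiff x)) k ≤ C₀ * lam) :
    ‖∑ k ∈ range n, e2pi (x k)‖ ≤
      (4000 * C₀) * (1 + Real.log (1 / lam)) * (L / Q + Q / (lam ^ (3 / 4 : ℝ) * L)) := by
  have h4 : (lam ^ (1 / 4 : ℝ)) ^ 4 = lam := by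
    rw [← Real.rpow_mul_natCast hlam.le]; norm_num
  have h3 : (lam ^ (1 / 4 : ℝ)) ^ 3 = lam ^ (3 / 4 : ℝ) := by
    rw [← Real.rpow_mul_natCast hlam.le]; norm_num
  have := weyl_third_diff x n L (lam ^ (1 / 4 : ℝ)) C₀ Q hC₀ hQ hQL hn (by positivity)
    (by rwa [h4]) (fun k hk => by rw [h4]; exact (h k hk).1)
    (fun k hk => by rw [h4]; exact (h k hk).2)
  rwa [h4, h3] at this

lemma sum_convex_eq_sum_range (P : ℕ → Prop) [DecidablePred P] (a len : ℕ)
    (hP : ∀ x y z, x ≤ y → y ≤ z → P x → P z → P y) :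
    ∃ s n, a ≤ s ∧ s + n ≤ a + len ∧ (∀ k < n, P (s + k)) ∧
      ∀ f : ℕ → ℂ, ∑ l ∈ range len, (if P (a + l) then f (a + l) else 0) =
        ∑ k ∈ range n, f (s + k) := by
  have e : ∀ f : ℕ → ℂ, ∑ l ∈ range len, (if P (a + l) then f (a + l) else 0) =
      ∑ l ∈ (Ico a (a + len)).filter P, f l := fun f => by
    rw [sum_filter, sum_Ico_eq_sum_range, Nat.add_sub_cancel_left]
  rcases ((Ico a (a + len)).filter P).eq_empty_or_nonempty with h0 | hne
  · refine ⟨a, 0, le_rfl, by omega, by simp, fun f => ?_⟩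
    rw [e, h0]; simp
  · set S := (Ico a (a + len)).filter P with hS
    have hmin := S.min'_mem hne
    have hmax := S.max'_mem hne
    set s := S.min' hne
    set t := S.max' hne
    have hst : s ≤ t := S.min'_le _ hmax
    have hs' := hmin
    have ht' := hmax
    rw [hS, mem_filter, mem_Ico] at hs' ht'
    refine ⟨s, t + 1 - s, hs'.1.1, by omega, fun k hk => ?_, fun f => ?_⟩
    · exact hP s _ t (by omega) (by omega) hs'.2 ht'.2
    · rw [e, ← sum_Ico_eq_sum_range]
      congr 1
      ext l
      rw [mem_Ico]
      constructor
      · intro hl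
        have := S.min'_le _ hl
        have := S.le_max' _ hl
        omega
      · intro hl
        rw [hS, mem_filter, mem_Ico]
        exact ⟨by omega, hP s l t (by omega) (by omega) hs'.2 ht'.2⟩

lemma sum_rpow_neg_three_quarters_le (n : ℕ) :
    ∑ d ∈ Ico 1 (n + 1), 1 / (d : ℝ) ^ (3 / 4 : ℝ) ≤ 4 * (n : ℝ) ^ (1 / 4 : ℝ) := by
  induction n with
  | zero => simp
  | succ n ih =>
    rw [sum_Ico_succ_top (by omega)]
    have e1 : ∀ m : ℕ, ((m : ℝ) ^ (1 / 4 : ℝ)) ^ 4 = m := fun m => by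
      rw [← Real.rpow_mul_natCast m.cast_nonneg]; norm_num
    have e3 : ((n + 1 : ℕ) : ℝ) ^ (3 / 4 : ℝ) = (((n + 1 : ℕ) : ℝ) ^ (1 / 4 : ℝ)) ^ 3 := by
      rw [← Real.rpow_mul_natCast (Nat.cast_nonneg _)]; norm_num
    rw [e3]
    have ha := e1 n
    have hb := e1 (n + 1)
    have hab : (n : ℝ) ^ (1 / 4 : ℝ) ≤ ((n + 1 : ℕ) : ℝ) ^ (1 / 4 : ℝ) := by
      gcongr; linarith
    have ha0 : (0 : ℝ) ≤ (n : ℝ) ^ (1 / 4 : ℝ) := by positivity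
    have hb0 : (0 : ℝ) < ((n + 1 : ℕ) : ℝ) ^ (1 / 4 : ℝ) := by positivity
    set a := (n : ℝ) ^ (1 / 4 : ℝ)
    set b := ((n + 1 : ℕ) : ℝ) ^ (1 / 4 : ℝ)
    push_cast at hb
    have key : 1 ≤ 4 * (b - a) * b ^ 3 := by
      have h1 : b ^ 4 - a ^ 4 = (b - a) * (b ^ 3 + b ^ 2 * a + b * a ^ 2 + a ^ 3) := by ring
      have h2 : b ^ 3 + b ^ 2 * a + b * a ^ 2 + a ^ 3 ≤ 4 * b ^ 3 := by
        have i1 : b ^ 2 * a ≤ b ^ 2 * b := by gcongr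
        have i2 : b * a ^ 2 ≤ b * b ^ 2 := by gcongr
        have i3 : a ^ 3 ≤ b ^ 3 := by gcongr
        linarith
      have h3 : (b - a) * (b ^ 3 + b ^ 2 * a + b * a ^ 2 + a ^ 3) ≤ (b - a) * (4 * b ^ 3) :=
        mul_le_mul_of_nonneg_left h2 (by linarith)
      linarith
    have : 1 / b ^ 3 ≤ 4 * (b - a) := by
      rw [div_le_iff₀ (by positivity)]; exact key
    linarith

/-- The standing hypotheses on the exponent `γ`, the length `N`, the frequency `j`, the shift `c`
and the saving `Q`. -/
structure Admissible (γ j c : ℝ) (N Q : ℕ) : Prop where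
  γ_ge : 13 / 14 ≤ γ
  γ_lt : γ < 1
  j_ge : 1 ≤ j
  c_nonneg : 0 ≤ c
  c_le : c ≤ 1
  N_pos : 1 ≤ N
  Q_pos : 1 ≤ Q
  Q_pow : Q ^ 7 ≤ N
  freq : j * (N : ℝ) ^ γ * (Q : ℝ) ^ 7 ≤ (N : ℝ) ^ 2

/-- The constant in the third derivative of `y ^ γ`. -/
noncomputable def thirdConst (γ : ℝ) : ℝ := γ * (1 - γ) * (2 - γ)

lemma thirdConst_pos {γ : ℝ} (h0 : 13 / 14 ≤ γ) (h1 : γ < 1) : 0 < thirdConst γ :=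
  mul_pos (mul_pos (by linarith) (by linarith)) (by linarith)

lemma thirdConst_le {γ : ℝ} (h0 : 13 / 14 ≤ γ) (h1 : γ < 1) : thirdConst γ ≤ 1 := by
  unfold thirdConst
  nlinarith [mul_pos (sub_pos.2 h1) (by linarith : (0 : ℝ) < γ)]

/-- The amplitude `θ n² + j (n + c)^γ` at an integer argument. -/
noncomputable def intPhase (γ θ j c : ℝ) (n : ℕ) : ℝ := θ * (n : ℝ) ^ 2 + j * ((n : ℝ) + c) ^ γ

lemma phase_eq_intPhase (γ θ j c : ℝ) (m s k : ℕ) :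
    phase γ θ j c m (s + k) = intPhase γ θ j c (m * (s + k)) := by
  unfold phase intPhase
  push_cast
  ring

lemma one_add_log_le (K E N : ℝ) (hK : 1 ≤ K) (hE : 0 < E) (hN : 1 ≤ N) (h : E ≤ K * N ^ 3) :
    1 + Real.log E ≤ (4 + Real.log K) * (1 + Real.log N) := by
  have h1 := Real.log_le_log hE h
  rw [Real.log_mul (by positivity) (by positivity), Real.log_pow] at h1
  have hN0 := Real.log_nonneg hN
  have hK0 := Real.log_nonneg hK
  push_cast at h1
  nlinarith

lemma rpow_sub_three_eq (γ X : ℝ) (hX : 0 < X) : X ^ (γ - 3) = X ^ γ / X ^ 3 := by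
  rw [Real.rpow_sub hX]; norm_num

lemma Admissible.pow_eight_le {γ j c : ℝ} {N Q : ℕ} (h : Admissible γ j c N Q) :
    (Q : ℝ) ^ 8 ≤ (N : ℝ) ^ (3 * γ - 1) := by
  have hQ : (1 : ℝ) ≤ Q := by exact_mod_cast h.Q_pos
  have hN : (1 : ℝ) ≤ N := by exact_mod_cast h.N_pos
  have h7 : (Q : ℝ) ^ 7 ≤ N := by exact_mod_cast h.Q_pow
  calc (Q : ℝ) ^ 8 = ((Q : ℝ) ^ 7) ^ (8 / 7 : ℝ) := by
        rw [← Real.rpow_natCast_mul (by positivity), ← Real.rpow_natCast]; norm_num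
    _ ≤ (N : ℝ) ^ (8 / 7 : ℝ) := by gcongr
    _ ≤ (N : ℝ) ^ (3 * γ - 1) :=
        Real.rpow_le_rpow_of_exponent_le hN (by linarith [h.γ_ge])

/-- The implied constant in the estimates below. -/
noncomputable def expConst (γ : ℝ) : ℝ := 8000 / (thirdConst γ * γ)

lemma expConst_ge {γ : ℝ} (h0 : 13 / 14 ≤ γ) (h1 : γ < 1) : 8000 ≤ expConst γ := by
  have := thirdConst_le h0 h1
  have h := thirdConst_pos h0 h1
  unfold expConst
  rw [le_div_iff₀ (mul_pos h (by linarith))]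
  nlinarith

lemma linear_sum_le {γ j c : ℝ} {N Q : ℕ} (h : Admissible γ j c N Q) (θ : ℝ) (m s n : ℕ)
    (hm : 1 ≤ m) (hmN : m ^ 7 ≤ N ^ 2) (hs : N < m * s)
    (hn : ∀ k < n, m * (s + k) ≤ 2 * N) :
    ‖∑ k ∈ range n, e2pi (intPhase γ θ j c (m * (s + k)))‖ ≤
      32000000 * (4 + Real.log (expConst γ)) * (2 + 2 * expConst γ) *
        ((1 + Real.log N) * (N / (m * Q))) := by
  obtain ⟨hγ0, hγ1, hj, hc0, hc1, hN, hQ, hQ7, hF⟩ := id h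
  have hκ := thirdConst_pos hγ0 hγ1
  have hκ1 := thirdConst_le hγ0 hγ1
  have hE := expConst_ge hγ0 hγ1
  set E := expConst γ with hEdef
  have hQ1 : (1 : ℝ) ≤ Q := by exact_mod_cast hQ
  have hN1 : (1 : ℝ) ≤ N := by exact_mod_cast hN
  have hm1 : (1 : ℝ) ≤ m := by exact_mod_cast hm
  have hQ0 : (0 : ℝ) < Q := by linarith
  have hN0 : (0 : ℝ) < N := by linarith
  have hm0 : (0 : ℝ) < m := by linarith
  have hlogN := Real.log_nonneg hN1
  have hlogE : 0 ≤ Real.log E := Real.log_nonneg (by linarith)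
  have hQ2m : Q ^ 2 * m ≤ N := by
    have : (Q ^ 2 * m) ^ 7 ≤ N ^ 7 := by
      calc (Q ^ 2 * m) ^ 7 = (Q ^ 7) ^ 2 * m ^ 7 := by ring
        _ ≤ N ^ 2 * N ^ 2 := by gcongr
        _ = N ^ 4 := by ring
        _ ≤ N ^ 7 := Nat.pow_le_pow_right hN (by norm_num)
    exact lt_of_pow_lt_pow_left₀ 7 (Nat.zero_le _) (Nat.lt_succ_of_le this |>.trans_le
      (Nat.pow_lt_pow_left (Nat.lt_succ_self N) (by norm_num))) |> Nat.lt_succ_iff.1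
  have hm3 : m ^ 3 ≤ N := by
    have : (m ^ 3) ^ 7 ≤ N ^ 7 := by
      calc (m ^ 3) ^ 7 = (m ^ 7) ^ 3 := by ring
        _ ≤ (N ^ 2) ^ 3 := by gcongr
        _ = N ^ 6 := by ring
        _ ≤ N ^ 7 := Nat.pow_le_pow_right hN (by norm_num)
    exact (Nat.pow_le_pow_iff_left (by norm_num)).1 this
  have hmN' : m ≤ N := le_trans (Nat.le_self_pow (by norm_num) m) hm3
  have hmNR : (m : ℝ) ≤ N := by exact_mod_cast hmN'
  set L : ℝ := 2 * N / m with hL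
  have hL0 : 0 < L := by positivity
  set lam : ℝ := thirdConst γ / 8000 * (j * (m ^ 3 * (N : ℝ) ^ (γ - 3))) with hlam
  have hNγ : 0 < (N : ℝ) ^ (γ - 3) := Real.rpow_pos_of_pos hN0 _
  have hlam0 : 0 < lam := by positivity
  have hs0 : 1 ≤ s := by
    rcases Nat.eq_zero_or_pos s with h0 | h0
    · subst h0; omega
    · exact h0
  have hnL : (n : ℝ) ≤ L := by
    rcases Nat.eq_zero_or_pos n with h0 | h0
    · subst h0; simp [hL0.le]
    · have := hn (n - 1) (by omega)
      have h2 : m * n ≤ 2 * N := by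
        refine le_trans (Nat.mul_le_mul_left m ?_) this
        omega
      rw [hL, le_div_iff₀ hm0]
      calc (n : ℝ) * m = ((m * n : ℕ) : ℝ) := by push_cast; ring
        _ ≤ ((2 * N : ℕ) : ℝ) := by exact_mod_cast h2
        _ = _ := by push_cast; ring
  have hQL : (Q : ℝ) ^ 2 ≤ L := by
    rw [hL, le_div_iff₀ hm0]
    have : (Q : ℝ) ^ 2 * m ≤ N := by exact_mod_cast hQ2m
    linarith
  have hlamQ : lam * (Q : ℝ) ^ 6 ≤ 1 := by
    have h67 : (Q : ℝ) ^ 6 ≤ (Q : ℝ) ^ 7 := pow_le_pow_right₀ hQ1 (by norm_num)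
    have hm3R : (m : ℝ) ^ 3 ≤ N := by exact_mod_cast hm3
    calc lam * (Q : ℝ) ^ 6 = thirdConst γ / 8000 * (m ^ 3 *
          ((j * (N : ℝ) ^ γ * (Q : ℝ) ^ 6) / (N : ℝ) ^ 3)) := by
          rw [hlam, rpow_sub_three_eq _ _ hN0]; ring
      _ ≤ 1 / 8000 * (N * ((N : ℝ) ^ 2 / (N : ℝ) ^ 3)) := by
          have : j * (N : ℝ) ^ γ * (Q : ℝ) ^ 6 ≤ (N : ℝ) ^ 2 := le_trans (by gcongr) hF
          gcongr
      _ = 1 / 8000 := by field_simp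
      _ ≤ 1 := by norm_num
  have hthird : ∀ k < n, lam ≤ fdiff (fdiff (fdiff fun i : ℕ =>
        intPhase γ θ j c (m * (s + i)))) k ∧
      fdiff (fdiff (fdiff fun i : ℕ => intPhase γ θ j c (m * (s + i)))) k ≤ 8000 * lam := by
    intro k hk
    simp_rw [← phase_eq_intPhase]
    have hw : ∀ v, (s : ℝ) + k ≤ v → v ≤ s + k + 3 →
        (N : ℝ) ^ (γ - 3) / 8000 ≤ (m * v + c) ^ (γ - 3) ∧
          (m * v + c) ^ (γ - 3) ≤ (N : ℝ) ^ (γ - 3) := by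
      intro v h1 h2
      have a1 : (N : ℝ) ≤ m * s := by exact_mod_cast hs.le
      have a2 : (m : ℝ) * (s + k) ≤ 2 * N := by exact_mod_cast hn k hk
      refine rpow_window γ N _ (by linarith) hγ1 hN0 ?_ ?_
      · have : (m : ℝ) * s ≤ m * v := by
          gcongr
          have : (0 : ℝ) ≤ k := k.cast_nonneg
          linarith
        linarith
      · have : (m : ℝ) * v ≤ m * (s + k + 3) := by gcongr
        nlinarith
    refine phase_fdiff_three γ θ j c m s lam (8000 * lam) k hm0 (by exact_mod_cast hs0) hc0
      (fun v h1 h2 => ?_) (fun v h1 h2 => ?_)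
    · calc lam = j * thirdConst γ * (m ^ 3 * ((N : ℝ) ^ (γ - 3) / 8000)) := by rw [hlam]; ring
        _ ≤ j * thirdConst γ * (m ^ 3 * (m * v + c) ^ (γ - 3)) := by
          have := (hw v h1 h2).1
          gcongr
        _ = _ := rfl
    · calc _ = j * thirdConst γ * (m ^ 3 * (m * v + c) ^ (γ - 3)) := rfl
        _ ≤ j * thirdConst γ * (m ^ 3 * (N : ℝ) ^ (γ - 3)) := by
          have := (hw v h1 h2).2
          gcongr
        _ = 8000 * lam := by rw [hlam]; ring
  have key := weyl_third_diff_rpow _ n L lam 8000 Q (by norm_num) hQ hQL hnL hlam0 hlamQ hthird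
  have hEκ : 8000 / thirdConst γ ≤ E := by
    rw [hEdef, expConst]
    gcongr
    nlinarith
  have hlog : 1 + Real.log (1 / lam) ≤ (4 + Real.log E) * (1 + Real.log N) := by
    refine one_add_log_le E _ N (by linarith) (by positivity) hN1 ?_
    calc 1 / lam = 8000 / thirdConst γ * (N ^ 3 / (j * m ^ 3 * (N : ℝ) ^ γ)) := by
          rw [hlam, rpow_sub_three_eq _ _ hN0]; field_simp
      _ ≤ E * (N ^ 3 / 1) := by
          gcongr
          have : 1 ≤ (N : ℝ) ^ γ := Real.one_le_rpow hN1 (by linarith)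
          have : (1 : ℝ) ≤ m ^ 3 := one_le_pow₀ hm1
          have : 1 ≤ j * m ^ 3 := one_le_mul_of_one_le_of_one_le hj this
          exact one_le_mul_of_one_le_of_one_le this ‹_›
      _ = _ := by ring
  have hsec : Q / (lam ^ (3 / 4 : ℝ) * L) ≤ E * (L / Q) := by
    have h4 : (lam ^ (3 / 4 : ℝ)) ^ 4 = lam ^ 3 := by
      rw [← Real.rpow_mul_natCast hlam0.le, ← Real.rpow_natCast]; norm_num
    have h8 : ((Q : ℝ) * Q) ^ 4 ≤ (E * L * (lam ^ (3 / 4 : ℝ) * L)) ^ 4 := by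
      calc ((Q : ℝ) * Q) ^ 4 = (Q : ℝ) ^ 8 := by ring
        _ ≤ (N : ℝ) ^ (3 * γ - 1) := h.pow_eight_le
        _ = ((N : ℝ) ^ γ) ^ 3 / N := by
            rw [Real.rpow_sub hN0, mul_comm, Real.rpow_mul hN0.le, Real.rpow_one]
            norm_num
        _ ≤ (256 * 8000 * j ^ 3 * m) * (((N : ℝ) ^ γ) ^ 3 / N) := by
            refine le_mul_of_one_le_left (by positivity) ?_
            have : 1 ≤ j ^ 3 := one_le_pow₀ hj
            nlinarith [one_le_mul_of_one_le_of_one_le this hm1]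
        _ = (8000 / thirdConst γ) ^ 4 * lam ^ 3 * L ^ 8 * thirdConst γ := by
            rw [hlam, hL, rpow_sub_three_eq _ _ hN0]; field_simp; norm_num
        _ ≤ E ^ 4 * lam ^ 3 * L ^ 8 * 1 := by gcongr
        _ = E ^ 4 * (lam ^ (3 / 4 : ℝ)) ^ 4 * L ^ 8 := by rw [h4, mul_one]
        _ = _ := by ring
    have h1 := le_of_pow_le_pow_left₀ (by norm_num) (by positivity) h8
    rw [div_le_iff₀ (by positivity)]
    calc (Q : ℝ) = Q * Q / Q := by field_simp
      _ ≤ E * L * (lam ^ (3 / 4 : ℝ) * L) / Q := by gcongr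
      _ = _ := by ring
  refine key.trans ?_
  calc _ ≤ 4000 * 8000 * ((4 + Real.log E) * (1 + Real.log N)) * (L / Q + E * (L / Q)) := by
        gcongr
    _ = 32000000 * (4 + Real.log E) * (2 + 2 * E) * ((1 + Real.log N) * (N / (m * Q))) := by
        rw [hL]; field_simp; ring

/-- `e(θ n² + j (n + c)^γ)` restricted to `N < n ≤ N'`. -/
noncomputable def windowed (γ θ j c : ℝ) (N N' n : ℕ) : ℂ :=
  if N < n ∧ n ≤ N' then e2pi (intPhase γ θ j c n) else 0

lemma norm_windowed_le (γ θ j c : ℝ) (N N' n : ℕ) : ‖windowed γ θ j c N N' n‖ ≤ 1 := by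
  unfold windowed
  split_ifs
  · exact (norm_e2pi _).le
  · simp

lemma correlation_le {γ j c : ℝ} {N Q : ℕ} (h : Admissible γ j c N Q) (θ : ℝ) (M L N' m d : ℕ)
    (hM : 1 ≤ M) (hML : M ≤ L) (hQL : Q ^ 2 ≤ L) (hN : N < 4 * (M * L)) (hN2 : M * L ≤ 2 * N)
    (hd : 1 ≤ d) (hdQ : d < Q) (hm : m + d < M) (lam : ℝ)
    (hlam : lam = j * (M ^ 2 * ((M : ℝ) * L) ^ (γ - 3)) / expConst γ) :
    ‖∑ l ∈ range L, (starRingEnd ℂ) (windowed γ θ j c N N' ((M + m) * (L + l))) *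
        windowed γ θ j c N N' ((M + (m + d)) * (L + l))‖ ≤
      48000 * expConst γ * ((4 + Real.log (8 * expConst γ)) * (1 + Real.log N)) *
        (L / Q + Q / (lam ^ (3 / 4 : ℝ) * L) * (1 / (d : ℝ) ^ (3 / 4 : ℝ))) := by
  obtain ⟨hγ0, hγ1, hj, hc0, hc1, hN1, hQ, hQ7, hF⟩ := id h
  have hκ := thirdConst_pos hγ0 hγ1
  have hκ1 := thirdConst_le hγ0 hγ1
  have hE := expConst_ge hγ0 hγ1
  have hEκ : expConst γ = 8000 / (thirdConst γ * γ) := rfl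
  set E := expConst γ with hEdef
  have hQ1 : (1 : ℝ) ≤ Q := by exact_mod_cast hQ
  have hN1' : (1 : ℝ) ≤ N := by exact_mod_cast hN1
  have hM1 : (1 : ℝ) ≤ M := by exact_mod_cast hM
  have hML' : (M : ℝ) ≤ L := by exact_mod_cast hML
  have hd1 : (1 : ℝ) ≤ d := by exact_mod_cast hd
  have hdQ' : (d : ℝ) ≤ Q := by exact_mod_cast hdQ.le
  have hQ0 : (0 : ℝ) < Q := by linarith
  have hN0 : (0 : ℝ) < N := by linarith
  have hM0 : (0 : ℝ) < M := by linarith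
  have hL0 : (0 : ℝ) < L := by linarith
  set X : ℝ := (M : ℝ) * L with hX
  have hX0 : 0 < X := by positivity
  have hNX : (N : ℝ) ≤ 4 * X := by rw [hX]; exact_mod_cast hN.le
  have hXN : X ≤ 2 * N := by rw [hX]; exact_mod_cast hN2
  have hXγ : 0 < X ^ (γ - 3) := Real.rpow_pos_of_pos hX0 _
  have hlam0 : 0 < lam := by rw [hlam]; positivity
  obtain ⟨s, n, hs, hsn, hP, hsum⟩ := sum_convex_eq_sum_range
    (fun l => (N < (M + m) * l ∧ (M + m) * l ≤ N') ∧
      (N < (M + (m + d)) * l ∧ (M + (m + d)) * l ≤ N')) L L (by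
        rintro x y z hxy hyz ⟨⟨a1, -⟩, ⟨a2, -⟩⟩ ⟨⟨-, b1⟩, ⟨-, b2⟩⟩
        exact ⟨⟨a1.trans_le (Nat.mul_le_mul_left _ hxy), (Nat.mul_le_mul_left _ hyz).trans b1⟩,
          ⟨a2.trans_le (Nat.mul_le_mul_left _ hxy), (Nat.mul_le_mul_left _ hyz).trans b2⟩⟩)
  have hnL : (n : ℝ) ≤ L := by
    have : n ≤ L := by omega
    exact_mod_cast this
  have e : ∑ l ∈ range L, (starRingEnd ℂ) (windowed γ θ j c N N' ((M + m) * (L + l))) *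
        windowed γ θ j c N N' ((M + (m + d)) * (L + l)) =
      ∑ k ∈ range n, e2pi (phase γ θ j c ((M + (m + d) : ℕ) : ℝ) (s + k) -
        phase γ θ j c ((M + m : ℕ) : ℝ) (s + k)) := by
    have := hsum (fun l => e2pi (intPhase γ θ j c ((M + (m + d)) * l) -
      intPhase γ θ j c ((M + m) * l)))
    simp_rw [phase_eq_intPhase]
    rw [← this]
    refine sum_congr rfl fun l _ => ?_
    unfold windowed
    by_cases h1 : N < (M + m) * (L + l) ∧ (M + m) * (L + l) ≤ N'
    · by_cases h2 : N < (M + (m + d)) * (L + l) ∧ (M + (m + d)) * (L + l) ≤ N'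
      · rw [if_pos h1, if_pos h2, if_pos ⟨h1, h2⟩, ← e2pi_neg, ← e2pi_add]
        congr 1; ring
      · rw [if_neg h2, mul_zero, if_neg fun h => h2 h.2]
    · rw [if_neg h1, map_zero, zero_mul, if_neg fun h => h1 h.1]
  rw [e]
  have hthird : ∀ k < n, lam * d ≤ fdiff (fdiff (fdiff fun i : ℕ =>
        phase γ θ j c ((M + (m + d) : ℕ) : ℝ) (s + i) -
          phase γ θ j c ((M + m : ℕ) : ℝ) (s + i))) k ∧
      fdiff (fdiff (fdiff fun i : ℕ => phase γ θ j c ((M + (m + d) : ℕ) : ℝ) (s + i) -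
          phase γ θ j c ((M + m : ℕ) : ℝ) (s + i))) k ≤ 12 * E * (lam * d) := by
    intro k hk
    have hs1 : (L : ℝ) ≤ s := by exact_mod_cast hs
    have hk1 : (s : ℝ) + k + 1 ≤ 2 * L := by
      have : s + k + 1 ≤ 2 * L := by omega
      exact_mod_cast this
    have hL1 : (1 : ℝ) ≤ L := by linarith
    have hk0 : (0 : ℝ) ≤ k := k.cast_nonneg
    have hmd : (m : ℝ) + d ≤ M := by exact_mod_cast hm.le
    have hm0 : (0 : ℝ) ≤ m := m.cast_nonneg
    have hw : ∀ v, (s : ℝ) + k ≤ v → v ≤ s + k + 3 → _ := fun v h1 h2 =>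
      cube_rpow_diff_bounds γ c v X M ((M + m : ℕ) : ℝ) ((M + (m + d) : ℕ) : ℝ) (by linarith) hγ1
        hc0 hX0 hM0 (by linarith) (by push_cast; linarith) (by push_cast; linarith)
        (by push_cast; linarith) (by rw [hX]; gcongr; linarith)
        (by
          have : v ≤ 5 * L := by linarith
          have h3 : 2 * M * v ≤ 2 * M * (5 * L) := by gcongr
          have h4 : (1 : ℝ) ≤ X := one_le_mul_of_one_le_of_one_le hM1 hL1
          calc 2 * M * v + c ≤ 2 * M * (5 * L) + 1 := by linarith
            _ = 10 * X + 1 := by rw [hX]; ring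
            _ ≤ 20 * X := by linarith)
    have hdd : (((M + (m + d) : ℕ) : ℝ) - ((M + m : ℕ) : ℝ)) = d := by push_cast; ring
    rw [hdd] at hw
    refine phase_sub_fdiff_three γ θ j c _ _ s _ _ k (by push_cast; linarith)
      (by push_cast; linarith) (by linarith) hc0 (fun v h1 h2 => ?_) (fun v h1 h2 => ?_)
    · calc lam * d = j * thirdConst γ * (γ / 8000 * (M ^ 2 * X ^ (γ - 3)) * d) := by
            rw [hlam, hEκ]; field_simp
        _ ≤ j * thirdConst γ * _ := mul_le_mul_of_nonneg_left (hw v h1 h2).1 (by positivity)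
        _ = _ := by unfold phaseThird thirdConst; ring
    · calc _ = j * thirdConst γ * (((M + (m + d) : ℕ) : ℝ) ^ 3 *
              (((M + (m + d) : ℕ) : ℝ) * v + c) ^ (γ - 3) - ((M + m : ℕ) : ℝ) ^ 3 *
              (((M + m : ℕ) : ℝ) * v + c) ^ (γ - 3)) := by unfold phaseThird thirdConst; ring
        _ ≤ j * thirdConst γ * (12 * (M ^ 2 * X ^ (γ - 3)) * d) :=
            mul_le_mul_of_nonneg_left (hw v h1 h2).2 (by positivity)
        _ ≤ j * 1 * (12 * (M ^ 2 * X ^ (γ - 3)) * d) := by gcongr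
        _ = _ := by rw [hlam]; field_simp
  have hlamQ : lam * d * (Q : ℝ) ^ 6 ≤ 1 := by
    have hXp : X ^ γ ≤ 2 * (N : ℝ) ^ γ := by
      calc X ^ γ ≤ (2 * N : ℝ) ^ γ := by gcongr
        _ = 2 ^ γ * (N : ℝ) ^ γ := Real.mul_rpow (by norm_num) hN0.le
        _ ≤ 2 ^ (1 : ℝ) * (N : ℝ) ^ γ := by
          gcongr
          norm_num
        _ = _ := by norm_num
    calc lam * d * (Q : ℝ) ^ 6 ≤ lam * Q * (Q : ℝ) ^ 6 := by gcongr
      _ = M ^ 2 / X ^ 3 / E * (j * X ^ γ * (Q : ℝ) ^ 7) := by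
          rw [hlam, rpow_sub_three_eq _ _ hX0]; ring
      _ ≤ M ^ 2 / X ^ 3 / E * (j * (2 * (N : ℝ) ^ γ) * (Q : ℝ) ^ 7) := by gcongr
      _ = 2 * (M ^ 2 / X ^ 3 / E) * (j * (N : ℝ) ^ γ * (Q : ℝ) ^ 7) := by ring
      _ ≤ 2 * (M ^ 2 / X ^ 3 / E) * (4 * X) ^ 2 := by
          gcongr
          exact hF.trans (by gcongr)
      _ = 32 * (M / L) / E := by rw [hX]; field_simp; norm_num
      _ ≤ 32 * 1 / E := by
          gcongr
          rw [div_le_one hL0]; exact hML'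
      _ ≤ 1 := by rw [div_le_one (by linarith)]; linarith
  have key := weyl_third_diff_rpow _ n L (lam * d) (12 * E) Q (by linarith) hQ
    (by exact_mod_cast hQL) hnL (by positivity) hlamQ hthird
  refine key.trans ?_
  have hlogN := Real.log_nonneg hN1'
  have hlog : 1 + Real.log (1 / (lam * d)) ≤ (4 + Real.log (8 * E)) * (1 + Real.log N) := by
    refine one_add_log_le (8 * E) _ N (by linarith) (by positivity) hN1' ?_
    have hL1 : (1 : ℝ) ≤ L := by linarith
    have h4 : (1 : ℝ) ≤ X := one_le_mul_of_one_le_of_one_le hM1 hL1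
    calc 1 / (lam * d) = E * (X ^ 3 / (j * M ^ 2 * X ^ γ * d)) := by
          rw [hlam, rpow_sub_three_eq _ _ hX0]; field_simp
      _ ≤ E * ((2 * N) ^ 3 / 1) := by
          gcongr
          have h1 : 1 ≤ X ^ γ := Real.one_le_rpow h4 (by linarith)
          have h2 : (1 : ℝ) ≤ M ^ 2 := one_le_pow₀ hM1
          exact one_le_mul_of_one_le_of_one_le (one_le_mul_of_one_le_of_one_le
            (one_le_mul_of_one_le_of_one_le hj h2) h1) hd1
      _ = _ := by ring
  calc _ ≤ 4000 * (12 * E) * ((4 + Real.log (8 * E)) * (1 + Real.log N)) *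
        (L / Q + Q / ((lam * d) ^ (3 / 4 : ℝ) * L)) := by gcongr
    _ = _ := by
      rw [Real.mul_rpow hlam0.le (by positivity)]
      have : (0 : ℝ) < (d : ℝ) ^ (3 / 4 : ℝ) := by positivity
      have : (0 : ℝ) < lam ^ (3 / 4 : ℝ) := by positivity
      field_simp
      ring

/-- The constant in `block_sum_le`. -/
noncomputable def blockConst (γ : ℝ) : ℝ :=
  3 * (1 + 96000 * expConst γ * (4 + Real.log (8 * expConst γ)) * (1 + 4 * expConst γ))

lemma block_sum_le {γ j c : ℝ} {N Q : ℕ} (h : Admissible γ j c N Q) (θ : ℝ) (M L N' : ℕ)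
    (a b : ℕ → ℂ) (hM : 1 ≤ M) (hML : M ≤ L) (hQM : Q ≤ 2 * M) (hN : N < 4 * (M * L))
    (hN2 : M * L ≤ 2 * N) :
    ‖∑ m ∈ range M, ∑ l ∈ range L,
        a m * b l * windowed γ θ j c N N' ((M + m) * (L + l))‖ ^ 2 ≤
      blockConst γ * (1 + Real.log N) * ((∑ m ∈ range M, ‖a m‖ ^ 2) *
        (∑ l ∈ range L, ‖b l‖ ^ 2)) * (M * L / Q) := by
  obtain ⟨hγ0, hγ1, hj, hc0, hc1, hN1, hQ, hQ7, hF⟩ := id h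
  have hE := expConst_ge hγ0 hγ1
  have hQ1 : (1 : ℝ) ≤ Q := by exact_mod_cast hQ
  have hN1' : (1 : ℝ) ≤ N := by exact_mod_cast hN1
  have hM1 : (1 : ℝ) ≤ M := by exact_mod_cast hM
  have hML' : (M : ℝ) ≤ L := by exact_mod_cast hML
  have hQ0 : (0 : ℝ) < Q := by linarith
  have hN0 : (0 : ℝ) < N := by linarith
  have hM0 : (0 : ℝ) < M := by linarith
  have hL0 : (0 : ℝ) < L := by linarith
  have hQL : Q ^ 2 ≤ L := by
    rcases Nat.lt_or_ge Q 2 with h1 | h2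
    · have : Q = 1 := by omega
      subst this
      rw [one_pow]; omega
    · by_contra! hc
      have h1 : Q ^ 7 < 4 * (L * L) := by
        calc Q ^ 7 ≤ N := hQ7
          _ < 4 * (M * L) := hN
          _ ≤ 4 * (L * L) := by gcongr
      have h2' : 4 * (L * L) ≤ 4 * (Q ^ 2 * Q ^ 2) := by gcongr
      have h3 : 4 * (Q ^ 2 * Q ^ 2) ≤ Q ^ 7 := by
        calc 4 * (Q ^ 2 * Q ^ 2) = 2 ^ 2 * Q ^ 4 := by ring
          _ ≤ Q ^ 2 * Q ^ 4 := by gcongr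
          _ = Q ^ 6 := by ring
          _ ≤ Q ^ 7 := Nat.pow_le_pow_right hQ (by norm_num)
      omega
  set E := expConst γ with hEdef
  set X : ℝ := (M : ℝ) * L with hX
  have hX1 : 1 ≤ X := one_le_mul_of_one_le_of_one_le hM1 (by linarith)
  have hX0 : 0 < X := by linarith
  have hNX : (N : ℝ) ≤ 4 * X := by rw [hX]; exact_mod_cast hN.le
  have hXγ : 0 < X ^ (γ - 3) := Real.rpow_pos_of_pos hX0 _
  set lam := j * (M ^ 2 * X ^ (γ - 3)) / E with hlam
  have hlam0 : 0 < lam := by rw [hlam]; positivity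
  set W := (4 + Real.log (8 * E)) * (1 + Real.log N) with hW
  have hlogN := Real.log_nonneg hN1'
  have hlogE : 0 ≤ Real.log (8 * E) := Real.log_nonneg (by linarith)
  have hW0 : 0 ≤ W := by positivity
  have hv := bilinear_vdc a b (fun m l => windowed γ θ j c N N' ((M + m) * (L + l))) M L Q hQ
    (fun d => 48000 * E * W *
        (L / Q + Q / (lam ^ (3 / 4 : ℝ) * L) * (1 / (d : ℝ) ^ (3 / 4 : ℝ))))
    (fun _ _ _ _ => norm_windowed_le _ _ _ _ _ _ _)
    (fun d hd hdQ m hm => correlation_le h θ M L N' m d hM hML hQL hN hN2 hd hdQ hm lam hlam)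
  set A := ∑ m ∈ range M, ‖a m‖ ^ 2
  set B := ∑ l ∈ range L, ‖b l‖ ^ 2
  have hA0 : 0 ≤ A := by positivity
  have hB0 : 0 ≤ B := by positivity
  set S := ‖∑ m ∈ range M, ∑ l ∈ range L,
        a m * b l * windowed γ θ j c N N' ((M + m) * (L + l))‖
  have hmain : (Q : ℝ) * (Q : ℝ) ^ (1 / 4 : ℝ) ≤ E * lam ^ (3 / 4 : ℝ) * L ^ 2 := by
    have h4 : (lam ^ (3 / 4 : ℝ)) ^ 4 = lam ^ 3 := by
      rw [← Real.rpow_mul_natCast hlam0.le, ← Real.rpow_natCast]; norm_num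
    have hq4 : ((Q : ℝ) ^ (1 / 4 : ℝ)) ^ 4 = Q := by
      rw [← Real.rpow_mul_natCast hQ0.le]; norm_num
    have h5 : (Q : ℝ) ^ 5 ≤ 4 * X ^ (3 * γ - 2) := by
      have h7 : (Q : ℝ) ^ 7 ≤ N := by exact_mod_cast hQ7
      calc (Q : ℝ) ^ 5 = ((Q : ℝ) ^ 7) ^ (5 / 7 : ℝ) := by
            rw [← Real.rpow_natCast_mul (by positivity), ← Real.rpow_natCast]; norm_num
        _ ≤ (4 * X) ^ (5 / 7 : ℝ) := by gcongr; linarith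
        _ = 4 ^ (5 / 7 : ℝ) * X ^ (5 / 7 : ℝ) := Real.mul_rpow (by norm_num) hX0.le
        _ ≤ 4 ^ (1 : ℝ) * X ^ (3 * γ - 2) := by
            gcongr
            · norm_num
            · norm_num
            · linarith
        _ = _ := by norm_num
    have hX3 : X ^ (3 * γ - 2) = (X ^ γ) ^ 3 / X ^ 2 := by
      rw [Real.rpow_sub hX0, mul_comm, Real.rpow_mul hX0.le]
      norm_num
    refine le_of_pow_le_pow_left₀ (n := 4) (by norm_num) (by positivity) ?_
    calc ((Q : ℝ) * (Q : ℝ) ^ (1 / 4 : ℝ)) ^ 4 = (Q : ℝ) ^ 4 * ((Q : ℝ) ^ (1 / 4 : ℝ)) ^ 4 := by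
          ring
      _ = (Q : ℝ) ^ 5 := by rw [hq4]; ring
      _ ≤ 4 * X ^ (3 * γ - 2) := h5
      _ = 4 * 1 * ((X ^ γ) ^ 3 / (X * (M * L))) * 1 := by rw [hX3, ← hX]; ring
      _ ≤ E * j ^ 3 * ((X ^ γ) ^ 3 / (X * (M * L))) * (L / M) := by
          gcongr
          · linarith
          · exact one_le_pow₀ hj
          · rw [one_le_div hM0]; exact hML'
      _ = E ^ 4 * lam ^ 3 * L ^ 8 := by
          rw [hlam, rpow_sub_three_eq _ _ hX0, hX]; field_simp
      _ = E ^ 4 * (lam ^ (3 / 4 : ℝ)) ^ 4 * L ^ 8 := by rw [h4]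
      _ = _ := by ring
  have hT : ∑ d ∈ Ico 1 Q, |48000 * E * W *
        (L / Q + Q / (lam ^ (3 / 4 : ℝ) * L) * (1 / (d : ℝ) ^ (3 / 4 : ℝ)))| ≤
      48000 * E * W * ((1 + 4 * E) * L) := by
    have : ∀ d ∈ Ico 1 Q, |48000 * E * W *
        (L / Q + Q / (lam ^ (3 / 4 : ℝ) * L) * (1 / (d : ℝ) ^ (3 / 4 : ℝ)))| =
        48000 * E * W *
        (L / Q + Q / (lam ^ (3 / 4 : ℝ) * L) * (1 / (d : ℝ) ^ (3 / 4 : ℝ))) := fun d _ =>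
      abs_of_nonneg (by positivity)
    rw [sum_congr rfl this, ← mul_sum, sum_add_distrib, ← mul_sum, sum_const, Nat.card_Ico,
      nsmul_eq_mul]
    gcongr
    have h1 : ((Q - 1 : ℕ) : ℝ) * (L / Q) ≤ L := by
      have : ((Q - 1 : ℕ) : ℝ) ≤ Q := by exact_mod_cast Nat.sub_le _ _
      calc ((Q - 1 : ℕ) : ℝ) * (L / Q) ≤ Q * (L / Q) := by gcongr
        _ = L := by field_simp
    have h2 : ∑ d ∈ Ico 1 Q, 1 / (d : ℝ) ^ (3 / 4 : ℝ) ≤ 4 * (Q : ℝ) ^ (1 / 4 : ℝ) := by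
      refine le_trans ?_ (sum_rpow_neg_three_quarters_le Q)
      refine sum_le_sum_of_subset_of_nonneg (Ico_subset_Ico_right (by omega)) fun d _ _ => ?_
      positivity
    have h3 : Q / (lam ^ (3 / 4 : ℝ) * L) * ∑ d ∈ Ico 1 Q, 1 / (d : ℝ) ^ (3 / 4 : ℝ) ≤
        4 * E * L := by
      calc _ ≤ Q / (lam ^ (3 / 4 : ℝ) * L) * (4 * (Q : ℝ) ^ (1 / 4 : ℝ)) := by gcongr
        _ = 4 * (Q * (Q : ℝ) ^ (1 / 4 : ℝ)) / (lam ^ (3 / 4 : ℝ) * L) := by ring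
        _ ≤ 4 * (E * lam ^ (3 / 4 : ℝ) * L ^ 2) / (lam ^ (3 / 4 : ℝ) * L) := by gcongr
        _ = _ := by field_simp
    linarith
  have hMQ : (M : ℝ) + Q ≤ 3 * M := by
    have : (Q : ℝ) ≤ 2 * M := by exact_mod_cast hQM
    linarith
  have hfin : S ^ 2 * Q ≤ blockConst γ * (1 + Real.log N) * (A * B) * (M * L) := by
    calc S ^ 2 * Q = Q * S ^ 2 := mul_comm _ _
      _ ≤ _ := hv
      _ ≤ 3 * M * A * B * (L + 2 * (48000 * E * W * ((1 + 4 * E) * L))) := by gcongr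
      _ = 3 * (1 + 96000 * E * W * (1 + 4 * E)) * (A * B) * (M * L) := by ring
      _ ≤ 3 * (1 * (1 + Real.log N) + 96000 * E * W * (1 + 4 * E)) * (A * B) * (M * L) := by
          gcongr
          linarith
      _ = _ := by rw [hW, blockConst, ← hEdef]; ring
  rw [mul_div_assoc', le_div_iff₀ hQ0]
  exact hfin

lemma sum_mul_smul_eq {V : Type*} [AddCommGroup V] [Module ℝ V] (f g : ArithmeticFunction ℝ)
    (w : ℕ → V) (K : ℕ) (hw0 : w 0 = 0) (hw : ∀ n, K ≤ n → w n = 0) :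
    ∑ n ∈ range K, (f * g) n • w n =
      ∑ m ∈ range K, ∑ l ∈ range K, (f m * g l) • w (m * l) := by
  have h1 : ∀ x : ℕ × ℕ, (f x.1 * g x.2) • w (x.1 * x.2) =
      ∑ n ∈ range K, if x.1 * x.2 = n then (f x.1 * g x.2) • w (x.1 * x.2) else 0 := by
    intro x
    rw [Finset.sum_ite_eq]
    split_ifs with h
    · rfl
    · rw [hw _ (by simpa using h), smul_zero]
  rw [← Finset.sum_product' (range K) (range K) (fun m l => (f m * g l) • w (m * l)),
    Finset.sum_congr rfl fun x _ => h1 x, Finset.sum_comm]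
  refine Finset.sum_congr rfl fun n hn => ?_
  rw [← Finset.sum_filter]
  rcases Nat.eq_zero_or_pos n with rfl | hn0
  · rw [hw0, smul_zero, Finset.sum_eq_zero]
    intro x hx
    rw [(mem_filter.1 hx).2, hw0, smul_zero]
  · have hset : (range K ×ˢ range K).filter (fun x => x.1 * x.2 = n) = n.divisorsAntidiagonal := by
      ext ⟨a, b⟩
      simp only [mem_filter, mem_product, mem_range, Nat.mem_divisorsAntidiagonal] at hn ⊢
      constructor
      · rintro ⟨-, h⟩
        exact ⟨h, hn0.ne'⟩
      · rintro ⟨h, -⟩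
        subst h
        have ha : 0 < a := Nat.pos_of_mul_pos_right hn0
        have hb : 0 < b := Nat.pos_of_mul_pos_left hn0
        exact ⟨⟨(Nat.le_mul_of_pos_right a hb).trans_lt hn,
          (Nat.le_mul_of_pos_left b ha).trans_lt hn⟩, rfl⟩
    rw [hset, ArithmeticFunction.mul_apply, Finset.sum_smul]
    refine Finset.sum_congr rfl fun x hx => ?_
    rw [(Nat.mem_divisorsAntidiagonal.1 hx).1]

/-- The divisor function, as a real arithmetic function. -/
noncomputable def divisorCount : ArithmeticFunction ℝ :=
  (ArithmeticFunction.zeta : ArithmeticFunction ℝ) * ArithmeticFunction.zeta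

lemma divisorCount_apply (n : ℕ) : divisorCount n = n.divisors.card := by
  rw [divisorCount, ArithmeticFunction.coe_mul_zeta_apply, Finset.card_eq_sum_ones]
  push_cast
  refine Finset.sum_congr rfl fun i hi => ?_
  simp [ArithmeticFunction.natCoe_apply, ArithmeticFunction.zeta_apply,
    (Nat.pos_of_mem_divisors hi).ne']

lemma divisorCount_nonneg (n : ℕ) : 0 ≤ divisorCount n := by
  rw [divisorCount_apply]; positivity

lemma divisorCount_mul_le (m n : ℕ) : divisorCount (m * n) ≤ divisorCount m * divisorCount n := by
  simp only [divisorCount_apply]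
  rw [Nat.divisors_mul]
  exact_mod_cast Finset.card_mul_le

lemma zeta_real_apply (n : ℕ) :
    (ArithmeticFunction.zeta : ArithmeticFunction ℝ) n = if n = 0 then 0 else 1 := by
  simp [ArithmeticFunction.natCoe_apply, ArithmeticFunction.zeta_apply]

lemma sum_range_inv_le (x : ℕ) : ∑ m ∈ range (x + 1), (1 : ℝ) / m ≤ 1 + Real.log x := by
  rw [Finset.sum_range_succ']
  have := sum_inv_le_log x
  rw [Finset.sum_Ico_eq_sum_range] at this
  simpa [add_comm] using this

lemma sum_divisorCount_le (x : ℕ) :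
    ∑ n ∈ range (x + 1), divisorCount n ≤ x * (1 + Real.log x) := by
  have h := sum_mul_smul_eq (V := ℝ) ArithmeticFunction.zeta ArithmeticFunction.zeta
    (fun n => if 1 ≤ n ∧ n ≤ x then 1 else 0) (x + 1) (by simp)
    (fun n hn => if_neg (by omega))
  have e : ∑ n ∈ range (x + 1), divisorCount n = ∑ n ∈ range (x + 1),
      ((ArithmeticFunction.zeta : ArithmeticFunction ℝ) * ArithmeticFunction.zeta) n •
        (if 1 ≤ n ∧ n ≤ x then (1 : ℝ) else 0) := by
    refine Finset.sum_congr rfl fun n hn => ?_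
    rcases Nat.eq_zero_or_pos n with rfl | h0
    · simp
    · rw [if_pos ⟨h0, by simpa [Nat.lt_succ_iff] using hn⟩]
      simp [divisorCount]
  rw [e, h]
  calc _ ≤ ∑ m ∈ range (x + 1), x * ((1 : ℝ) / m) := by
        refine Finset.sum_le_sum fun m hm => ?_
        rcases Nat.eq_zero_or_pos m with rfl | h0
        · simp
        · have hm0 : (0 : ℝ) < m := by exact_mod_cast h0
          have : ∀ l ∈ range (x + 1), ((ArithmeticFunction.zeta : ArithmeticFunction ℝ) m *
              (ArithmeticFunction.zeta : ArithmeticFunction ℝ) l) •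
              (if 1 ≤ m * l ∧ m * l ≤ x then (1 : ℝ) else 0) ≤
              if l ∈ Finset.Ioc 0 (x / m) then 1 else 0 := by
            intro l _
            rw [zeta_real_apply, zeta_real_apply, if_neg h0.ne']
            rcases Nat.eq_zero_or_pos l with rfl | hl
            · simp
            · rw [if_neg hl.ne']
              by_cases hml : m * l ≤ x
              · rw [if_pos ⟨Nat.mul_pos h0 hl, hml⟩, if_pos]
                · simp
                · rw [mem_Ioc]
                  exact ⟨hl, (Nat.le_div_iff_mul_le h0).2 (by rwa [mul_comm])⟩
              · rw [if_neg (fun hh => hml hh.2)]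
                split_ifs <;> simp
          refine (Finset.sum_le_sum this).trans ?_
          rw [← Finset.sum_filter, Finset.sum_const, nsmul_eq_mul, mul_one]
          refine le_trans ?_ ((Nat.cast_div_le (α := ℝ) (m := x) (n := m)).trans (by
            rw [mul_one_div]))
          have : ((range (x + 1)).filter (· ∈ Finset.Ioc 0 (x / m))).card ≤ x / m := by
            refine (Finset.card_le_card (t := Finset.Ioc 0 (x / m)) ?_).trans (by simp)
            intro y hy
            exact (mem_filter.1 hy).2
          exact_mod_cast this
    _ ≤ _ := by
        rw [← Finset.mul_sum]
        exact mul_le_mul_of_nonneg_left (sum_range_inv_le x) (by positivity)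

lemma sum_divisorCount_div_le (x : ℕ) :
    ∑ n ∈ range (x + 1), divisorCount n * (1 / n) ≤ (1 + Real.log x) ^ 2 := by
  have h := sum_mul_smul_eq (V := ℝ) ArithmeticFunction.zeta ArithmeticFunction.zeta
    (fun n => if n ≤ x then (1 : ℝ) / n else 0) (x + 1) (by simp)
    (fun n hn => if_neg (by omega))
  have e : ∑ n ∈ range (x + 1), divisorCount n * (1 / n) = ∑ n ∈ range (x + 1),
      ((ArithmeticFunction.zeta : ArithmeticFunction ℝ) * ArithmeticFunction.zeta) n •
        (if n ≤ x then (1 : ℝ) / n else 0) := by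
    refine Finset.sum_congr rfl fun n hn => ?_
    rw [if_pos (by simpa [Nat.lt_succ_iff] using hn)]
    simp [divisorCount]
  rw [e, h, sq]
  calc _ ≤ ∑ m ∈ range (x + 1), ∑ l ∈ range (x + 1), (1 : ℝ) / m * (1 / l) := by
        refine Finset.sum_le_sum fun m _ => Finset.sum_le_sum fun l _ => ?_
        rw [smul_eq_mul, zeta_real_apply, zeta_real_apply]
        split_ifs <;> simp <;> first | positivity | rw [mul_comm]
    _ = (∑ m ∈ range (x + 1), (1 : ℝ) / m) * ∑ m ∈ range (x + 1), (1 : ℝ) / m := by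
        rw [Finset.sum_mul_sum]
    _ ≤ _ := by
        have := sum_range_inv_le x
        gcongr

lemma sum_divisorCount_sq_le (x : ℕ) (hx : 1 ≤ x) :
    ∑ n ∈ range (x + 1), divisorCount n ^ 2 ≤ x * (1 + Real.log x) ^ 3 := by
  have hx1 : (1 : ℝ) ≤ x := by exact_mod_cast hx
  have hlog := Real.log_nonneg hx1
  have h := sum_mul_smul_eq (V := ℝ) ArithmeticFunction.zeta ArithmeticFunction.zeta
    (fun n => if n ≤ x then divisorCount n else 0) (x + 1) (by simp)
    (fun n hn => if_neg (by omega))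
  have e : ∑ n ∈ range (x + 1), divisorCount n ^ 2 = ∑ n ∈ range (x + 1),
      ((ArithmeticFunction.zeta : ArithmeticFunction ℝ) * ArithmeticFunction.zeta) n •
        (if n ≤ x then divisorCount n else 0) := by
    refine Finset.sum_congr rfl fun n hn => ?_
    rw [if_pos (by simpa [Nat.lt_succ_iff] using hn), smul_eq_mul, sq]
    rfl
  rw [e, h]
  calc _ ≤ ∑ m ∈ range (x + 1), x * (1 + Real.log x) * (divisorCount m * (1 / m)) := by
        refine Finset.sum_le_sum fun m hm => ?_
        rcases Nat.eq_zero_or_pos m with rfl | h0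
        · simp
        · have hm0 : (0 : ℝ) < m := by exact_mod_cast h0
          have hmx : m ≤ x := by simpa [Nat.lt_succ_iff] using hm
          have : ∀ l ∈ range (x + 1), ((ArithmeticFunction.zeta : ArithmeticFunction ℝ) m *
              (ArithmeticFunction.zeta : ArithmeticFunction ℝ) l) •
              (if m * l ≤ x then divisorCount (m * l) else 0) ≤
              if l ∈ range (x / m + 1) then divisorCount m * divisorCount l else 0 := by
            intro l _
            have hD := mul_nonneg (divisorCount_nonneg m) (divisorCount_nonneg l)
            rw [zeta_real_apply, zeta_real_apply, if_neg h0.ne']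
            rcases Nat.eq_zero_or_pos l with rfl | hl
            · simp
            · rw [if_neg hl.ne']
              by_cases hml : m * l ≤ x
              · rw [if_pos hml, if_pos]
                · simpa using divisorCount_mul_le m l
                · rw [mem_range, Nat.lt_succ_iff]
                  exact (Nat.le_div_iff_mul_le h0).2 (by rwa [mul_comm])
              · rw [if_neg hml]
                split_ifs <;> simp [hD]
          refine (Finset.sum_le_sum this).trans ?_
          rw [← Finset.sum_filter]
          have hsub : ((range (x + 1)).filter (· ∈ range (x / m + 1))) = range (x / m + 1) := by
            ext y
            have := Nat.div_le_self x m
            simp only [mem_filter, mem_range]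
            omega
          rw [hsub, ← Finset.mul_sum]
          have h1 := sum_divisorCount_le (x / m)
          have hxm : 1 ≤ x / m := (Nat.one_le_div_iff h0).2 hmx
          have hxm1 : (1 : ℝ) ≤ (x / m : ℕ) := by exact_mod_cast hxm
          have h2 : ((x / m : ℕ) : ℝ) ≤ x * (1 / m) := by
            rw [mul_one_div]; exact Nat.cast_div_le
          have h3 : Real.log (x / m : ℕ) ≤ Real.log x :=
            Real.log_le_log (by linarith) (by exact_mod_cast Nat.div_le_self x m)
          have h4 := Real.log_nonneg hxm1
          have h5 : ∑ l ∈ range (x / m + 1), divisorCount l ≤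
              x * (1 / m) * (1 + Real.log x) := h1.trans (by gcongr)
          calc _ ≤ divisorCount m * (x * (1 / m) * (1 + Real.log x)) :=
                mul_le_mul_of_nonneg_left h5 (divisorCount_nonneg m)
            _ = _ := by ring
    _ ≤ x * (1 + Real.log x) * (1 + Real.log x) ^ 2 := by
        rw [← Finset.mul_sum]
        exact mul_le_mul_of_nonneg_left (sum_divisorCount_div_le x) (by positivity)
    _ = _ := by ring

/-- The restriction of an arithmetic function to `[1, U]`. -/
noncomputable def lowPart (f : ArithmeticFunction ℝ) (U : ℕ) : ArithmeticFunction ℝ :=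
  ⟨fun n => if n ≤ U then f n else 0, by simp⟩

lemma lowPart_apply (f : ArithmeticFunction ℝ) (U n : ℕ) :
    lowPart f U n = if n ≤ U then f n else 0 := rfl

/-- The restriction of an arithmetic function to `(U, ∞)`. -/
noncomputable def highPart (f : ArithmeticFunction ℝ) (U : ℕ) : ArithmeticFunction ℝ :=
  ⟨fun n => if n ≤ U then 0 else f n, by simp⟩

lemma highPart_apply (f : ArithmeticFunction ℝ) (U n : ℕ) :
    highPart f U n = if n ≤ U then 0 else f n := rfl

lemma lowPart_add_highPart (f : ArithmeticFunction ℝ) (U : ℕ) :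
    lowPart f U + highPart f U = f := by
  ext n
  rw [ArithmeticFunction.add_apply, lowPart_apply, highPart_apply]
  split_ifs <;> simp

/-- The Möbius function, real-valued. -/
noncomputable def realMoebius : ArithmeticFunction ℝ :=
  (ArithmeticFunction.moebius : ArithmeticFunction ℝ)

lemma abs_realMoebius_le (n : ℕ) : |realMoebius n| ≤ 1 := by
  have := ArithmeticFunction.abs_moebius_le_one (n := n)
  simp only [realMoebius, ArithmeticFunction.intCoe_apply]
  exact_mod_cast this

/-- Vaughan's identity. -/
lemma vaughan_identity (U : ℕ) :
    ArithmeticFunction.vonMangoldt +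
        lowPart realMoebius U * lowPart ArithmeticFunction.vonMangoldt U * ArithmeticFunction.zeta =
      lowPart ArithmeticFunction.vonMangoldt U + lowPart realMoebius U * ArithmeticFunction.log +
      highPart realMoebius U * ArithmeticFunction.zeta *
        highPart ArithmeticFunction.vonMangoldt U := by
  have h1 : realMoebius * ArithmeticFunction.zeta = 1 :=
    ArithmeticFunction.coe_moebius_mul_coe_zeta
  have h2 : ArithmeticFunction.vonMangoldt * ArithmeticFunction.zeta = ArithmeticFunction.log :=
    ArithmeticFunction.vonMangoldt_mul_zeta
  have h3 := lowPart_add_highPart realMoebius U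
  have h4 := lowPart_add_highPart ArithmeticFunction.vonMangoldt U
  rw [← h2]
  linear_combination (-highPart ArithmeticFunction.vonMangoldt U) * h1 -
    ((ArithmeticFunction.zeta : ArithmeticFunction ℝ) *
      highPart ArithmeticFunction.vonMangoldt U) * h3 +
    (lowPart realMoebius U * ArithmeticFunction.zeta - 1) * h4

lemma abs_low_mul_low_le (U n : ℕ) :
    |(lowPart realMoebius U * lowPart ArithmeticFunction.vonMangoldt U) n| ≤ Real.log n := by
  rw [← ArithmeticFunction.log_apply, ← ArithmeticFunction.zeta_mul_vonMangoldt,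
    ArithmeticFunction.mul_apply, ArithmeticFunction.mul_apply]
  refine (Finset.abs_sum_le_sum_abs _ _).trans (Finset.sum_le_sum fun x hx => ?_)
  obtain ⟨h1, h2⟩ := Nat.mem_divisorsAntidiagonal.1 hx
  have hx1 : x.1 ≠ 0 := fun h => h2 (by rw [← h1, h, zero_mul])
  rw [zeta_real_apply, if_neg hx1, one_mul, abs_mul, lowPart_apply, lowPart_apply]
  have hΛ := ArithmeticFunction.vonMangoldt_nonneg (n := x.2)
  have hμ := abs_realMoebius_le x.1
  split_ifs
  · rw [abs_of_nonneg hΛ]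
    nlinarith
  all_goals simp [hΛ]

lemma low_mul_low_eq_zero (U n : ℕ) (hn : U ^ 2 < n) :
    (lowPart realMoebius U * lowPart ArithmeticFunction.vonMangoldt U) n = 0 := by
  rw [ArithmeticFunction.mul_apply]
  refine Finset.sum_eq_zero fun x hx => ?_
  rw [lowPart_apply, lowPart_apply]
  split_ifs with h1 h2
  · have := (Nat.mem_divisorsAntidiagonal.1 hx).1
    have := Nat.mul_le_mul h1 h2
    nlinarith
  all_goals simp

lemma abs_high_mul_zeta_le (U n : ℕ) :
    |(highPart realMoebius U * ArithmeticFunction.zeta) n| ≤ divisorCount n := by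
  rw [ArithmeticFunction.coe_mul_zeta_apply, divisorCount_apply, Finset.card_eq_sum_ones]
  push_cast
  refine (Finset.abs_sum_le_sum_abs _ _).trans (Finset.sum_le_sum fun i _ => ?_)
  rw [highPart_apply]
  split_ifs
  · simp
  · exact abs_realMoebius_le i

lemma high_mul_zeta_eq_zero (U n : ℕ) (hn : n ≤ U) :
    (highPart realMoebius U * ArithmeticFunction.zeta) n = 0 := by
  rw [ArithmeticFunction.coe_mul_zeta_apply]
  refine Finset.sum_eq_zero fun i hi => ?_
  rw [highPart_apply, if_pos ((Nat.divisor_le hi).trans hn)]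

lemma norm_sum_monotone_mul_le (b : ℕ → ℝ) (hb : Monotone b) (hb0 : 0 ≤ b 0) (z : ℕ → ℂ) (n : ℕ)
    (T : ℝ) (hT : ∀ i ≤ n, ‖∑ k ∈ range i, z k‖ ≤ T) :
    ‖∑ k ∈ range n, (b k : ℂ) * z k‖ ≤ 2 * b n * T := by
  have hT0 : 0 ≤ T := by simpa using hT 0 (Nat.zero_le _)
  have key : ∀ m, ∑ k ∈ range m, (b k : ℂ) * z k = b m * (∑ k ∈ range m, z k) -
      ∑ k ∈ range m, ((b (k + 1) - b k : ℝ) : ℂ) * ∑ i ∈ range (k + 1), z i := by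
    intro m
    induction m with
    | zero => simp
    | succ m ih =>
      rw [Finset.sum_range_succ, ih, Finset.sum_range_succ (fun k => ((b (k + 1) - b k : ℝ) : ℂ) *
        ∑ i ∈ range (k + 1), z i), Finset.sum_range_succ z]
      push_cast
      ring
  have hbn : 0 ≤ b n := hb0.trans (hb (Nat.zero_le n))
  rw [key]
  refine (norm_sub_le _ _).trans ?_
  have h1 : ‖(b n : ℂ) * ∑ k ∈ range n, z k‖ ≤ b n * T := by
    rw [norm_mul, Complex.norm_real, Real.norm_of_nonneg hbn]
    exact mul_le_mul_of_nonneg_left (hT n le_rfl) hbn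
  have h2 : ‖∑ k ∈ range n, ((b (k + 1) - b k : ℝ) : ℂ) * ∑ i ∈ range (k + 1), z i‖ ≤
      ∑ k ∈ range n, (b (k + 1) - b k) * T := by
    refine (norm_sum_le _ _).trans (Finset.sum_le_sum fun k hk => ?_)
    have hd : 0 ≤ b (k + 1) - b k := sub_nonneg.2 (hb (Nat.le_succ k))
    rw [norm_mul, Complex.norm_real, Real.norm_of_nonneg hd]
    exact mul_le_mul_of_nonneg_left (hT _ (by simpa using hk)) hd
  rw [← Finset.sum_mul, Finset.sum_range_sub] at h2
  nlinarith

/-- The constant in `linear_sum_le`. -/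
noncomputable def linConst (γ : ℝ) : ℝ :=
  32000000 * (4 + Real.log (expConst γ)) * (2 + 2 * expConst γ)

lemma linConst_nonneg {γ : ℝ} (h0 : 13 / 14 ≤ γ) (h1 : γ < 1) : 0 ≤ linConst γ := by
  have hE := expConst_ge h0 h1
  have := Real.log_nonneg (by linarith : 1 ≤ expConst γ)
  unfold linConst
  positivity

lemma inner_sum_le {γ j c : ℝ} {N Q : ℕ} (h : Admissible γ j c N Q) (θ : ℝ) (m N' K : ℕ)
    (b : ℕ → ℝ) (hb : Monotone b) (hb0 : 0 ≤ b 0)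
    (hm : 1 ≤ m) (hmN : m ^ 7 ≤ N ^ 2) (hN' : N' ≤ 2 * N) :
    ‖∑ l ∈ range K, (b l : ℂ) * windowed γ θ j c N N' (m * l)‖ ≤
      2 * b (2 * N + 1) * (linConst γ * ((1 + Real.log N) * (N / (m * Q)))) := by
  have hN1 : (1 : ℝ) ≤ N := by exact_mod_cast h.N_pos
  have hlin := linConst_nonneg h.γ_ge h.γ_lt
  have hlog := Real.log_nonneg hN1
  have hT0 : 0 ≤ linConst γ * ((1 + Real.log N) * (N / (m * Q))) := by positivity
  have hb1 : 0 ≤ b (2 * N + 1) := hb0.trans (hb (Nat.zero_le _))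
  obtain ⟨s, n, -, -, hP, hsum⟩ := sum_convex_eq_sum_range
    (fun l => N < m * l ∧ m * l ≤ N') 0 K (by
      rintro x y z hxy hyz ⟨a1, -⟩ ⟨-, a2⟩
      exact ⟨a1.trans_le (Nat.mul_le_mul_left _ hxy), (Nat.mul_le_mul_left _ hyz).trans a2⟩)
  have e : ∑ l ∈ range K, (b l : ℂ) * windowed γ θ j c N N' (m * l) =
      ∑ k ∈ range n, (b (s + k) : ℂ) * e2pi (intPhase γ θ j c (m * (s + k))) := by
    rw [← hsum (fun l => (b l : ℂ) * e2pi (intPhase γ θ j c (m * l)))]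
    refine Finset.sum_congr rfl fun l _ => ?_
    rw [zero_add, windowed]
    split_ifs <;> simp
  rw [e]
  rcases Nat.eq_zero_or_pos n with rfl | hn
  · simp only [range_zero, sum_empty, norm_zero]
    positivity
  · have h1 := norm_sum_monotone_mul_le (fun k => b (s + k))
      (fun x y hxy => hb (Nat.add_le_add_left hxy s)) (hb0.trans (hb (Nat.zero_le _)))
      (fun k => e2pi (intPhase γ θ j c (m * (s + k)))) n
      (linConst γ * ((1 + Real.log N) * (N / (m * Q)))) (fun i hi =>
        linear_sum_le h θ m s i hm hmN (hP 0 hn).1 fun k hk => (hP k (hk.trans_le hi)).2.trans hN')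
    refine h1.trans ?_
    have hsn : s + n ≤ 2 * N + 1 := by
      have h2 := (hP (n - 1) (by omega)).2.trans hN'
      have h3 := Nat.le_mul_of_pos_left (s + (n - 1)) hm
      omega
    have := hb hsn
    gcongr

lemma typeI_le {γ j c : ℝ} {N Q : ℕ} (h : Admissible γ j c N Q) (θ : ℝ) (N' K : ℕ)
    (f : ArithmeticFunction ℝ) (A : ℝ) (hf : ∀ m, |f m| ≤ A) (hf0 : ∀ m, f m ≠ 0 → m ^ 7 ≤ N ^ 2)
    (b : ℕ → ℝ) (hb : Monotone b) (hb0 : 0 ≤ b 0) (hN' : N' ≤ 2 * N) :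
    ‖∑ m ∈ range K, ∑ l ∈ range K, (f m * b l) • windowed γ θ j c N N' (m * l)‖ ≤
      2 * A * b (2 * N + 1) * linConst γ * ((1 + Real.log N) ^ 2 * (N / Q)) := by
  have hN1 : (1 : ℝ) ≤ N := by exact_mod_cast h.N_pos
  have hlin := linConst_nonneg h.γ_ge h.γ_lt
  have hlog := Real.log_nonneg hN1
  have hA : 0 ≤ A := (abs_nonneg _).trans (hf 0)
  have hb1 : 0 ≤ b (2 * N + 1) := hb0.trans (hb (Nat.zero_le _))
  set B := 2 * A * b (2 * N + 1) * linConst γ * ((1 + Real.log N) * (N / Q)) with hB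
  have hB0 : 0 ≤ B := by positivity
  have key : ∀ m ∈ range K, ‖∑ l ∈ range K, (f m * b l) • windowed γ θ j c N N' (m * l)‖ ≤
      B * (if m ∈ range (N + 1) then (1 : ℝ) / m else 0) := by
    intro m _
    by_cases hfm : f m = 0
    · simp only [hfm, zero_mul, zero_smul, sum_const_zero, norm_zero]
      split_ifs <;> positivity
    · have hm : 1 ≤ m := by
        rcases Nat.eq_zero_or_pos m with rfl | hm
        · simp at hfm
        · exact hm
      have hm7 := hf0 m hfm
      have hmN : m ≤ N := by
        by_contra! hlt
        have h1 : N ^ 2 < m ^ 2 := Nat.pow_lt_pow_left hlt (by norm_num)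
        have h2 : m ^ 2 ≤ m ^ 7 := Nat.pow_le_pow_right hm (by norm_num)
        omega
      rw [if_pos (by simpa [Nat.lt_succ_iff] using hmN)]
      have e : ∑ l ∈ range K, (f m * b l) • windowed γ θ j c N N' (m * l) =
          (f m : ℂ) * ∑ l ∈ range K, (b l : ℂ) * windowed γ θ j c N N' (m * l) := by
        rw [Finset.mul_sum]
        refine Finset.sum_congr rfl fun l _ => ?_
        rw [Complex.real_smul]
        push_cast
        ring
      rw [e, norm_mul, Complex.norm_real, Real.norm_eq_abs]
      calc _ ≤ A * (2 * b (2 * N + 1) * (linConst γ * ((1 + Real.log N) * (N / (m * Q))))) :=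
            mul_le_mul (hf m) (inner_sum_le h θ m N' K b hb hb0 hm hm7 hN') (norm_nonneg _) hA
        _ = _ := by
            rw [hB, div_mul_eq_div_div_swap, div_eq_mul_one_div (_ / (Q : ℝ)) (m : ℝ)]
            ring
  refine (norm_sum_le _ _).trans ((Finset.sum_le_sum key).trans ?_)
  rw [← Finset.mul_sum, ← Finset.sum_filter]
  have h1 : ∑ m ∈ (range K).filter (· ∈ range (N + 1)), (1 : ℝ) / m ≤ 1 + Real.log N := by
    refine le_trans ?_ (sum_range_inv_le N)
    refine Finset.sum_le_sum_of_subset_of_nonneg (fun x hx => (mem_filter.1 hx).2)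
      fun _ _ _ => by positivity
  calc _ ≤ B * (1 + Real.log N) := mul_le_mul_of_nonneg_left h1 hB0
    _ = _ := by rw [hB]; ring

lemma sum_range_two_pow {V : Type*} [AddCommMonoid V] (F : ℕ → V) (I : ℕ) :
    ∑ m ∈ range (2 ^ I), F m =
      F 0 + ∑ i ∈ range I, ∑ m ∈ range (2 ^ i), F (2 ^ i + m) := by
  induction I with
  | zero => simp
  | succ I ih => rw [pow_succ, mul_two, Finset.sum_range_add, ih, Finset.sum_range_succ, add_assoc]

lemma sum_high_mul_zeta_sq_le (U M : ℕ) (hM : 1 ≤ M) :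
    ∑ m ∈ range M, ‖(((highPart realMoebius U * ArithmeticFunction.zeta) (M + m) : ℝ) : ℂ)‖ ^ 2 ≤
      2 * M * (1 + Real.log (2 * M)) ^ 3 := by
  have h1 := sum_divisorCount_sq_le (2 * M) (by omega)
  push_cast at h1
  refine le_trans ?_ h1
  rw [show 2 * M + 1 = M + (M + 1) by ring, Finset.sum_range_add, Finset.sum_range_succ _ M]
  have h2 : ∑ m ∈ range M,
      ‖(((highPart realMoebius U * ArithmeticFunction.zeta) (M + m) : ℝ) : ℂ)‖ ^ 2 ≤
      ∑ m ∈ range M, divisorCount (M + m) ^ 2 := by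
    refine Finset.sum_le_sum fun m _ => ?_
    rw [Complex.norm_real, Real.norm_eq_abs]
    exact pow_le_pow_left₀ (abs_nonneg _) (abs_high_mul_zeta_le U _) 2
  have h3 : 0 ≤ ∑ m ∈ range M, divisorCount m ^ 2 := Finset.sum_nonneg fun _ _ => sq_nonneg _
  have h4 := sq_nonneg (divisorCount (M + M))
  linarith

lemma sum_high_vonMangoldt_sq_le (U L : ℕ) (hL : 1 ≤ L) :
    ∑ l ∈ range L, ‖((highPart ArithmeticFunction.vonMangoldt U (L + l) : ℝ) : ℂ)‖ ^ 2 ≤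
      L * Real.log (2 * L) ^ 2 := by
  have h1 : ∀ l ∈ range L, ‖((highPart ArithmeticFunction.vonMangoldt U (L + l) : ℝ) : ℂ)‖ ^ 2 ≤
      Real.log (2 * L) ^ 2 := by
    intro l hl
    have hlL : l < L := by simpa using hl
    refine pow_le_pow_left₀ (norm_nonneg _) ?_ 2
    have h2 : Real.log ((L + l : ℕ) : ℝ) ≤ Real.log (2 * L) := by
      refine Real.log_le_log (by exact_mod_cast (by omega : 0 < L + l)) ?_
      exact_mod_cast (by omega : L + l ≤ 2 * L)
    have h3 := ArithmeticFunction.vonMangoldt_le_log (n := L + l)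
    have h4 := ArithmeticFunction.vonMangoldt_nonneg (n := L + l)
    rw [Complex.norm_real, Real.norm_eq_abs, highPart_apply]
    split_ifs
    · rw [abs_zero]; linarith
    · rw [abs_of_nonneg h4]; linarith
  refine (Finset.sum_le_sum h1).trans ?_
  simp

lemma typeII_block_le {γ j c : ℝ} {N Q : ℕ} (h : Admissible γ j c N Q) (θ : ℝ) (N' M L : ℕ)
    (hN' : N' ≤ 2 * N) (hM : 1 ≤ M) (hL : 1 ≤ L) :
    ‖∑ m ∈ range M, ∑ l ∈ range L,
      ((highPart realMoebius Q * ArithmeticFunction.zeta) (M + m) *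
        highPart ArithmeticFunction.vonMangoldt Q (L + l)) •
        windowed γ θ j c N N' ((M + m) * (L + l))‖ ≤
      √(864 * blockConst γ) * ((1 + Real.log N) ^ 3 * (N / √(Q : ℝ))) := by
  have hN1 : (1 : ℝ) ≤ N := by exact_mod_cast h.N_pos
  have hQ1 : (1 : ℝ) ≤ Q := by exact_mod_cast h.Q_pos
  have hlog := Real.log_nonneg hN1
  have hE := expConst_ge h.γ_ge h.γ_lt
  have hbc : 0 ≤ blockConst γ := by
    have := Real.log_nonneg (by linarith : 1 ≤ 8 * expConst γ)
    unfold blockConst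
    positivity
  by_cases hcond : Q ≤ 2 * M ∧ Q ≤ 2 * L ∧ N < 4 * (M * L) ∧ M * L ≤ 2 * N
  swap
  · rw [Finset.sum_eq_zero]
    · rw [norm_zero]; positivity
    intro m hm
    refine Finset.sum_eq_zero fun l hl => ?_
    rw [mem_range] at hm hl
    by_contra hne
    refine hcond ?_
    have h1 : ¬ (M + m ≤ Q) := fun hh => hne (by rw [high_mul_zeta_eq_zero _ _ hh]; simp)
    have h2 : ¬ (L + l ≤ Q) := fun hh => hne (by rw [highPart_apply, if_pos hh]; simp)
    have h3 : N < (M + m) * (L + l) ∧ (M + m) * (L + l) ≤ N' := by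
      by_contra hh
      exact hne (by rw [windowed, if_neg hh, smul_zero])
    refine ⟨by omega, by omega, ?_, ?_⟩
    · have : (M + m) * (L + l) ≤ (2 * M) * (2 * L) := Nat.mul_le_mul (by omega) (by omega)
      nlinarith
    · have : M * L ≤ (M + m) * (L + l) := Nat.mul_le_mul (by omega) (by omega)
      omega
  obtain ⟨hQM, hQL, hN4, hN2⟩ := hcond
  set a : ℕ → ℂ := fun m => ((highPart realMoebius Q * ArithmeticFunction.zeta) (M + m) : ℝ)
  set b : ℕ → ℂ := fun l => (highPart ArithmeticFunction.vonMangoldt Q (L + l) : ℝ)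
  have hA := sum_high_mul_zeta_sq_le Q M hM
  have hB := sum_high_vonMangoldt_sq_le Q L hL
  have hM1 : (1 : ℝ) ≤ M := by exact_mod_cast hM
  have hL1 : (1 : ℝ) ≤ L := by exact_mod_cast hL
  have hMLN : (M : ℝ) * L ≤ 2 * N := by exact_mod_cast hN2
  have hlog4 : Real.log (4 * N) ≤ 2 + Real.log N := by
    rw [Real.log_mul (by norm_num) (by linarith), show (4 : ℝ) = 2 ^ 2 by norm_num, Real.log_pow]
    have := Real.log_two_lt_d9
    push_cast
    linarith
  have hlM : Real.log (2 * M) ≤ 2 + Real.log N :=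
    (Real.log_le_log (by linarith) (by nlinarith)).trans hlog4
  have hlL : Real.log (2 * L) ≤ 2 + Real.log N :=
    (Real.log_le_log (by linarith) (by nlinarith)).trans hlog4
  have hlM0 : 0 ≤ Real.log (2 * M) := Real.log_nonneg (by linarith)
  have hlL0 : 0 ≤ Real.log (2 * L) := Real.log_nonneg (by linarith)
  have e : ∑ m ∈ range M, ∑ l ∈ range L,
      ((highPart realMoebius Q * ArithmeticFunction.zeta) (M + m) *
        highPart ArithmeticFunction.vonMangoldt Q (L + l)) •
        windowed γ θ j c N N' ((M + m) * (L + l)) =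
      ∑ m ∈ range M, ∑ l ∈ range L, a m * b l * windowed γ θ j c N N' ((M + m) * (L + l)) := by
    simp only [a, b, Complex.real_smul, Complex.ofReal_mul]
  have hmain : ‖∑ m ∈ range M, ∑ l ∈ range L,
      a m * b l * windowed γ θ j c N N' ((M + m) * (L + l))‖ ^ 2 ≤
      blockConst γ * (1 + Real.log N) * ((∑ m ∈ range M, ‖a m‖ ^ 2) *
        (∑ l ∈ range L, ‖b l‖ ^ 2)) * (M * L / Q) := by
    rcases le_total M L with hML | hML
    · exact block_sum_le h θ M L N' a b hM hML hQM hN4 hN2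
    · have := block_sum_le h θ L M N' b a hL hML hQL (by rwa [mul_comm L M])
        (by rwa [mul_comm L M])
      rw [Finset.sum_comm, mul_comm (M : ℝ) (L : ℝ), mul_comm (∑ m ∈ range M, ‖a m‖ ^ 2)]
      simp_rw [mul_comm (M + _) (L + _), mul_comm (a _) (b _)]
      exact this
  rw [e]
  refine (sq_le_sq₀ (norm_nonneg _) (by positivity)).1 (hmain.trans ?_)
  have hA' : ∑ m ∈ range M, ‖a m‖ ^ 2 ≤ 2 * M * (3 * (1 + Real.log N)) ^ 3 :=
    hA.trans (by gcongr; linarith)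
  have hB' : ∑ l ∈ range L, ‖b l‖ ^ 2 ≤ L * (2 * (1 + Real.log N)) ^ 2 :=
    hB.trans (by gcongr; linarith)
  have hB0 : 0 ≤ ∑ l ∈ range L, ‖b l‖ ^ 2 := Finset.sum_nonneg fun _ _ => sq_nonneg _
  have hML2 : ((M : ℝ) * L) ^ 2 ≤ (2 * N) ^ 2 := pow_le_pow_left₀ (by positivity) hMLN 2
  calc _ ≤ blockConst γ * (1 + Real.log N) * ((2 * M * (3 * (1 + Real.log N)) ^ 3) *
        (L * (2 * (1 + Real.log N)) ^ 2)) * (M * L / Q) := by gcongr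
    _ = 216 * blockConst γ * (1 + Real.log N) ^ 6 / Q * ((M : ℝ) * L) ^ 2 := by ring
    _ ≤ 216 * blockConst γ * (1 + Real.log N) ^ 6 / Q * (2 * N) ^ 2 := by gcongr
    _ = (√(864 * blockConst γ)) ^ 2 * ((1 + Real.log N) ^ 6 * (N ^ 2 / (√(Q : ℝ)) ^ 2)) := by
        rw [Real.sq_sqrt (by positivity), Real.sq_sqrt (by positivity)]
        ring
    _ = _ := by ring

lemma log_two_pow_le (N N' : ℕ) (hN : 1 ≤ N) (hN' : N' ≤ 2 * N) :
    ((Nat.log 2 N' + 1 : ℕ) : ℝ) ≤ 3 * (1 + Real.log N) := by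
  have hN1 : (1 : ℝ) ≤ N := by exact_mod_cast hN
  have hlog := Real.log_nonneg hN1
  have h2 := Real.log_two_gt_d9
  have h2' := Real.log_two_lt_d9
  rcases Nat.eq_zero_or_pos N' with rfl | h0
  · simp; linarith
  · have h1 : 2 ^ Nat.log 2 N' ≤ 2 * N := (Nat.pow_log_le_self 2 h0.ne').trans hN'
    have h3 : (2 : ℝ) ^ Nat.log 2 N' ≤ 2 * N := by exact_mod_cast h1
    have h4 := Real.log_le_log (by positivity) h3
    rw [Real.log_pow, Real.log_mul (by norm_num) (by linarith)] at h4
    push_cast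
    have h5 : (0 : ℝ) ≤ Nat.log 2 N' := Nat.cast_nonneg _
    nlinarith

lemma typeII_le {γ j c : ℝ} {N Q : ℕ} (h : Admissible γ j c N Q) (θ : ℝ) (N' : ℕ)
    (hN' : N' ≤ 2 * N) :
    ‖∑ m ∈ range (2 ^ (Nat.log 2 N' + 1)), ∑ l ∈ range (2 ^ (Nat.log 2 N' + 1)),
      ((highPart realMoebius Q * ArithmeticFunction.zeta) m *
        highPart ArithmeticFunction.vonMangoldt Q l) • windowed γ θ j c N N' (m * l)‖ ≤
      9 * √(864 * blockConst γ) * ((1 + Real.log N) ^ 5 * (N / √(Q : ℝ))) := by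
  have hI := log_two_pow_le N N' h.N_pos hN'
  have hN1 : (1 : ℝ) ≤ N := by exact_mod_cast h.N_pos
  have hlog := Real.log_nonneg hN1
  set I := Nat.log 2 N' + 1
  set T := √(864 * blockConst γ) * ((1 + Real.log N) ^ 3 * (N / √(Q : ℝ))) with hT
  have hT0 : 0 ≤ T := by positivity
  rw [sum_range_two_pow]
  simp_rw [sum_range_two_pow (fun l => (_ * highPart ArithmeticFunction.vonMangoldt Q l) • _)]
  simp only [ArithmeticFunction.map_zero, zero_mul, mul_zero, zero_smul, sum_const_zero, zero_add]
  have h1 : ∀ i ∈ range I, ‖∑ m ∈ range (2 ^ i), ∑ k ∈ range I, ∑ l ∈ range (2 ^ k),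
      ((highPart realMoebius Q * ArithmeticFunction.zeta) (2 ^ i + m) *
        highPart ArithmeticFunction.vonMangoldt Q (2 ^ k + l)) •
        windowed γ θ j c N N' ((2 ^ i + m) * (2 ^ k + l))‖ ≤ I * T := by
    intro i _
    rw [Finset.sum_comm]
    refine (norm_sum_le _ _).trans ?_
    refine (Finset.sum_le_sum fun k _ => typeII_block_le h θ N' (2 ^ i) (2 ^ k) hN'
      Nat.one_le_two_pow Nat.one_le_two_pow).trans ?_
    rw [Finset.sum_const, card_range, nsmul_eq_mul]
  refine (norm_sum_le _ _).trans ((Finset.sum_le_sum h1).trans ?_)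
  rw [Finset.sum_const, card_range, nsmul_eq_mul]
  calc (I : ℝ) * (I * T) = (I : ℝ) ^ 2 * T := by ring
    _ ≤ (3 * (1 + Real.log N)) ^ 2 * T := by gcongr
    _ = _ := by rw [hT]; ring

/-- The constant in `vonMangoldt_sum_le`. -/
noncomputable def mangoldtConst (γ : ℝ) : ℝ := 8 * linConst γ + 9 * √(864 * blockConst γ)

lemma mangoldtConst_nonneg {γ : ℝ} (h0 : 13 / 14 ≤ γ) (h1 : γ < 1) : 0 ≤ mangoldtConst γ := by
  have := linConst_nonneg h0 h1
  unfold mangoldtConst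
  positivity

lemma vonMangoldt_sum_le {γ j c : ℝ} {N Q : ℕ} (h : Admissible γ j c N Q) (θ : ℝ) (N' : ℕ)
    (hN' : N' ≤ 2 * N) :
    ‖∑ n ∈ Ioc N N', (ArithmeticFunction.vonMangoldt n : ℂ) * e2pi (intPhase γ θ j c n)‖ ≤
      mangoldtConst γ * ((1 + Real.log N) ^ 5 * (N / √(Q : ℝ))) := by
  have hN1 : (1 : ℝ) ≤ N := by exact_mod_cast h.N_pos
  have hQ1 : (1 : ℝ) ≤ Q := by exact_mod_cast h.Q_pos
  have hlog := Real.log_nonneg hN1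
  have hlin := linConst_nonneg h.γ_ge h.γ_lt
  have hQN : Q ^ 7 ≤ N := h.Q_pow
  have hQN1 : Q ≤ N := (Nat.le_self_pow (by norm_num) Q).trans hQN
  set K := 2 ^ (Nat.log 2 N' + 1) with hK
  have hKN : N' < K := Nat.lt_pow_succ_log_self (by norm_num) N'
  set w : ℕ → ℂ := windowed γ θ j c N N' with hw
  have hw0 : w 0 = 0 := by simp [hw, windowed]
  have hwK : ∀ n, K ≤ n → w n = 0 := fun n hn => by
    rw [hw, windowed, if_neg (by omega)]
  have e1 : ∑ n ∈ Ioc N N', (ArithmeticFunction.vonMangoldt n : ℂ) * e2pi (intPhase γ θ j c n) =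
      ∑ n ∈ range K, ArithmeticFunction.vonMangoldt n • w n := by
    have : Ioc N N' = (range K).filter (fun n => N < n ∧ n ≤ N') := by
      ext n
      simp only [mem_Ioc, mem_filter, mem_range]
      omega
    rw [this, Finset.sum_filter]
    refine Finset.sum_congr rfl fun n _ => ?_
    rw [hw, windowed, Complex.real_smul]
    split_ifs <;> simp
  have e2 : ∑ n ∈ range K, ArithmeticFunction.vonMangoldt n • w n =
      (∑ m ∈ range K, ∑ l ∈ range K,
        (lowPart realMoebius Q m * ArithmeticFunction.log l) • w (m * l)) -
      (∑ m ∈ range K, ∑ l ∈ range K,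
        ((lowPart realMoebius Q * lowPart ArithmeticFunction.vonMangoldt Q) m *
          (ArithmeticFunction.zeta : ArithmeticFunction ℝ) l) • w (m * l)) +
      ∑ m ∈ range K, ∑ l ∈ range K, ((highPart realMoebius Q * ArithmeticFunction.zeta) m *
        highPart ArithmeticFunction.vonMangoldt Q l) • w (m * l) := by
    rw [← sum_mul_smul_eq _ _ w K hw0 hwK, ← sum_mul_smul_eq _ _ w K hw0 hwK,
      ← sum_mul_smul_eq _ _ w K hw0 hwK, ← Finset.sum_sub_distrib, ← Finset.sum_add_distrib]
    refine Finset.sum_congr rfl fun n _ => ?_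
    rw [← sub_smul, ← add_smul]
    by_cases hn : n ≤ Q
    · rw [hw, windowed, if_neg (by omega), smul_zero, smul_zero]
    · congr 1
      have := congrArg (fun f : ArithmeticFunction ℝ => f n) (vaughan_identity Q)
      simp only [ArithmeticFunction.add_apply] at this
      rw [lowPart_apply, if_neg hn] at this
      linarith
  have hsq7 : ∀ m, m ≤ Q ^ 2 → m ^ 7 ≤ N ^ 2 := fun m hm =>
    calc m ^ 7 ≤ (Q ^ 2) ^ 7 := Nat.pow_le_pow_left hm 7
      _ = (Q ^ 7) ^ 2 := by ring
      _ ≤ N ^ 2 := Nat.pow_le_pow_left hQN 2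
  have hlogmono : Monotone fun n : ℕ => Real.log (n : ℝ) := by
    intro x y hxy
    rcases Nat.eq_zero_or_pos x with rfl | hx
    · simpa using Real.log_natCast_nonneg y
    · exact Real.log_le_log (by exact_mod_cast hx) (by exact_mod_cast hxy)
  have t1 := typeI_le h θ N' K (lowPart realMoebius Q) 1
    (fun m => by
      rw [lowPart_apply]
      split_ifs
      · exact abs_realMoebius_le m
      · simp)
    (fun m hm => hsq7 m (by
      rw [lowPart_apply] at hm
      have h1 : m ≤ Q := by
        by_contra hh
        exact hm (if_neg hh)
      nlinarith [h.Q_pos])) (fun n => Real.log n) hlogmono (by simp) hN'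
  have t2 := typeI_le h θ N' K (lowPart realMoebius Q * lowPart ArithmeticFunction.vonMangoldt Q)
    (1 + Real.log N)
    (fun m => by
      by_cases hm : m ≤ Q ^ 2
      · refine (abs_low_mul_low_le Q m).trans ?_
        have hmN : m ≤ N := hm.trans ((Nat.pow_le_pow_right h.Q_pos (by norm_num)).trans hQN)
        linarith [hlogmono hmN]
      · rw [low_mul_low_eq_zero Q m (by omega), abs_zero]
        linarith)
    (fun m hm => hsq7 m (by
      by_contra hh
      exact hm (low_mul_low_eq_zero Q m (by omega)))) (fun _ => 1) monotone_const zero_le_one hN'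
  have e3 : ∑ m ∈ range K, ∑ l ∈ range K,
        ((lowPart realMoebius Q * lowPart ArithmeticFunction.vonMangoldt Q) m *
          (ArithmeticFunction.zeta : ArithmeticFunction ℝ) l) • w (m * l) =
      ∑ m ∈ range K, ∑ l ∈ range K,
        ((lowPart realMoebius Q * lowPart ArithmeticFunction.vonMangoldt Q) m * 1) • w (m * l) := by
    refine Finset.sum_congr rfl fun m _ => Finset.sum_congr rfl fun l _ => ?_
    rw [zeta_real_apply]
    split_ifs with hl
    · rw [hl, mul_zero m, hw0, smul_zero, smul_zero]
    · rfl
  have t3 := typeII_le h θ N' hN'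
  have hlog3 : Real.log ((2 * N + 1 : ℕ) : ℝ) ≤ 2 * (1 + Real.log N) := by
    have h1 : Real.log ((2 * N + 1 : ℕ) : ℝ) ≤ Real.log (4 * N) := by
      refine Real.log_le_log (by positivity) ?_
      push_cast
      linarith
    rw [Real.log_mul (by norm_num) (by linarith), show (4 : ℝ) = 2 ^ 2 by norm_num,
      Real.log_pow] at h1
    have := Real.log_two_lt_d9
    push_cast at h1 ⊢
    linarith
  have hQs : (N : ℝ) / Q ≤ N / √(Q : ℝ) := by
    refine div_le_div_of_nonneg_left (by positivity) (by positivity) ?_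
    rw [Real.sqrt_le_left (by positivity)]
    nlinarith
  have hT : linConst γ * ((1 + Real.log N) ^ 3 * (N / Q)) ≤
      linConst γ * ((1 + Real.log N) ^ 5 * (N / √(Q : ℝ))) := by
    have : (1 + Real.log N) ^ 3 ≤ (1 + Real.log N) ^ 5 :=
      pow_le_pow_right₀ (by linarith) (by norm_num)
    gcongr
  have t1' : 2 * 1 * Real.log ((2 * N + 1 : ℕ) : ℝ) * linConst γ *
      ((1 + Real.log N) ^ 2 * (N / Q)) ≤ 4 * (linConst γ * ((1 + Real.log N) ^ 3 * (N / Q))) := by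
    calc _ ≤ 2 * 1 * (2 * (1 + Real.log N)) * linConst γ * ((1 + Real.log N) ^ 2 * (N / Q)) := by
          gcongr
      _ = _ := by ring
  rw [e1, e2, e3]
  refine (norm_add_le _ _).trans ((add_le_add (norm_sub_le _ _) le_rfl).trans ?_)
  refine (add_le_add (add_le_add t1 t2) t3).trans ?_
  have e4 : 2 * (1 + Real.log N) * 1 * linConst γ * ((1 + Real.log N) ^ 2 * (N / Q)) =
    2 * (linConst γ * ((1 + Real.log N) ^ 3 * (N / Q))) := by ring
  have hn0 : 0 ≤ linConst γ * ((1 + Real.log N) ^ 5 * (N / √(Q : ℝ))) := by positivity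
  rw [e4]
  unfold mangoldtConst
  linarith

lemma integer_sum_le {γ j c : ℝ} {N Q : ℕ} (h : Admissible γ j c N Q) (θ : ℝ) (N' : ℕ)
    (hN' : N' ≤ 2 * N) :
    ‖∑ n ∈ Ioc N N', e2pi (intPhase γ θ j c n)‖ ≤
      2 * linConst γ * ((1 + Real.log N) * (N / Q)) := by
  have h1 := inner_sum_le h θ 1 N' (N' + 1) (fun _ => 1) monotone_const zero_le_one le_rfl
    (by simpa using Nat.one_le_pow 2 N h.N_pos) hN'
  have e1 : ∑ n ∈ Ioc N N', e2pi (intPhase γ θ j c n) =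
      ∑ l ∈ range (N' + 1), ((1 : ℝ) : ℂ) * windowed γ θ j c N N' (1 * l) := by
    have : Ioc N N' = (range (N' + 1)).filter (fun n => N < n ∧ n ≤ N') := by
      ext n
      simp only [mem_Ioc, mem_filter, mem_range]
      omega
    rw [this, Finset.sum_filter]
    refine Finset.sum_congr rfl fun n _ => ?_
    rw [windowed, one_mul]
    split_ifs <;> simp
  rw [e1]
  refine h1.trans (le_of_eq ?_)
  push_cast
  ring

/-- Half of the second periodic Bernoulli function, a primitive of `psi`. -/
noncomputable def psiPrimitive (t : ℝ) : ℝ := (Int.fract t ^ 2 - Int.fract t + 1 / 6) / 2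

lemma hasSum_psiPrimitive (t : ℝ) :
    HasSum (fun m : ℕ => 1 / (2 * Real.pi ^ 2 * (m : ℝ) ^ 2) * Real.cos (2 * Real.pi * (m * t)))
      (psiPrimitive t) := by
  have hx : Int.fract t ∈ Set.Icc (0 : ℝ) 1 := ⟨Int.fract_nonneg t, (Int.fract_lt_one t).le⟩
  have h := (hasSum_one_div_nat_pow_mul_cos (k := 1) one_ne_zero hx).mul_left
    (1 / (2 * Real.pi ^ 2))
  have hb : (Polynomial.map (algebraMap ℚ ℝ) (Polynomial.bernoulli (2 * 1))).eval (Int.fract t) =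
      Int.fract t ^ 2 - Int.fract t + 1 / 6 := by
    rw [Polynomial.bernoulli]
    simp [Finset.sum_range_succ, bernoulli_eq_bernoulli'_of_ne_one, bernoulli'_two]
    ring
  rw [hb] at h
  have hpi : Real.pi ≠ 0 := Real.pi_ne_zero
  have hv : psiPrimitive t = 1 / (2 * Real.pi ^ 2) * ((-1) ^ (1 + 1) * (2 * Real.pi) ^ (2 * 1) / 2 /
      ((2 * 1).factorial : ℝ) * (Int.fract t ^ 2 - Int.fract t + 1 / 6)) := by
    unfold psiPrimitive
    simp only [mul_one, Nat.factorial]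
    field_simp
    norm_num
  rw [hv]
  refine h.congr_fun fun m => ?_
  have h1 : 2 * Real.pi * (m : ℝ) * Int.fract t =
      2 * Real.pi * ((m : ℝ) * t) - (((m : ℤ) * ⌊t⌋ : ℤ) : ℝ) * (2 * Real.pi) := by
    rw [← Int.self_sub_floor]
    push_cast
    ring
  rw [h1, Real.cos_sub_int_mul_two_pi]
  ring

lemma psiPrimitive_add_le (t δ : ℝ) (h0 : 0 < δ) (h1 : δ ≤ 1) :
    (psiPrimitive (t + δ) - psiPrimitive t) / δ ≤ psi t + δ / 2 := by
  rw [div_le_iff₀ h0]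
  unfold psiPrimitive psi
  have hx0 := Int.fract_nonneg t
  have hx1 := Int.fract_lt_one t
  rcases lt_or_ge (Int.fract t + δ) 1 with h | h
  · have : Int.fract (t + δ) = Int.fract t + δ := by
      rw [Int.fract_eq_iff]
      exact ⟨by linarith, h, ⌊t⌋, by rw [← Int.self_sub_floor]; ring⟩
    rw [this]
    nlinarith
  · have : Int.fract (t + δ) = Int.fract t + δ - 1 := by
      rw [Int.fract_eq_iff]
      exact ⟨by linarith, by linarith, ⌊t⌋ + 1, by rw [← Int.self_sub_floor]; push_cast; ring⟩
    rw [this]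
    nlinarith

lemma le_psiPrimitive_sub (t δ : ℝ) (h0 : 0 < δ) (h1 : δ ≤ 1) :
    psi t - δ / 2 ≤ (psiPrimitive t - psiPrimitive (t - δ)) / δ := by
  rw [le_div_iff₀ h0]
  unfold psiPrimitive psi
  have hx0 := Int.fract_nonneg t
  have hx1 := Int.fract_lt_one t
  rcases le_or_gt 0 (Int.fract t - δ) with h | h
  · have : Int.fract (t - δ) = Int.fract t - δ := by
      rw [Int.fract_eq_iff]
      exact ⟨h, by linarith, ⌊t⌋, by rw [← Int.self_sub_floor]; ring⟩
    rw [this]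
    nlinarith
  · have : Int.fract (t - δ) = Int.fract t - δ + 1 := by
      rw [Int.fract_eq_iff]
      exact ⟨by linarith, by linarith, ⌊t⌋ - 1, by rw [← Int.self_sub_floor]; push_cast; ring⟩
    rw [this]
    nlinarith

lemma abs_psi_sub_le (t δ : ℝ) (h0 : 0 < δ) (h1 : δ ≤ 1) :
    |psi t - (psiPrimitive (t + δ) - psiPrimitive t) / δ| ≤
      2 * δ + (2 * psiPrimitive t - psiPrimitive (t - δ) - psiPrimitive (t + δ)) / δ := by
  have h2 := psiPrimitive_add_le t δ h0 h1
  have h3 := le_psiPrimitive_sub t δ h0 h1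
  have e : (2 * psiPrimitive t - psiPrimitive (t - δ) - psiPrimitive (t + δ)) / δ =
      (psiPrimitive t - psiPrimitive (t - δ)) / δ -
        (psiPrimitive (t + δ) - psiPrimitive t) / δ := by ring
  rw [e, abs_le]
  constructor <;> linarith

/-- The size of the `m`-th Fourier coefficient of `psi` smoothed at scale `1 / M`. -/
noncomputable def smoothCoeff (M m : ℕ) : ℝ := min (1 / (m : ℝ)) (M / (m : ℝ) ^ 2)

lemma norm_e2pi_sub_one_le (x : ℝ) : ‖e2pi x - 1‖ ≤ min 2 (2 * Real.pi * |x|) := by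
  refine le_min ?_ ?_
  · refine (norm_sub_le _ _).trans ?_
    rw [norm_e2pi, norm_one]
    norm_num
  · have h := Real.norm_exp_I_mul_ofReal_sub_one_le (x := 2 * Real.pi * x)
    have e : e2pi x = Complex.exp (Complex.I * ((2 * Real.pi * x : ℝ) : ℂ)) := by
      rw [e2pi]
      congr 1
      push_cast
      ring
    rw [e]
    refine h.trans (le_of_eq ?_)
    rw [Real.norm_eq_abs, abs_mul, abs_of_pos (by positivity : 0 < 2 * Real.pi)]

lemma min_coeff_le (M m : ℕ) (hM : 1 ≤ M) (hm : 1 ≤ m) (δ : ℝ) (hδ : δ = 1 / M) :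
    1 / (2 * Real.pi ^ 2 * (m : ℝ) ^ 2) / δ * min 2 (2 * Real.pi * |m * δ|) ≤ smoothCoeff M m := by
  have hM0 : (0 : ℝ) < M := by exact_mod_cast hM
  have hm0 : (0 : ℝ) < m := by exact_mod_cast hm
  have hδ0 : 0 < δ := by rw [hδ]; positivity
  have hpi := Real.pi_gt_three
  have hpi2 : 1 ≤ Real.pi ^ 2 := by nlinarith
  rw [abs_of_pos (by positivity)]
  refine le_min ?_ ?_
  · calc _ ≤ 1 / (2 * Real.pi ^ 2 * (m : ℝ) ^ 2) / δ * (2 * Real.pi * (m * δ)) :=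
          mul_le_mul_of_nonneg_left (min_le_right _ _) (by positivity)
      _ = 1 / Real.pi * (1 / m) := by field_simp
      _ ≤ 1 * (1 / m) := by
          gcongr
          rw [div_le_one (by positivity)]
          linarith
      _ = _ := one_mul _
  · calc _ ≤ 1 / (2 * Real.pi ^ 2 * (m : ℝ) ^ 2) / δ * 2 :=
          mul_le_mul_of_nonneg_left (min_le_left _ _) (by positivity)
      _ = 1 / Real.pi ^ 2 * (M / (m : ℝ) ^ 2) := by rw [hδ]; field_simp
      _ ≤ 1 * (M / (m : ℝ) ^ 2) := by
          gcongr
          rw [div_le_one (by positivity)]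
          linarith
      _ = _ := one_mul _

lemma cos_two_pi_eq (x : ℝ) : (Real.cos (2 * Real.pi * x) : ℂ) = (e2pi x + e2pi (-x)) / 2 := by
  rw [e2pi, e2pi, Complex.ofReal_cos, Complex.cos]
  congr 3
  · push_cast; ring
  · push_cast; ring

lemma norm_sum_smoothed_le {ι : Type*} (s : Finset ι) (w : ι → ℂ) (t : ι → ℝ) (M : ℕ) (hM : 1 ≤ M)
    (T : ℕ → ℝ) (R : ℝ) (h1 : ∀ m : ℕ, 1 ≤ m → ‖∑ n ∈ s, w n * e2pi (m * t n)‖ ≤ T m)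
    (h2 : ∀ m : ℕ, 1 ≤ m → ‖∑ n ∈ s, w n * e2pi (-(m * t n))‖ ≤ T m)
    (hR : ∀ K, ∑ m ∈ Ico 1 (K + 1), smoothCoeff M m * T m ≤ R) (δ : ℝ) (hδ : δ = 1 / M) :
    ‖∑ n ∈ s, w n * (((psiPrimitive (t n + δ) - psiPrimitive (t n)) / δ : ℝ) : ℂ)‖ ≤ R := by
  have hM0 : (0 : ℝ) < M := by exact_mod_cast hM
  have hδ0 : 0 < δ := by rw [hδ]; positivity
  set F : ℕ → ℂ := fun m => ∑ n ∈ s, w n * ((1 / (2 * Real.pi ^ 2 * (m : ℝ) ^ 2) / δ *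
    (Real.cos (2 * Real.pi * (m * (t n + δ))) - Real.cos (2 * Real.pi * (m * t n))) : ℝ) : ℂ)
    with hF
  have hsum : HasSum F
      (∑ n ∈ s, w n * (((psiPrimitive (t n + δ) - psiPrimitive (t n)) / δ : ℝ) : ℂ)) := by
    refine hasSum_sum fun n _ => HasSum.mul_left _ (Complex.hasSum_ofReal.2 ?_)
    refine (((hasSum_psiPrimitive (t n + δ)).sub
      (hasSum_psiPrimitive (t n))).div_const δ).congr_fun fun m => ?_
    ring
  have hFm : ∀ m, 1 ≤ m → ‖F m‖ ≤ smoothCoeff M m * T m := by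
    intro m hm
    have hT : 0 ≤ T m := (norm_nonneg _).trans (h1 m hm)
    have e : F m = ((1 / (2 * Real.pi ^ 2 * (m : ℝ) ^ 2) / δ : ℝ) : ℂ) *
        (((e2pi (m * δ) - 1) * ∑ n ∈ s, w n * e2pi (m * t n) +
          (e2pi (-(m * δ)) - 1) * ∑ n ∈ s, w n * e2pi (-(m * t n))) / 2) := by
      rw [hF, Finset.mul_sum, Finset.mul_sum, ← Finset.sum_add_distrib, Finset.sum_div,
        Finset.mul_sum]
      refine Finset.sum_congr rfl fun n _ => ?_
      rw [Complex.ofReal_mul, Complex.ofReal_sub, cos_two_pi_eq, cos_two_pi_eq,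
        show (m : ℝ) * (t n + δ) = m * t n + m * δ by ring,
        show -((m : ℝ) * t n + m * δ) = -(m * t n) + -(m * δ) by ring, e2pi_add, e2pi_add]
      ring
    rw [e, norm_mul, Complex.norm_real, Real.norm_of_nonneg (by positivity)]
    have h3 := norm_e2pi_sub_one_le (m * δ)
    have h4 := norm_e2pi_sub_one_le (-(m * δ))
    rw [abs_neg] at h4
    have h5 : ‖((e2pi (m * δ) - 1) * ∑ n ∈ s, w n * e2pi (m * t n) +
          (e2pi (-(m * δ)) - 1) * ∑ n ∈ s, w n * e2pi (-(m * t n))) / 2‖ ≤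
        min 2 (2 * Real.pi * |m * δ|) * T m := by
      rw [norm_div, Complex.norm_ofNat, div_le_iff₀ (by norm_num)]
      refine (norm_add_le _ _).trans ?_
      rw [norm_mul, norm_mul]
      have h6 := mul_le_mul h3 (h1 m hm) (norm_nonneg _) ((norm_nonneg _).trans h3)
      have h7 := mul_le_mul h4 (h2 m hm) (norm_nonneg _) ((norm_nonneg _).trans h4)
      linarith
    calc _ ≤ 1 / (2 * Real.pi ^ 2 * (m : ℝ) ^ 2) / δ *
          (min 2 (2 * Real.pi * |m * δ|) * T m) := mul_le_mul_of_nonneg_left h5 (by positivity)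
      _ = (1 / (2 * Real.pi ^ 2 * (m : ℝ) ^ 2) / δ * min 2 (2 * Real.pi * |m * δ|)) * T m := by ring
      _ ≤ _ := mul_le_mul_of_nonneg_right (min_coeff_le M m hM hm δ hδ) hT
  have hF0 : F 0 = 0 := by simp [hF]
  refine le_of_tendsto ((hsum.tendsto_sum_nat).norm) (Filter.eventually_atTop.2 ⟨1, fun K hK => ?_⟩)
  obtain ⟨K, rfl⟩ : ∃ k, K = k + 1 := ⟨K - 1, by omega⟩
  rw [Finset.range_eq_Ico, Finset.sum_eq_sum_Ico_succ_bot (by omega), hF0, zero_add]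
  refine (norm_sum_le _ _).trans (le_trans (Finset.sum_le_sum fun m hm => hFm m ?_) (hR K))
  simpa using (mem_Ico.1 hm).1

lemma sum_second_difference_le {ι : Type*} (s : Finset ι) (t : ι → ℝ) (M : ℕ) (hM : 1 ≤ M)
    (T : ℕ → ℝ) (R : ℝ) (h1 : ∀ m : ℕ, 1 ≤ m → ‖∑ n ∈ s, e2pi (m * t n)‖ ≤ T m)
    (hR : ∀ K, ∑ m ∈ Ico 1 (K + 1), smoothCoeff M m * T m ≤ R) (δ : ℝ) (hδ : δ = 1 / M) :
    ∑ n ∈ s, (2 * psiPrimitive (t n) - psiPrimitive (t n - δ) - psiPrimitive (t n + δ)) / δ ≤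
      2 * R := by
  have hM0 : (0 : ℝ) < M := by exact_mod_cast hM
  have hδ0 : 0 < δ := by rw [hδ]; positivity
  set F : ℕ → ℝ := fun m => ∑ n ∈ s, 1 / (2 * Real.pi ^ 2 * (m : ℝ) ^ 2) / δ *
    (2 * Real.cos (2 * Real.pi * (m * t n)) - Real.cos (2 * Real.pi * (m * (t n - δ))) -
      Real.cos (2 * Real.pi * (m * (t n + δ)))) with hF
  have hsum : HasSum F (∑ n ∈ s,
      (2 * psiPrimitive (t n) - psiPrimitive (t n - δ) - psiPrimitive (t n + δ)) / δ) := by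
    refine hasSum_sum fun n _ => ?_
    refine (((((hasSum_psiPrimitive (t n)).mul_left 2).sub (hasSum_psiPrimitive (t n - δ))).sub
      (hasSum_psiPrimitive (t n + δ))).div_const δ).congr_fun fun m => ?_
    ring
  have hFm : ∀ m, 1 ≤ m → F m ≤ 2 * (smoothCoeff M m * T m) := by
    intro m hm
    have hT : 0 ≤ T m := (norm_nonneg _).trans (h1 m hm)
    have hre : ∀ x, (e2pi x).re = Real.cos (2 * Real.pi * x) := by
      intro x
      rw [e2pi, show (2 * Real.pi * Complex.I * x : ℂ) = ((2 * Real.pi * x : ℝ) : ℂ) * Complex.I by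
        push_cast; ring, Complex.exp_ofReal_mul_I_re]
    have e : F m = 2 * (1 / (2 * Real.pi ^ 2 * (m : ℝ) ^ 2) / δ *
        ((1 - Real.cos (2 * Real.pi * (m * δ))) * (∑ n ∈ s, e2pi (m * t n)).re)) := by
      rw [hF, Complex.re_sum, Finset.mul_sum, Finset.mul_sum, Finset.mul_sum]
      refine Finset.sum_congr rfl fun n _ => ?_
      rw [hre, show 2 * Real.pi * (m * (t n - δ)) = 2 * Real.pi * (m * t n) -
        2 * Real.pi * (m * δ) by ring, show 2 * Real.pi * (m * (t n + δ)) =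
        2 * Real.pi * (m * t n) + 2 * Real.pi * (m * δ) by ring, Real.cos_sub, Real.cos_add]
      ring
    have h3 : 1 - Real.cos (2 * Real.pi * (m * δ)) ≤ min 2 (2 * Real.pi * |m * δ|) := by
      refine le_trans ?_ (norm_e2pi_sub_one_le (m * δ))
      rw [← hre, ← norm_neg, neg_sub]
      exact (by simp : 1 - (e2pi (m * δ)).re = (1 - e2pi (m * δ)).re) ▸ Complex.re_le_norm _
    have h4 : 0 ≤ 1 - Real.cos (2 * Real.pi * (m * δ)) := by
      linarith [Real.cos_le_one (2 * Real.pi * (m * δ))]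
    have h5 : (∑ n ∈ s, e2pi (m * t n)).re ≤ T m := (Complex.re_le_norm _).trans (h1 m hm)
    rw [e]
    refine mul_le_mul_of_nonneg_left ?_ (by norm_num)
    calc _ ≤ 1 / (2 * Real.pi ^ 2 * (m : ℝ) ^ 2) / δ *
          (min 2 (2 * Real.pi * |m * δ|) * T m) := by
          refine mul_le_mul_of_nonneg_left ?_ (by positivity)
          exact (mul_le_mul_of_nonneg_left h5 h4).trans (mul_le_mul_of_nonneg_right h3 hT)
      _ = (1 / (2 * Real.pi ^ 2 * (m : ℝ) ^ 2) / δ * min 2 (2 * Real.pi * |m * δ|)) * T m := by ring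
      _ ≤ _ := mul_le_mul_of_nonneg_right (min_coeff_le M m hM hm δ hδ) hT
  have hF0 : F 0 = 0 := by simp [hF]
  refine le_of_tendsto hsum.tendsto_sum_nat (Filter.eventually_atTop.2 ⟨1, fun K hK => ?_⟩)
  obtain ⟨K, rfl⟩ : ∃ k, K = k + 1 := ⟨K - 1, by omega⟩
  rw [Finset.range_eq_Ico, Finset.sum_eq_sum_Ico_succ_bot (by omega), hF0, zero_add]
  refine le_trans (Finset.sum_le_sum fun m hm => hFm m ?_) (?_ : _ ≤ 2 * R)
  · simpa using (mem_Ico.1 hm).1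
  · rw [← Finset.mul_sum]
    exact mul_le_mul_of_nonneg_left (hR K) (by norm_num)

/-- A weighted sum of `psi` in terms of exponential sums. -/
lemma norm_sum_psi_le {ι : Type*} (s : Finset ι) (w : ι → ℂ) (t : ι → ℝ) (M : ℕ) (hM : 1 ≤ M)
    (T : ℕ → ℝ) (R W : ℝ) (hW : ∀ n ∈ s, ‖w n‖ ≤ W) (hW0 : 0 ≤ W)
    (h1 : ∀ m : ℕ, 1 ≤ m → ‖∑ n ∈ s, w n * e2pi (m * t n)‖ ≤ T m)
    (h2 : ∀ m : ℕ, 1 ≤ m → ‖∑ n ∈ s, w n * e2pi (-(m * t n))‖ ≤ T m)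
    (hR : ∀ K, ∑ m ∈ Ico 1 (K + 1), smoothCoeff M m * T m ≤ R)
    (T' : ℕ → ℝ) (R' : ℝ) (h1' : ∀ m : ℕ, 1 ≤ m → ‖∑ n ∈ s, e2pi (m * t n)‖ ≤ T' m)
    (hR' : ∀ K, ∑ m ∈ Ico 1 (K + 1), smoothCoeff M m * T' m ≤ R') :
    ‖∑ n ∈ s, w n * (psi (t n) : ℂ)‖ ≤ R + W * (2 * s.card / M + 2 * R') := by
  have hM0 : (0 : ℝ) < M := by exact_mod_cast hM
  have hM1 : (1 : ℝ) ≤ M := by exact_mod_cast hM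
  obtain ⟨δ, hδ⟩ : ∃ δ : ℝ, δ = 1 / M := ⟨_, rfl⟩
  have hδ0 : 0 < δ := by rw [hδ]; positivity
  have hδ1 : δ ≤ 1 := by rw [hδ, div_le_one hM0]; exact hM1
  have e : ∑ n ∈ s, w n * (psi (t n) : ℂ) =
      ∑ n ∈ s, w n * (((psiPrimitive (t n + δ) - psiPrimitive (t n)) / δ : ℝ) : ℂ) +
      ∑ n ∈ s, w n *
        ((psi (t n) - (psiPrimitive (t n + δ) - psiPrimitive (t n)) / δ : ℝ) : ℂ) := by
    rw [← Finset.sum_add_distrib]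
    refine Finset.sum_congr rfl fun n _ => ?_
    push_cast
    ring
  rw [e]
  refine (norm_add_le _ _).trans (add_le_add (norm_sum_smoothed_le s w t M hM T R h1 h2 hR δ hδ) ?_)
  calc _ ≤ ∑ n ∈ s, W * (2 * δ +
        (2 * psiPrimitive (t n) - psiPrimitive (t n - δ) - psiPrimitive (t n + δ)) / δ) := by
        refine (norm_sum_le _ _).trans (Finset.sum_le_sum fun n hn => ?_)
        rw [norm_mul, Complex.norm_real, Real.norm_eq_abs]
        exact mul_le_mul (hW n hn) (abs_psi_sub_le _ _ hδ0 hδ1) (abs_nonneg _) hW0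
    _ = W * (2 * s.card / M + ∑ n ∈ s,
        (2 * psiPrimitive (t n) - psiPrimitive (t n - δ) - psiPrimitive (t n + δ)) / δ) := by
        rw [← Finset.mul_sum, Finset.sum_add_distrib, Finset.sum_const, nsmul_eq_mul, hδ]
        ring
    _ ≤ _ := by
        have := sum_second_difference_le s t M hM T' R' h1' hR' δ hδ
        gcongr

lemma smoothCoeff_mul_le {γ c : ℝ} {N M : ℕ} (hγ0 : 13 / 14 ≤ γ) (hγ1 : γ < 1) (hc0 : 0 ≤ c)
    (hc1 : c ≤ 1) (hN : 1 ≤ N) (hM : 1 ≤ M) (hM14 : M ^ 14 ≤ N)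
    (hfreq : (N : ℝ) ^ γ * (M : ℝ) ^ 15 ≤ (N : ℝ) ^ 2) (X : ℕ → ℝ) (D : ℝ) (hD : 0 ≤ D)
    (hX0 : ∀ m, 0 ≤ X m)
    (hX : ∀ m Q : ℕ, Admissible γ m c N Q → X m ≤ D * (N / √(Q : ℝ))) (m : ℕ) (hm : 1 ≤ m)
    (hmM : m ≤ M ^ 2) :
    smoothCoeff M m * X m ≤ 2 * D * (N / M) * (1 / m) := by
  have hM1 : (1 : ℝ) ≤ M := by exact_mod_cast hM
  have hm1 : (1 : ℝ) ≤ m := by exact_mod_cast hm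
  have hM0 : (0 : ℝ) < M := by linarith
  have hm0 : (0 : ℝ) < m := by linarith
  have hNγ : 0 ≤ (N : ℝ) ^ γ := Real.rpow_nonneg (Nat.cast_nonneg _) _
  have hadm : ∀ Q : ℕ, 1 ≤ Q → Q ≤ M ^ 2 → m * Q ≤ M ^ 3 → Admissible γ m c N Q := by
    intro Q hQ hQM hmQ
    refine ⟨hγ0, hγ1, hm1, hc0, hc1, hN, hQ, ?_, ?_⟩
    · calc Q ^ 7 ≤ (M ^ 2) ^ 7 := Nat.pow_le_pow_left hQM 7
        _ = M ^ 14 := by ring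
        _ ≤ N := hM14
    · have h1 : m * Q ^ 7 ≤ M ^ 15 := by
        calc m * Q ^ 7 = (m * Q) * Q ^ 6 := by ring
          _ ≤ M ^ 3 * (M ^ 2) ^ 6 := Nat.mul_le_mul hmQ (Nat.pow_le_pow_left hQM 6)
          _ = M ^ 15 := by ring
      have h2 : (m : ℝ) * (Q : ℝ) ^ 7 ≤ (M : ℝ) ^ 15 := by exact_mod_cast h1
      calc _ = (N : ℝ) ^ γ * (m * (Q : ℝ) ^ 7) := by ring
        _ ≤ (N : ℝ) ^ γ * (M : ℝ) ^ 15 := mul_le_mul_of_nonneg_left h2 hNγ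
        _ ≤ _ := hfreq
  rcases le_or_gt m M with hmM' | hmM'
  · have h1 := hX m (M ^ 2) (hadm _ (Nat.one_le_pow _ _ hM) le_rfl
      (by nlinarith [Nat.mul_le_mul_right (M ^ 2) hmM']))
    push_cast at h1
    rw [Real.sqrt_sq hM0.le] at h1
    calc _ ≤ 1 / (m : ℝ) * (D * (N / M)) :=
          mul_le_mul (min_le_left _ _) h1 (hX0 m) (by positivity)
      _ ≤ 2 * (1 / (m : ℝ) * (D * (N / M))) := le_mul_of_one_le_left (by positivity) (by norm_num)
      _ = _ := by ring
  · set Q := M ^ 3 / m with hQ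
    have hmQ : m * Q ≤ M ^ 3 := Nat.mul_div_le _ _
    have hQ1 : 1 ≤ Q := by
      rw [hQ, Nat.one_le_div_iff hm]
      exact hmM.trans (Nat.pow_le_pow_right hM (by norm_num))
    have hQM : Q ≤ M ^ 2 := by
      have h2 : M * Q ≤ M * M ^ 2 := by
        calc M * Q ≤ m * Q := Nat.mul_le_mul_right _ hmM'.le
          _ ≤ M ^ 3 := hmQ
          _ = M * M ^ 2 := by ring
      exact Nat.le_of_mul_le_mul_left h2 hM
    have h1 := hX m Q (hadm Q hQ1 hQM hmQ)
    have hlow : M ^ 3 ≤ 2 * (m * Q) := by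
      have h3 : M ^ 3 < m * (Q + 1) := by
        rw [mul_comm]
        exact Nat.lt_mul_of_div_lt (by omega) hm
      nlinarith
    have hlow' : (M : ℝ) ^ 3 ≤ 2 * (m * Q) := by exact_mod_cast hlow
    have hQ0 : (0 : ℝ) < Q := by exact_mod_cast hQ1
    have hs : (M : ℝ) ^ 2 ≤ 2 * m * √(Q : ℝ) := by
      refine (sq_le_sq₀ (by positivity) (by positivity)).1 ?_
      rw [mul_pow, Real.sq_sqrt hQ0.le]
      have h4 : (M : ℝ) ≤ m := by exact_mod_cast hmM'.le
      calc ((M : ℝ) ^ 2) ^ 2 = (M : ℝ) * (M : ℝ) ^ 3 := by ring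
        _ ≤ (m : ℝ) * (2 * ((m : ℝ) * (Q : ℝ))) := by gcongr
        _ ≤ (2 * (m : ℝ)) ^ 2 * (Q : ℝ) := by nlinarith [mul_pos (mul_pos hm0 hm0) hQ0]
    have hsq : 0 < √(Q : ℝ) := Real.sqrt_pos.2 hQ0
    calc _ ≤ M / (m : ℝ) ^ 2 * (D * (N / √(Q : ℝ))) :=
          mul_le_mul (min_le_right _ _) h1 (hX0 m) (by positivity)
      _ = D * N * (1 / m) * (M / (m * √(Q : ℝ))) := by field_simp
      _ ≤ D * N * (1 / m) * (2 / M) := by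
          refine mul_le_mul_of_nonneg_left ?_ (by positivity)
          rw [div_le_div_iff₀ (by positivity) hM0]
          nlinarith
      _ = _ := by ring

lemma sum_smoothCoeff_le {γ c : ℝ} {N M : ℕ} (hγ0 : 13 / 14 ≤ γ) (hγ1 : γ < 1) (hc0 : 0 ≤ c)
    (hc1 : c ≤ 1) (hN : 1 ≤ N) (hM : 1 ≤ M) (hM14 : M ^ 14 ≤ N)
    (hfreq : (N : ℝ) ^ γ * (M : ℝ) ^ 15 ≤ (N : ℝ) ^ 2) (X : ℕ → ℝ) (D : ℝ) (hD : 0 ≤ D)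
    (hX0 : ∀ m, 0 ≤ X m)
    (hX : ∀ m Q : ℕ, Admissible γ m c N Q →
      X m ≤ D * (1 + Real.log N) ^ 5 * (N / √(Q : ℝ)))
    (hX1 : ∀ m, X m ≤ 2 * (1 + Real.log N) * N) (K : ℕ) :
    ∑ m ∈ Ico 1 (K + 1), smoothCoeff M m * X m ≤
      2 * (D + 1) * ((1 + Real.log N) ^ 6 * (N / M)) := by
  have hN1 : (1 : ℝ) ≤ N := by exact_mod_cast hN
  have hM1 : (1 : ℝ) ≤ M := by exact_mod_cast hM
  have hlog := Real.log_nonneg hN1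
  set ℓ := 1 + Real.log N with hℓ
  have hℓ1 : 1 ≤ ℓ := by linarith
  have hstep : ∀ m ∈ Ico 1 (K + 1), smoothCoeff M m * X m ≤
      2 * (D * ℓ ^ 5) * (N / M) * (if m ∈ range (M ^ 2 + 1) then (1 : ℝ) / m else 0) +
      2 * ℓ * N * M * (if m ∈ Ioc (M ^ 2) K then ((m : ℝ) ^ 2)⁻¹ else 0) := by
    intro m hm
    obtain ⟨hm1, hmK⟩ := mem_Ico.1 hm
    rcases le_or_gt m (M ^ 2) with hmM | hmM
    · rw [if_pos (mem_range.2 (by omega)), if_neg (fun hh => by have := (mem_Ioc.1 hh).1; omega),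
        mul_zero, add_zero]
      exact smoothCoeff_mul_le hγ0 hγ1 hc0 hc1 hN hM hM14 hfreq X _ (by positivity) hX0 hX m hm1 hmM
    · rw [if_neg (fun hh => by have := mem_range.1 hh; omega),
        if_pos (mem_Ioc.2 ⟨hmM, by omega⟩), mul_zero, zero_add]
      calc _ ≤ M / (m : ℝ) ^ 2 * (2 * ℓ * N) :=
            mul_le_mul (min_le_right _ _) (hX1 m) (hX0 m) (by positivity)
        _ = _ := by ring
  refine (Finset.sum_le_sum hstep).trans ?_
  rw [Finset.sum_add_distrib, ← Finset.mul_sum, ← Finset.mul_sum, ← Finset.sum_filter,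
    ← Finset.sum_filter]
  have hM2N : M ^ 2 ≤ N := (Nat.pow_le_pow_right hM (by norm_num)).trans hM14
  have h1 : ∑ m ∈ (Ico 1 (K + 1)).filter (· ∈ range (M ^ 2 + 1)), (1 : ℝ) / m ≤ ℓ := by
    refine (Finset.sum_le_sum_of_subset_of_nonneg (fun x hx => (mem_filter.1 hx).2)
      fun _ _ _ => by positivity).trans ((sum_range_inv_le (M ^ 2)).trans ?_)
    rw [hℓ]
    have : Real.log ((M ^ 2 : ℕ) : ℝ) ≤ Real.log N :=
      Real.log_le_log (by exact_mod_cast Nat.one_le_pow _ _ hM) (by exact_mod_cast hM2N)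
    linarith
  have h2 : ∑ m ∈ (Ico 1 (K + 1)).filter (· ∈ Ioc (M ^ 2) K), ((m : ℝ) ^ 2)⁻¹ ≤
      1 / (M : ℝ) ^ 2 := by
    refine (Finset.sum_le_sum_of_subset_of_nonneg (t := Ioc (M ^ 2) K)
      (fun x hx => (mem_filter.1 hx).2) fun _ _ _ => by positivity).trans ?_
    rcases le_or_gt (M ^ 2) K with hK | hK
    · refine (sum_Ioc_inv_sq_le_sub (Nat.one_le_iff_ne_zero.1 (Nat.one_le_pow _ _ hM)) hK).trans ?_
      have : (0 : ℝ) ≤ (K : ℝ)⁻¹ := by positivity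
      push_cast
      rw [one_div]
      linarith
    · rw [Ioc_eq_empty (by omega), sum_empty]
      positivity
  calc _ ≤ 2 * (D * ℓ ^ 5) * (N / M) * ℓ + 2 * ℓ * N * M * (1 / (M : ℝ) ^ 2) := by gcongr
    _ = 2 * D * (ℓ ^ 6 * (N / M)) + 2 * (ℓ * (N / M)) := by field_simp
    _ ≤ 2 * D * (ℓ ^ 6 * (N / M)) + 2 * (ℓ ^ 6 * (N / M)) := by
        have : ℓ ≤ ℓ ^ 6 := le_self_pow₀ hℓ1 (by norm_num)
        gcongr
    _ = _ := by ring

lemma vonMangoldt_le_of_mem {N N' n : ℕ} (hN : 1 ≤ N) (hN' : N' ≤ 2 * N) (hn : n ∈ Ioc N N') :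
    ArithmeticFunction.vonMangoldt n ≤ 1 + Real.log N := by
  obtain ⟨h1, h2⟩ := mem_Ioc.1 hn
  have hN1 : (1 : ℝ) ≤ N := by exact_mod_cast hN
  refine ArithmeticFunction.vonMangoldt_le_log.trans ?_
  have h3 : Real.log n ≤ Real.log (2 * N) :=
    Real.log_le_log (by exact_mod_cast (by omega : 0 < n)) (by exact_mod_cast h2.trans hN')
  rw [Real.log_mul (by norm_num) (by linarith)] at h3
  have := Real.log_two_lt_d9
  linarith

/-- The constant in `block_psi_le`. -/
noncomputable def psiConst (γ : ℝ) : ℝ := 4 * mangoldtConst γ + 8 * linConst γ + 8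

lemma block_psi_le {γ c : ℝ} {N M : ℕ} (hγ0 : 13 / 14 ≤ γ) (hγ1 : γ < 1) (hc0 : 0 ≤ c)
    (hc1 : c ≤ 1) (hN : 1 ≤ N) (hM : 1 ≤ M) (hM14 : M ^ 14 ≤ N)
    (hfreq : (N : ℝ) ^ γ * (M : ℝ) ^ 15 ≤ (N : ℝ) ^ 2) (θ : ℝ) (N' : ℕ) (hN' : N' ≤ 2 * N) :
    ‖∑ n ∈ Ioc N N', (ArithmeticFunction.vonMangoldt n : ℂ) * e2pi (θ * (n : ℝ) ^ 2) *
      (psi (-((n + c : ℝ) ^ γ)) : ℂ)‖ ≤ psiConst γ * ((1 + Real.log N) ^ 7 * (N / M)) := by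
  have hN1 : (1 : ℝ) ≤ N := by exact_mod_cast hN
  have hM1 : (1 : ℝ) ≤ M := by exact_mod_cast hM
  have hlog := Real.log_nonneg hN1
  have hlin := linConst_nonneg hγ0 hγ1
  have hman := mangoldtConst_nonneg hγ0 hγ1
  set ℓ := 1 + Real.log N with hℓ
  have hℓ1 : 1 ≤ ℓ := by linarith
  set w : ℕ → ℂ := fun n => (ArithmeticFunction.vonMangoldt n : ℂ) * e2pi (θ * (n : ℝ) ^ 2)
  set t : ℕ → ℝ := fun n => -((n + c : ℝ) ^ γ)
  have hw : ∀ n ∈ Ioc N N', ‖w n‖ ≤ ℓ := by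
    intro n hn
    rw [norm_mul, norm_e2pi, mul_one, Complex.norm_real,
      Real.norm_of_nonneg ArithmeticFunction.vonMangoldt_nonneg]
    exact vonMangoldt_le_of_mem hN hN' hn
  have hcard : ((Ioc N N').card : ℝ) ≤ N := by
    rw [Nat.card_Ioc]
    exact_mod_cast (by omega : N' - N ≤ N)
  have hsum1 : ∀ x : ℕ → ℝ, ‖∑ n ∈ Ioc N N', w n * e2pi (x n)‖ ≤ ℓ * N := by
    intro x
    refine (norm_sum_le_of_le _ (f := fun n => w n * e2pi (x n)) (n := fun _ => ℓ)
      fun n hn => ?_).trans ?_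
    · rw [norm_mul, norm_e2pi, mul_one]
      exact hw n hn
    · rw [Finset.sum_const, nsmul_eq_mul, mul_comm]
      exact mul_le_mul_of_nonneg_left hcard (by linarith)
  have e2 : ∀ (m : ℕ), ∑ n ∈ Ioc N N', w n * e2pi (-(m * t n)) =
      ∑ n ∈ Ioc N N', (ArithmeticFunction.vonMangoldt n : ℂ) * e2pi (intPhase γ θ m c n) := by
    intro m
    refine Finset.sum_congr rfl fun n _ => ?_
    rw [intPhase, mul_assoc, ← e2pi_add]
    congr 2
    ring
  have e1 : ∀ (m : ℕ), ∑ n ∈ Ioc N N', w n * e2pi (m * t n) = (starRingEnd ℂ)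
      (∑ n ∈ Ioc N N', (ArithmeticFunction.vonMangoldt n : ℂ) * e2pi (intPhase γ (-θ) m c n)) := by
    intro m
    rw [map_sum]
    refine Finset.sum_congr rfl fun n _ => ?_
    rw [map_mul, Complex.conj_ofReal, ← e2pi_neg, intPhase, mul_assoc, ← e2pi_add]
    congr 2
    ring
  have e3 : ∀ (m : ℕ), ∑ n ∈ Ioc N N', e2pi (m * t n) = (starRingEnd ℂ)
      (∑ n ∈ Ioc N N', e2pi (intPhase γ 0 m c n)) := by
    intro m
    rw [map_sum]
    refine Finset.sum_congr rfl fun n _ => ?_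
    rw [← e2pi_neg, intPhase]
    congr 1
    ring
  have hR := sum_smoothCoeff_le hγ0 hγ1 hc0 hc1 hN hM hM14 hfreq
    (fun m => ‖∑ n ∈ Ioc N N', w n * e2pi (m * t n)‖ +
      ‖∑ n ∈ Ioc N N', w n * e2pi (-(m * t n))‖) (2 * mangoldtConst γ) (by positivity)
    (fun m => by positivity)
    (fun m Q h => by
      simp only [e1, e2, RCLike.norm_conj]
      have h1 := vonMangoldt_sum_le h θ N' hN'
      have h2 := vonMangoldt_sum_le h (-θ) N' hN'
      linarith)
    (fun m => by
      have h1 := hsum1 (fun n => m * t n)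
      have h2 := hsum1 (fun n => -(m * t n))
      linarith)
  have hR' := sum_smoothCoeff_le hγ0 hγ1 hc0 hc1 hN hM hM14 hfreq
    (fun m => ‖∑ n ∈ Ioc N N', e2pi (m * t n)‖) (2 * linConst γ) (by positivity)
    (fun m => norm_nonneg _)
    (fun m Q h => by
      simp only [e3, RCLike.norm_conj]
      have hQ1 : (1 : ℝ) ≤ Q := by exact_mod_cast h.Q_pos
      have hQs : (N : ℝ) / Q ≤ N / √(Q : ℝ) := by
        refine div_le_div_of_nonneg_left (by positivity) (by positivity) ?_
        rw [Real.sqrt_le_left (by positivity)]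
        nlinarith
      have h5 : ℓ ≤ ℓ ^ 5 := le_self_pow₀ hℓ1 (by norm_num)
      refine (integer_sum_le h 0 N' hN').trans ?_
      rw [mul_assoc _ (ℓ ^ 5)]
      gcongr)
    (fun m => by
      have h1 := norm_sum_e2pi_le (Ioc N N') (fun n => m * t n)
      nlinarith)
  have main := norm_sum_psi_le (Ioc N N') w t M hM _ _ ℓ hw (by linarith)
    (fun m _ => le_add_of_nonneg_right (norm_nonneg _))
    (fun m _ => le_add_of_nonneg_left (norm_nonneg _)) hR _ _ (fun m _ => le_rfl) hR'
  refine main.trans ?_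
  have h6 : ℓ ^ 6 * (N / M) ≤ ℓ ^ 7 * (N / M) := by
    have : ℓ ^ 6 ≤ ℓ ^ 7 := pow_le_pow_right₀ hℓ1 (by norm_num)
    gcongr
  have h7 : ℓ * (N / M) ≤ ℓ ^ 7 * (N / M) := by
    have : ℓ ≤ ℓ ^ 7 := le_self_pow₀ hℓ1 (by norm_num)
    gcongr
  calc _ ≤ 2 * (2 * mangoldtConst γ + 1) * (ℓ ^ 6 * (N / M)) +
        ℓ * (2 * N / M + 2 * (2 * (2 * linConst γ + 1) * (ℓ ^ 6 * (N / M)))) := by gcongr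
    _ = (4 * mangoldtConst γ + 2) * (ℓ ^ 6 * (N / M)) + 2 * (ℓ * (N / M)) +
        (8 * linConst γ + 4) * (ℓ ^ 7 * (N / M)) := by ring
    _ ≤ (4 * mangoldtConst γ + 2) * (ℓ ^ 7 * (N / M)) + 2 * (ℓ ^ 7 * (N / M)) +
        (8 * linConst γ + 4) * (ℓ ^ 7 * (N / M)) := by gcongr
    _ = _ := by unfold psiConst; ring

lemma one_add_log_pow_seven_le {x ε : ℝ} (hx : 1 ≤ x) (hε : 0 < ε) :
    (1 + Real.log x) ^ 7 ≤ (1 + 7 / ε) ^ 7 * x ^ ε := by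
  have h1 := Real.log_le_rpow_div (zero_le_one.trans hx) (by positivity : 0 < ε / 7)
  have h2 : 1 ≤ x ^ (ε / 7) := Real.one_le_rpow hx (by positivity)
  have h3 : x ^ ε = (x ^ (ε / 7)) ^ 7 := by
    rw [← Real.rpow_mul_natCast (zero_le_one.trans hx)]
    congr 1
    push_cast
    ring
  have hlog := Real.log_nonneg hx
  rw [h3, ← mul_pow]
  refine pow_le_pow_left₀ (by positivity) ?_ 7
  calc 1 + Real.log x ≤ x ^ (ε / 7) + x ^ (ε / 7) / (ε / 7) := add_le_add h2 h1
    _ = _ := by field_simp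

lemma block_psi_le_rpow {γ c ε : ℝ} {N : ℕ} (hγ0 : 13 / 14 ≤ γ) (hγ1 : γ < 1) (hε : 0 < ε)
    (hc0 : 0 ≤ c) (hc1 : c ≤ 1) (hN : 1 ≤ N) (θ : ℝ) (N' : ℕ) (hN' : N' ≤ 2 * N) :
    ‖∑ n ∈ Ioc N N', (ArithmeticFunction.vonMangoldt n : ℂ) * e2pi (θ * (n : ℝ) ^ 2) *
      (psi (-((n + c : ℝ) ^ γ)) : ℂ)‖ ≤
      2 * psiConst γ * (1 + 7 / ε) ^ 7 * (N : ℝ) ^ ((15 * γ + 13) / 29 + ε) := by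
  have hN1 : (1 : ℝ) ≤ N := by exact_mod_cast hN
  have hN0 : (0 : ℝ) < N := by linarith
  set δ := (16 - 15 * γ) / 29 with hδ
  have hδ0 : 0 ≤ δ := by rw [hδ]; linarith
  set M := ⌊(N : ℝ) ^ δ⌋₊ with hMdef
  have hNδ : 1 ≤ (N : ℝ) ^ δ := Real.one_le_rpow hN1 hδ0
  have hM : 1 ≤ M := (Nat.one_le_floor_iff _).2 hNδ
  have hM1 : (1 : ℝ) ≤ M := by exact_mod_cast hM
  have hMle : (M : ℝ) ≤ (N : ℝ) ^ δ := Nat.floor_le (by positivity)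
  have hMge : (N : ℝ) ^ δ ≤ 2 * M := by
    have := Nat.lt_floor_add_one ((N : ℝ) ^ δ)
    rw [← hMdef] at this
    linarith
  have hpow : ∀ k : ℕ, (M : ℝ) ^ k ≤ (N : ℝ) ^ (δ * k) := fun k => by
    rw [Real.rpow_mul_natCast hN0.le]
    exact pow_le_pow_left₀ (by positivity) hMle k
  have hM14 : M ^ 14 ≤ N := by
    have : (M : ℝ) ^ 14 ≤ N := by
      refine (hpow 14).trans ?_
      conv_rhs => rw [← Real.rpow_one (N : ℝ)]
      refine Real.rpow_le_rpow_of_exponent_le hN1 ?_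
      rw [hδ]
      push_cast
      linarith
    exact_mod_cast this
  have hfreq : (N : ℝ) ^ γ * (M : ℝ) ^ 15 ≤ (N : ℝ) ^ 2 := by
    calc _ ≤ (N : ℝ) ^ γ * (N : ℝ) ^ (δ * (15 : ℕ)) := by gcongr; exact hpow 15
      _ = (N : ℝ) ^ (γ + δ * (15 : ℕ)) := (Real.rpow_add hN0 _ _).symm
      _ ≤ (N : ℝ) ^ ((2 : ℕ) : ℝ) := by
          refine Real.rpow_le_rpow_of_exponent_le hN1 ?_
          rw [hδ]
          push_cast
          linarith
      _ = _ := Real.rpow_natCast _ _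
  have hdiv : (N : ℝ) / M ≤ 2 * (N : ℝ) ^ ((15 * γ + 13) / 29) := by
    have h1 : (N : ℝ) ^ ((15 * γ + 13) / 29) * (N : ℝ) ^ δ = N := by
      rw [← Real.rpow_add hN0, hδ]
      convert Real.rpow_one (N : ℝ) using 2
      ring
    rw [div_le_iff₀ (by linarith)]
    calc (N : ℝ) = (N : ℝ) ^ ((15 * γ + 13) / 29) * (N : ℝ) ^ δ := h1.symm
      _ ≤ (N : ℝ) ^ ((15 * γ + 13) / 29) * (2 * M) := by gcongr
      _ = _ := by ring
  have hconst : 0 ≤ psiConst γ := by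
    have := linConst_nonneg hγ0 hγ1
    have := mangoldtConst_nonneg hγ0 hγ1
    unfold psiConst
    positivity
  calc _ ≤ psiConst γ * ((1 + Real.log N) ^ 7 * (N / M)) :=
        block_psi_le hγ0 hγ1 hc0 hc1 hN hM hM14 hfreq θ N' hN'
    _ ≤ psiConst γ * ((1 + 7 / ε) ^ 7 * (N : ℝ) ^ ε * (2 * (N : ℝ) ^ ((15 * γ + 13) / 29))) := by
        gcongr
        exact one_add_log_pow_seven_le hN1 hε
    _ = _ := by rw [Real.rpow_add hN0]; ring

lemma norm_sum_Ioc_le_of_dyadic (f : ℕ → ℂ) {C s : ℝ} (hC : 0 ≤ C) (hs : 0 < s)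
    (hf : ∀ N N' : ℕ, 1 ≤ N → N' ≤ 2 * N → ‖∑ n ∈ Ioc N N', f n‖ ≤ C * (N : ℝ) ^ s) (N : ℕ) :
    ‖∑ n ∈ Ioc 1 N, f n‖ ≤ C / (1 - (2 / 3) ^ s) * (N : ℝ) ^ s := by
  have hr1 : (2 / 3 : ℝ) ^ s < 1 := Real.rpow_lt_one (by norm_num) (by norm_num) hs
  have hr0 : 0 ≤ (2 / 3 : ℝ) ^ s := by positivity
  have h1r : 0 < 1 - (2 / 3 : ℝ) ^ s := by linarith
  induction N using Nat.strong_induction_on with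
  | _ N ih =>
    rcases le_or_gt N 1 with hN | hN
    · rw [Ioc_eq_empty (by omega), sum_empty, norm_zero]
      positivity
    · obtain ⟨M, hM⟩ : ∃ M, M = (N + 1) / 2 := ⟨_, rfl⟩
      have hM1 : 1 ≤ M := by omega
      have hMN : M < N := by omega
      have hle : (M : ℝ) ^ s ≤ (2 / 3) ^ s * (N : ℝ) ^ s := by
        rw [← Real.mul_rpow (by norm_num) (by positivity)]
        refine Real.rpow_le_rpow (by positivity) ?_ hs.le
        have : 3 * M ≤ 2 * N := by omega
        have : (3 : ℝ) * M ≤ 2 * N := by exact_mod_cast this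
        linarith
      rw [← Finset.sum_Ioc_consecutive f hM1 hMN.le]
      calc _ ≤ C / (1 - (2 / 3) ^ s) * (M : ℝ) ^ s + C * (M : ℝ) ^ s :=
            (norm_add_le _ _).trans (add_le_add (ih M hMN) (hf M N hM1 (by omega)))
        _ = (C / (1 - (2 / 3) ^ s) + C) * (M : ℝ) ^ s := by ring
        _ ≤ (C / (1 - (2 / 3) ^ s) + C) * ((2 / 3) ^ s * (N : ℝ) ^ s) := by gcongr
        _ = (C / (1 - (2 / 3) ^ s) - C * (1 - (2 / 3) ^ s)) * (N : ℝ) ^ s := by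
            field_simp
            ring
        _ ≤ _ := by
            have : 0 ≤ C * (1 - (2 / 3 : ℝ) ^ s) := by positivity
            gcongr
            linarith

lemma abs_psi_sub_psi_le (x y : ℝ) : |psi x - psi y| ≤ 1 := by
  have h1 := Int.fract_nonneg x
  have h2 := (Int.fract_lt_one x).le
  have h3 := Int.fract_nonneg y
  have h4 := (Int.fract_lt_one y).le
  unfold psi
  rw [abs_le]
  constructor <;> linarith

lemma prime_sum_psi_le {γ ε : ℝ} (hγ0 : 13 / 14 ≤ γ) (hγ1 : γ < 1) (hε : 0 < ε) :
    ∃ C > 0, ∀ (θ : ℝ) (N : ℕ), 1 ≤ N →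
      ‖∑ p ∈ (range (N + 1)).filter Nat.Prime,
          ((psi (-(((p : ℝ) + 1) ^ γ)) - psi (-((p : ℝ) ^ γ)) : ℝ) : ℂ) *
            e2pi (θ * (p : ℝ) ^ 2) * (Real.log p : ℂ)‖ ≤
        C * (N : ℝ) ^ ((15 * γ + 13) / 29 + ε) := by
  obtain ⟨D, hD⟩ := Chebyshev.psi_sub_theta_le_mul_sqrt
  set s := (15 * γ + 13) / 29 + ε with hs
  have hs0 : 1 / 2 < s := by rw [hs]; linarith
  set B := 2 * psiConst γ * (1 + 7 / ε) ^ 7 with hB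
  have hB0 : 0 ≤ B := by
    have := linConst_nonneg hγ0 hγ1
    have := mangoldtConst_nonneg hγ0 hγ1
    have : 0 ≤ psiConst γ := by unfold psiConst; positivity
    positivity
  set K := B / (1 - (2 / 3) ^ s) with hK
  have hK0 : 0 ≤ K := div_nonneg hB0
    (sub_nonneg.2 (Real.rpow_le_one (by norm_num) (by norm_num) (by linarith)))
  refine ⟨2 * K + |D| + 1, by positivity, fun θ N hN => ?_⟩
  have hN1 : (1 : ℝ) ≤ N := by exact_mod_cast hN
  set g : ℕ → ℂ := fun n =>
    ((psi (-(((n : ℝ) + 1) ^ γ)) - psi (-((n : ℝ) ^ γ)) : ℝ) : ℂ) * e2pi (θ * (n : ℝ) ^ 2)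
  have hg : ∀ n, ‖g n‖ ≤ 1 := fun n => by
    rw [norm_mul, norm_e2pi, mul_one, Complex.norm_real]
    exact abs_psi_sub_psi_le _ _
  set F : ℝ → ℕ → ℂ := fun c n => (ArithmeticFunction.vonMangoldt n : ℂ) *
    e2pi (θ * (n : ℝ) ^ 2) * (psi (-((n + c : ℝ) ^ γ)) : ℂ)
  have hF : ∀ c : ℝ, 0 ≤ c → c ≤ 1 → ‖∑ n ∈ Ioc 1 N, F c n‖ ≤ K * (N : ℝ) ^ s :=
    fun c hc0 hc1 => norm_sum_Ioc_le_of_dyadic (F c) hB0 (by linarith)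
      (fun L L' hL hL' => block_psi_le_rpow hγ0 hγ1 hε hc0 hc1 hL θ L' hL') N
  have hΛ : ∑ n ∈ Ioc 0 N, g n * (ArithmeticFunction.vonMangoldt n : ℂ) =
      ∑ n ∈ Ioc 1 N, F 1 n - ∑ n ∈ Ioc 1 N, F 0 n := by
    rw [← Finset.sum_Ioc_consecutive _ (Nat.zero_le 1) hN, ← Finset.sum_sub_distrib]
    simp only [Nat.Ioc_succ_singleton, zero_add, sum_singleton,
      ArithmeticFunction.vonMangoldt_apply_one, Complex.ofReal_zero, mul_zero]
    refine Finset.sum_congr rfl fun n _ => ?_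
    simp only [g, F, add_zero, Complex.ofReal_sub]
    ring
  have hsplit : ∑ n ∈ Ioc 0 N, g n * (ArithmeticFunction.vonMangoldt n : ℂ) =
      ∑ p ∈ (range (N + 1)).filter Nat.Prime, g p * (Real.log p : ℂ) +
      ∑ n ∈ (Ioc 0 N).filter (fun n => ¬ n.Prime),
        g n * (ArithmeticFunction.vonMangoldt n : ℂ) := by
    rw [← Finset.sum_filter_add_sum_filter_not (Ioc 0 N) Nat.Prime]
    congr 1
    have : (Ioc 0 N).filter Nat.Prime = (range (N + 1)).filter Nat.Prime := by
      ext p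
      simp only [mem_filter, mem_Ioc, mem_range, Order.lt_add_one_iff]
      exact ⟨fun h => ⟨h.1.2, h.2⟩, fun h => ⟨⟨h.2.pos, h.1⟩, h.2⟩⟩
    rw [this]
    refine Finset.sum_congr rfl fun p hp => ?_
    rw [ArithmeticFunction.vonMangoldt_apply_prime (mem_filter.1 hp).2]
  have hrest : ‖∑ n ∈ (Ioc 0 N).filter (fun n => ¬ n.Prime),
      g n * (ArithmeticFunction.vonMangoldt n : ℂ)‖ ≤ |D| * (N : ℝ) ^ s := by
    calc _ ≤ ∑ n ∈ (Ioc 0 N).filter (fun n => ¬ n.Prime), ArithmeticFunction.vonMangoldt n := by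
          refine norm_sum_le_of_le _ fun n _ => ?_
          rw [norm_mul, Complex.norm_real,
            Real.norm_of_nonneg ArithmeticFunction.vonMangoldt_nonneg]
          exact mul_le_of_le_one_left ArithmeticFunction.vonMangoldt_nonneg (hg n)
      _ = Chebyshev.psi N - Chebyshev.theta N := by
          rw [Chebyshev.psi_sub_theta_eq_sum_not_prime, Nat.floor_natCast]
      _ ≤ |D| * √(N : ℝ) := (hD N).trans (by gcongr; exact le_abs_self D)
      _ ≤ |D| * (N : ℝ) ^ s := by
          rw [Real.sqrt_eq_rpow]
          gcongr
  have hmain : ∑ p ∈ (range (N + 1)).filter Nat.Prime, g p * (Real.log p : ℂ) =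
      ∑ n ∈ Ioc 1 N, F 1 n - ∑ n ∈ Ioc 1 N, F 0 n -
      ∑ n ∈ (Ioc 0 N).filter (fun n => ¬ n.Prime),
        g n * (ArithmeticFunction.vonMangoldt n : ℂ) := by
    rw [← hΛ, hsplit, add_sub_cancel_right]
  change ‖∑ p ∈ (range (N + 1)).filter Nat.Prime, g p * (Real.log p : ℂ)‖ ≤ _
  rw [hmain]
  have hpos : 0 ≤ (N : ℝ) ^ s := by positivity
  have := norm_sub_le (∑ n ∈ Ioc 1 N, F 1 n - ∑ n ∈ Ioc 1 N, F 0 n)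
    (∑ n ∈ (Ioc 0 N).filter (fun n => ¬ n.Prime),
        g n * (ArithmeticFunction.vonMangoldt n : ℂ))
  have := norm_sub_le (∑ n ∈ Ioc 1 N, F 1 n) (∑ n ∈ Ioc 1 N, F 0 n)
  have := hF 1 zero_le_one le_rfl
  have := hF 0 le_rfl zero_le_one
  nlinarith

end

theorem Sigma_bound (γ ε : ℝ) (hγ1 : 13 / 14 < γ) (hγ2 : γ < 1) (hε : 0 < ε) :
    ∃ C > 0, ∃ q₀ : ℕ, ∀ (α : ℝ) (a : ℤ) (q h : ℕ),
      Irrational α → q₀ ≤ q → 2 ≤ q → Int.gcd a (q : ℤ) = 1 → a ≠ 0 →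
      |α - (a : ℝ) / (q : ℝ)| < 1 / (q : ℝ) ^ 2 →
      1 ≤ h → (h : ℝ) ≤ Real.sqrt q →
      ‖∑ p ∈ (Finset.range (⌊(q : ℝ) ^ (29 / (55 - 28 * γ))⌋₊ + 1)).filter Nat.Prime,
          ((psi (-(((p : ℝ) + 1) ^ γ)) - psi (-((p : ℝ) ^ γ)) : ℝ) : ℂ) *
            e2pi (α * (h : ℝ) * (p : ℝ) ^ 2) * (Real.log p : ℂ)‖ ≤
        C * ((q : ℝ) ^ (29 / (55 - 28 * γ))) ^ ((15 * γ + 13) / 29 + ε) := by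
  obtain ⟨C, hC, hbound⟩ := prime_sum_psi_le hγ1.le hγ2 hε
  refine ⟨C, hC, 0, fun α a q h _ _ hq _ _ _ _ _ => ?_⟩
  have hq1 : (1 : ℝ) ≤ q := by exact_mod_cast (by omega : 1 ≤ q)
  have hX : 1 ≤ (q : ℝ) ^ (29 / (55 - 28 * γ)) :=
    Real.one_le_rpow hq1 (div_nonneg (by norm_num) (by linarith))
  refine (hbound (α * h) _ ((Nat.one_le_floor_iff _).2 hX)).trans ?_
  refine mul_le_mul_of_nonneg_left (Real.rpow_le_rpow (Nat.cast_nonneg _)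
    (Nat.floor_le (by positivity)) ?_) hC.le
  linarith
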